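/- Let f_1, …, f_r be E-functions. There exists a finite set S ⊂ ℚ̄ such that for every nonzero algebraic number α, if there exists a non-banal homogeneous algebraic relation over ℚ̄ among f_1(α), …, f_r(α) (i.e., a homogeneous P ∈ ℚ̄[X_1,…,X_r] with P(f_1(α),…,f_r(α)) = 0 which is not banal), then α ∈ S. -/

import Mathlib

noncomputable section

/-- The derivative `d/dz` of a formal power series over `ℂ`. -/
def psD (f : PowerSeries ℂ) : PowerSeries ℂ :=
  PowerSeries.mk fun n => ((n : ℂ) + 1) * PowerSeries.coeff (n + 1) f

/-- The Mahler operator `σ_q : f(z) ↦ f(z^q)` on formal power series over `ℂ`. -/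
def psSigma (q : ℕ) (f : PowerSeries ℂ) : PowerSeries ℂ :=
  PowerSeries.mk fun n => if q ∣ n then PowerSeries.coeff (n / q) f else 0

/-- The canonical embedding of polynomials into power series. -/
def polyPS : Polynomial ℂ →+* PowerSeries ℂ := Polynomial.coeToPowerSeries.ringHom

/-- The power series `∑ (a n / n!) zⁿ` attached to a sequence `a` of coefficients. -/
def ePS (a : ℕ → ℂ) : PowerSeries ℂ := PowerSeries.mk fun n => a n / (n.factorial : ℂ)

/-- `IsE a` : the power series `∑ (a n / n!) zⁿ` is an E-function: its coefficients are
algebraic, it satisfies a nonzero linear differential equation over `ℚ̄[z]`, and the size of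
the conjugates of the `a n` as well as their common denominators grow at most geometrically. -/
def IsE (a : ℕ → ℂ) : Prop :=
  (∀ n, IsAlgebraic ℚ (a n)) ∧
  (∃ (m : ℕ) (p : ℕ → Polynomial ℂ),
      (∀ i k, IsAlgebraic ℚ ((p i).coeff k)) ∧ (∃ i, i ≤ m ∧ p i ≠ 0) ∧
      ∑ i ∈ Finset.range (m + 1), polyPS (p i) * psD^[i] (ePS a) = 0) ∧
  (∃ C : ℝ, 0 < C ∧ ∃ d : ℕ → ℕ, ∀ n : ℕ, 1 ≤ n →
      1 ≤ d n ∧ (d n : ℝ) ≤ C ^ n ∧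
      (∀ σ : (integralClosure ℚ ℂ) →+* ℂ, ∀ h : a n ∈ integralClosure ℚ ℂ,
        ‖σ ⟨a n, h⟩‖ ≤ C ^ n) ∧
      (∀ i, 1 ≤ i → i ≤ n → IsIntegral ℤ ((d n : ℂ) * a i)))

/-- The value at `α` of the E-function with coefficient sequence `a`
(E-functions are entire, so this series converges for all `α`). -/
def evalE (a : ℕ → ℂ) (α : ℂ) : ℂ := ∑' n : ℕ, a n / (n.factorial : ℂ) * α ^ n

/-- `IsM q f` : the formal power series `f` is an M_q-function, i.e. it has algebraic
coefficients and satisfies a linear `σ_q`-difference equation over `ℚ̄[z]` with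
not-all-zero polynomial coefficients. -/
def IsM (q : ℕ) (f : PowerSeries ℂ) : Prop :=
  (∀ n, IsAlgebraic ℚ (PowerSeries.coeff n f)) ∧
  ∃ (m : ℕ) (p : ℕ → Polynomial ℂ),
    (∀ i k, IsAlgebraic ℚ ((p i).coeff k)) ∧ (∃ i, i ≤ m ∧ p i ≠ 0) ∧
    ∑ i ∈ Finset.range (m + 1), polyPS (p i) * (psSigma q)^[i] f = 0

/-- `MahlerValue f α v` : the meromorphic extension of (the sum of) the power series `f`
to the open unit disk has no pole at `α` and takes the value `v` there. -/
def MahlerValue (f : PowerSeries ℂ) (α v : ℂ) : Prop :=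
  ∃ F : ℂ → ℂ, MeromorphicOn F (Metric.ball (0 : ℂ) 1) ∧
    (∀ᶠ z in nhds (0 : ℂ), HasSum (fun n => PowerSeries.coeff n f * z ^ n) (F z)) ∧
    AnalyticAt ℂ F α ∧ F α = v

/-- The power series `f` converges (hence defines an analytic function) on the open
disk `D(0,R)`. -/
def AnOnBall (f : PowerSeries ℂ) (R : ℝ) : Prop :=
  ∀ z : ℂ, ‖z‖ < R → Summable fun n => PowerSeries.coeff n f * z ^ n

/-- The value at `z` of (the sum of) the power series `f`. -/
def psEval (f : PowerSeries ℂ) (z : ℂ) : ℂ := ∑' n : ℕ, PowerSeries.coeff n f * z ^ n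

/-- `Banal fv α P` : the homogeneous algebraic relation `P` among the values at `α` of the
power series `fv 1, …, fv r` is banal: it is the specialization at `z = α` of some
`Q ∈ ℚ̄[z, X₁, …, X_r]`, homogeneous in `X₁, …, X_r`, with `Q(z, fv 1, …, fv r) = 0`. -/
def Banal {r : ℕ} (fv : Fin r → PowerSeries ℂ) (α : ℂ) (P : MvPolynomial (Fin r) ℂ) : Prop :=
  ∃ Q : MvPolynomial (Fin r) (Polynomial ℂ),
    (∀ v k, IsAlgebraic ℚ ((MvPolynomial.coeff v Q).coeff k)) ∧
    (∃ e, Q.IsHomogeneous e) ∧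
    MvPolynomial.eval₂ polyPS fv Q = 0 ∧
    MvPolynomial.map (Polynomial.evalRingHom α) Q = P

/-- `Eset S` : the set of values at `z = 1` of all E-functions with coefficients in `S`. -/
def Eset (S : Set ℂ) : Set ℂ :=
  {x | ∃ a : ℕ → ℂ, IsE a ∧ (∀ n, a n ∈ S) ∧ x = evalE a 1}

/-- `Mset q α S` : the set of values at `α` of all M_q-functions with coefficients in `S`
having no pole at `α`. -/
def Mset (q : ℕ) (α : ℂ) (S : Set ℂ) : Set ℂ :=
  {x | ∃ f : PowerSeries ℂ, IsM q f ∧ (∀ n, PowerSeries.coeff n f ∈ S) ∧ MahlerValue f α x}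

set_option linter.unusedSectionVars false

namespace EFun
open scoped Polynomial ENNReal
open Matrix NumberField

/-! ### Nonvanishing minors -/

theorem exists_minor_ne_zero_field {F m : Type*} [Field F] [Finite m] {l : ℕ}
    (A : Matrix m (Fin l) F) (h : ∀ v : Fin l → F, A *ᵥ v = 0 → v = 0) :
    ∃ I : Fin l → m, (A.submatrix I id).det ≠ 0 := by
  classical
  cases nonempty_fintype m
  have hspan : Module.finrank F (Submodule.span F (Set.range A)) = l := by
    have h1 := A.rank_eq_finrank_span_row
    have h2 : LinearIndependent F A.col := by
      rw [← Matrix.mulVec_injective_iff]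
      intro v w hvw
      have := h (v - w) (by rw [Matrix.mulVec_sub, sub_eq_zero]; exact hvw)
      exact sub_eq_zero.1 this
    have h3 : A.rank = l := by
      rw [← Matrix.rank_transpose, LinearIndependent.rank_matrix (M := Aᵀ) h2, Fintype.card_fin]
    rw [h3] at h1
    exact h1.symm
  obtain ⟨f, hf, -, hli⟩ := Submodule.exists_fun_fin_finrank_span_eq F (Set.range A)
  have hli' : LinearIndependent F (f ∘ Fin.cast hspan.symm) :=
    hli.comp _ (Fin.cast_injective _)
  choose I hI using fun i : Fin l => hf (Fin.cast hspan.symm i)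
  refine ⟨I, ?_⟩
  have h4 : LinearIndependent F (A.submatrix I id).row := by
    convert hli' using 1
    funext i
    exact hI i
  rw [Matrix.linearIndependent_rows_iff_isUnit, Matrix.isUnit_iff_isUnit_det] at h4
  exact h4.ne_zero

theorem exists_minor_ne_zero {R m : Type*} [CommRing R] [IsDomain R] [Finite m] {l : ℕ}
    (A : Matrix m (Fin l) R) (h : ∀ v : Fin l → R, A *ᵥ v = 0 → v = 0) :
    ∃ I : Fin l → m, (A.submatrix I id).det ≠ 0 := by
  classical
  cases nonempty_fintype m
  let K := FractionRing R
  obtain ⟨I, hI⟩ := exists_minor_ne_zero_field (A.map (algebraMap R K)) (by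
    intro v hv
    obtain ⟨b, hb⟩ := IsLocalization.exist_integer_multiples_of_finite (nonZeroDivisors R) v
    choose w hw using hb
    have hw0 : w = 0 := by
      apply h
      funext i
      apply IsFractionRing.injective R K
      have := congrFun hv i
      simp only [Matrix.mulVec, dotProduct, Matrix.map_apply, Pi.zero_apply] at this ⊢
      rw [map_sum, map_zero]
      have h2 : ∑ j, algebraMap R K (A i j * w j) =
          algebraMap R K b * ∑ j, algebraMap R K (A i j) * v j := by
        rw [Finset.mul_sum]
        refine Finset.sum_congr rfl fun j _ => ?_
        rw [map_mul, hw j, Algebra.smul_def]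
        ring
      rw [h2, this, mul_zero]
    funext j
    have := hw j
    rw [hw0, Pi.zero_apply, map_zero, Algebra.smul_def] at this
    have hb0 : algebraMap R K b ≠ 0 := by
      have := nonZeroDivisors.ne_zero b.2
      simp [this]
    rcases mul_eq_zero.1 this.symm with h5 | h5
    · exact absurd h5 hb0
    · exact h5)
  refine ⟨I, fun h0 => hI ?_⟩
  have := RingHom.map_det (algebraMap R K) (A.submatrix I id)
  rw [h0, map_zero] at this
  rw [this]
  rfl

theorem exists_row_minor_ne_zero {R n : Type*} [CommRing R] [IsDomain R] [Finite n] {l : ℕ}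
    (A : Matrix (Fin l) n R) (h : ∀ v : Fin l → R, v ᵥ* A = 0 → v = 0) :
    ∃ I : Fin l → n, (A.submatrix id I).det ≠ 0 := by
  cases nonempty_fintype n
  obtain ⟨I, hI⟩ := exists_minor_ne_zero Aᵀ (fun v hv => h v (by rwa [Matrix.mulVec_transpose] at hv))
  refine ⟨I, ?_⟩
  rwa [← Matrix.det_transpose, Matrix.transpose_submatrix]

/-! ### Formal linear differential systems -/

section ODE
variable {k : Type*} [Field k] [CharZero k]
open PowerSeries

/-- Coefficients of the formal solution of `y' = A y`, `y(0) = v`. -/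
def odeCoeff {n : ℕ} (A : Matrix (Fin n) (Fin n) k⟦X⟧) (v : Fin n → k) : ℕ → Fin n → k
  | 0 => v
  | m + 1 => fun i => ((m : k) + 1)⁻¹ *
      ∑ p : Fin (m + 1), ∑ j, coeff (m - p) (A i j) * odeCoeff A v p j
decreasing_by exact p.2

theorem ode_exists {n : ℕ} (A : Matrix (Fin n) (Fin n) k⟦X⟧) (v : Fin n → k) :
    ∃ y : Fin n → k⟦X⟧, (∀ i, d⁄dX k (y i) = ∑ j, A i j * y j) ∧
      ∀ i, constantCoeff (y i) = v i := by
  refine ⟨fun i => PowerSeries.mk fun m => odeCoeff A v m i, fun i => ?_, fun i => ?_⟩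
  · ext m
    rw [coeff_derivative, coeff_mk, odeCoeff, map_sum]
    have hm : ((m : k) + 1) ≠ 0 := by exact_mod_cast Nat.succ_ne_zero m
    field_simp
    rw [Finset.sum_comm]
    refine Finset.sum_congr rfl fun j _ => ?_
    rw [coeff_mul, Finset.Nat.sum_antidiagonal_eq_sum_range_succ_mk, Finset.sum_range,
      ← Equiv.sum_comp Fin.revPerm]
    refine Finset.sum_congr rfl fun p _ => ?_
    have : (p : ℕ) ≤ m := Nat.lt_succ_iff.1 p.2
    simp only [Fin.revPerm_apply, Fin.val_rev, coeff_mk]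
    have e1 : m + 1 - (p + 1) = m - p := by omega
    have e2 : m - (m - p) = (p : ℕ) := by omega
    rw [e1, e2]
  · rw [← coeff_zero_eq_constantCoeff_apply, coeff_mk, odeCoeff]

theorem X_pow_dvd_of_derivative {m : ℕ} {f : k⟦X⟧} (h : (X : k⟦X⟧) ^ m ∣ d⁄dX k f)
    (h0 : constantCoeff f = 0) : (X : k⟦X⟧) ^ (m + 1) ∣ f := by
  rw [X_pow_dvd_iff] at h ⊢
  intro i hi
  rcases i with _ | i
  · simpa using h0
  · have := h i (by omega)
    rw [coeff_derivative] at this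
    rcases mul_eq_zero.1 this with h1 | h1
    · exact h1
    · exact absurd h1 (by exact_mod_cast Nat.succ_ne_zero i)

theorem X_pow_dvd_derivative {m : ℕ} {f : k⟦X⟧} (h : (X : k⟦X⟧) ^ (m + 1) ∣ f) :
    (X : k⟦X⟧) ^ m ∣ d⁄dX k f := by
  rw [X_pow_dvd_iff] at h ⊢
  intro i hi
  rw [coeff_derivative, h (i + 1) (by omega), zero_mul]

theorem eq_zero_of_X_pow_dvd {f : k⟦X⟧} (h : ∀ m, (X : k⟦X⟧) ^ m ∣ f) : f = 0 := by
  ext i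
  simpa using X_pow_dvd_iff.1 (h (i + 1)) i (Nat.lt_succ_self i)

theorem ode_unique {ι : Type*} [Fintype ι] (A : Matrix ι ι k⟦X⟧) (y : ι → k⟦X⟧)
    (hy : ∀ i, d⁄dX k (y i) = ∑ j, A i j * y j) (h0 : ∀ i, constantCoeff (y i) = 0) : y = 0 := by
  have key : ∀ m i, (X : k⟦X⟧) ^ m ∣ y i := by
    intro m
    induction m with
    | zero => intro i; simp
    | succ m ih =>
      intro i
      refine X_pow_dvd_of_derivative ?_ (h0 i)
      rw [hy]
      exact Finset.dvd_sum fun j _ => (ih j).mul_left _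
  funext i
  exact eq_zero_of_X_pow_dvd fun m => key m i

/-- Two power series with zero Wronskian are proportional. -/
theorem exists_eq_C_mul {x y : k⟦X⟧} (hy : y ≠ 0) (h : y * d⁄dX k x = x * d⁄dX k y) :
    ∃ c : k, x = C c * y := by
  by_contra! hne
  -- subtract the multiple of `y` making the orders differ
  set o := y.order.toNat with ho
  have hyo : coeff o y ≠ 0 := coeff_order hy
  set c := coeff o x / coeff o y with hc
  set w := x - C c * y with hw
  have hw0 : w ≠ 0 := fun h0 => hne c (sub_eq_zero.1 h0)
  have hww : y * d⁄dX k w = w * d⁄dX k y := by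
    rw [hw, map_sub, Derivation.leibniz, derivative_C]
    simp only [smul_eq_mul]
    linear_combination h
  set p := w.order.toNat with hp
  have hwp : coeff p w ≠ 0 := coeff_order hw0
  have hpo : p ≠ o := by
    intro hpo
    apply hwp
    rw [hpo, hw, map_sub, coeff_C_mul, hc]
    field_simp
    ring
  obtain ⟨y1, hy1⟩ := X_pow_order_dvd (φ := y)
  obtain ⟨w1, hw1⟩ := X_pow_order_dvd (φ := w)
  rw [← ho] at hy1
  rw [← hp] at hw1
  have cy : constantCoeff y1 ≠ 0 := by
    rw [hy1] at hyo
    simpa [coeff_X_pow_mul'] using hyo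
  have cw : constantCoeff w1 ≠ 0 := by
    rw [hw1] at hwp
    simpa [coeff_X_pow_mul'] using hwp
  have e : ∀ (q : ℕ) (g : k⟦X⟧), X * d⁄dX k (X ^ q * g) = X ^ q * ((q : k⟦X⟧) * g + X * d⁄dX k g) := by
    intro q g
    rw [Derivation.leibniz, Derivation.leibniz_pow, derivative_X]
    rcases q with _ | q
    · simp
    · simp only [smul_eq_mul, nsmul_eq_mul, Nat.add_sub_cancel]
      push_cast
      ring
  have h2 : X ^ (o + p) * (y1 * ((p : k⟦X⟧) * w1 + X * d⁄dX k w1)) =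
      X ^ (o + p) * (w1 * ((o : k⟦X⟧) * y1 + X * d⁄dX k y1)) := by
    have h3 : y * (X * d⁄dX k w) = w * (X * d⁄dX k y) := by linear_combination X * hww
    rw [hw1, hy1, e, e] at h3
    linear_combination h3
  have h4 := mul_left_cancel₀ (pow_ne_zero _ X_ne_zero) h2
  have h5 := congrArg constantCoeff h4
  simp only [map_mul, map_add, map_natCast, constantCoeff_X, zero_mul, add_zero] at h5
  apply hpo
  have h6 : constantCoeff y1 * constantCoeff w1 * ((p : k) - o) = 0 := by linear_combination h5
  rcases mul_eq_zero.1 h6 with h7 | h7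
  · exact absurd h7 (mul_ne_zero cy cw)
  · exact_mod_cast sub_eq_zero.1 h7

end ODE

section Shidlovskii
variable {k : Type*} [Field k] [CharZero k]
open PowerSeries

/-- Linear forms `P` act on solutions `y` of `Q y' = B y`; differentiation of `P · y` followed by
multiplication by `Q` corresponds to `nab Q B P`. -/
def nab {n : ℕ} (Q : k[X]) (B : Matrix (Fin n) (Fin n) k[X]) (P : Fin n → k[X]) : Fin n → k[X] :=
  fun j => Q * Polynomial.derivative (P j) + ∑ i, P i * B i j

/-- `y` is a formal solution of `Q y' = B y`. -/
def IsSol {n : ℕ} (Q : k[X]) (B : Matrix (Fin n) (Fin n) k[X]) (y : Fin n → k⟦X⟧) : Prop :=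
  ∀ i, (Q : k⟦X⟧) * d⁄dX k (y i) = ∑ j, (B i j : k⟦X⟧) * y j

/-- The linear form `P` evaluated at `y`. -/
def frm {n : ℕ} (P : Fin n → k[X]) (y : Fin n → k⟦X⟧) : k⟦X⟧ := ∑ i, (P i : k⟦X⟧) * y i

theorem nab_frm {n : ℕ} {Q : k[X]} {B : Matrix (Fin n) (Fin n) k[X]} {y : Fin n → k⟦X⟧}
    (hy : IsSol Q B y) (P : Fin n → k[X]) :
    frm (nab Q B P) y = (Q : k⟦X⟧) * d⁄dX k (frm P y) := by
  simp only [frm, nab, map_sum, Derivation.leibniz, smul_eq_mul, PowerSeries.derivative_coe,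
    Finset.mul_sum, Polynomial.coe_add, Polynomial.coe_mul, add_mul, Finset.sum_add_distrib, mul_add]
  rw [add_comm]
  congr 1
  · have : ∀ j, ((∑ i, P i * B i j : k[X]) : k⟦X⟧) = ∑ i, (P i : k⟦X⟧) * (B i j : k⟦X⟧) := by
      intro j
      rw [← Polynomial.coeToPowerSeries.ringHom_apply, map_sum]
      simp
    simp only [this, Finset.sum_mul]
    rw [Finset.sum_comm]
    refine Finset.sum_congr rfl fun i _ => ?_
    rw [mul_left_comm, hy i, Finset.mul_sum]
    exact Finset.sum_congr rfl fun j _ => by ring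
  · exact Finset.sum_congr rfl fun i _ => by ring

theorem nab_iter_frm {n : ℕ} {Q : k[X]} {B : Matrix (Fin n) (Fin n) k[X]} {y : Fin n → k⟦X⟧}
    (hy : IsSol Q B y) (P : Fin n → k[X]) (m : ℕ) :
    frm ((nab Q B)^[m + 1] P) y = (Q : k⟦X⟧) * d⁄dX k (frm ((nab Q B)^[m] P) y) := by
  rw [Function.iterate_succ_apply', nab_frm hy]

theorem exists_sol {n : ℕ} (Q : k[X]) (B : Matrix (Fin n) (Fin n) k[X]) (hQ : Q.coeff 0 ≠ 0)
    (v : Fin n → k) : ∃ y, IsSol Q B y ∧ ∀ i, constantCoeff (y i) = v i := by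
  have hQ' : constantCoeff (Q : k⟦X⟧) ≠ 0 := by simpa using hQ
  obtain ⟨y, h1, h2⟩ := ode_exists (fun i j => (Q : k⟦X⟧)⁻¹ * (B i j : k⟦X⟧)) v
  refine ⟨y, fun i => ?_, h2⟩
  rw [h1, Finset.mul_sum]
  refine Finset.sum_congr rfl fun j _ => ?_
  rw [← mul_assoc, ← mul_assoc, PowerSeries.mul_inv_cancel _ hQ', one_mul]

theorem exists_fundamental {n : ℕ} (Q : k[X]) (B : Matrix (Fin n) (Fin n) k[X])
    (hQ : Q.coeff 0 ≠ 0) :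
    ∃ Y : Matrix (Fin n) (Fin n) k⟦X⟧, (∀ j, IsSol Q B fun i => Y i j) ∧ IsUnit Y.det := by
  choose y hy hy0 using fun j : Fin n => exists_sol Q B hQ (Pi.single j 1)
  refine ⟨Matrix.of fun i j => y j i, hy, ?_⟩
  rw [PowerSeries.isUnit_iff_constantCoeff, RingHom.map_det]
  have : (constantCoeff (R := k)).mapMatrix (Matrix.of fun i j => y j i) = 1 := by
    ext i j
    simp [hy0, Matrix.one_apply, Pi.single_apply]
  rw [this]
  simp

theorem prod_mem_pow {A ι : Type*} [CommRing A] [Algebra k A] (S : Submodule k A)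
    (s : Finset ι) (f : ι → A) (h : ∀ i ∈ s, f i ∈ S) : ∏ i ∈ s, f i ∈ S ^ s.card := by
  classical
  induction s using Finset.induction_on with
  | empty => simp [Submodule.one_le.1 le_rfl]
  | insert a s ha ih =>
    rw [Finset.prod_insert ha, Finset.card_insert_of_notMem ha, pow_succ']
    exact Submodule.mul_mem_mul (h a (by simp)) (ih fun i hi => h i (by simp [hi]))

theorem det_mem_pow {A ι : Type*} [CommRing A] [Algebra k A] [Fintype ι] [DecidableEq ι]
    (S : Submodule k A) (M : Matrix ι ι A) (h : ∀ i j, M i j ∈ S) :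
    M.det ∈ S ^ Fintype.card ι := by
  rw [Matrix.det_apply]
  refine Submodule.sum_mem _ fun σ _ => ?_
  have := prod_mem_pow S Finset.univ (fun i => M (σ i) i) fun i _ => h _ _
  rw [Finset.card_univ] at this
  rcases Int.units_eq_one_or (Equiv.Perm.sign σ) with h1 | h1 <;> simp only [h1]
  · simpa using this
  · simpa using this

theorem smul_ps (p : k[X]) (x : k⟦X⟧) : p • x = (p : k⟦X⟧) * x := by
  rw [Algebra.smul_def, PowerSeries.algebraMap_apply']
  simp

theorem torsionFree_ps : Module.IsTorsionFree k[X] k⟦X⟧ := by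
  rw [Module.isTorsionFree_iff_smul_eq_zero]
  intro p x h
  rw [smul_ps] at h
  rcases mul_eq_zero.1 h with h | h
  · left; exact_mod_cast h
  · right; exact h

/-- Ratios of polynomials that are ratios of elements of a fixed finite-dimensional space of
power series have bounded degree. -/
theorem bounded_ratio (G : Submodule k k⟦X⟧) (hG : G.FG) :
    ∃ c : ℕ, ∀ x ∈ G, ∀ y ∈ G, y ≠ 0 → ∀ a b : k[X], (a : k⟦X⟧) * y = (b : k⟦X⟧) * x →
      ∃ p q : k[X], p.natDegree ≤ c ∧ q.natDegree ≤ c ∧ q ≠ 0 ∧ a * q = b * p := by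
  classical
  obtain ⟨s, hs⟩ := hG
  let N := Submodule.span k[X] (s : Set k⟦X⟧)
  have : Module.Finite k[X] N := Module.Finite.span_of_finite _ s.finite_toSet
  have := torsionFree_ps (k := k)
  let e := Module.Free.chooseBasis k[X] N
  let ι := Module.Free.ChooseBasisIndex k[X] N
  have hGN : ∀ x ∈ G, x ∈ N := by
    intro x hx
    rw [← hs] at hx
    exact Submodule.span_le_restrictScalars k k[X] _ hx
  have hd : ∀ z : s, ∃ d : ℕ, ∀ i : ι,
      (e.repr ⟨z.1, Submodule.subset_span z.2⟩ i).natDegree ≤ d := fun z =>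
    ⟨Finset.univ.sup fun i => (e.repr ⟨z.1, Submodule.subset_span z.2⟩ i).natDegree,
      fun i => Finset.le_sup (f := fun i =>
        (e.repr ⟨z.1, Submodule.subset_span z.2⟩ i).natDegree) (Finset.mem_univ i)⟩
  choose d hd using hd
  obtain ⟨c, hc⟩ : ∃ c, ∀ z, d z ≤ c :=
    ⟨∑ z, d z, fun z => Finset.single_le_sum (fun _ _ => Nat.zero_le _) (Finset.mem_univ z)⟩
  have hdeg : ∀ x (hx : x ∈ G) (i : ι), (e.repr ⟨x, hGN x hx⟩ i).natDegree ≤ c := by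
    intro x hx i
    have hx' : x ∈ Submodule.span k (s : Set k⟦X⟧) := hs ▸ hx
    suffices h : ∃ h : x ∈ N, e.repr ⟨x, h⟩ i ∈ Polynomial.degreeLE k c by
      obtain ⟨h1, h2⟩ := h
      exact Polynomial.natDegree_le_iff_degree_le.2 (Polynomial.mem_degreeLE.1 h2)
    clear hx
    induction hx' using Submodule.span_induction with
    | mem z hz =>
      refine ⟨Submodule.subset_span hz, ?_⟩
      rw [Polynomial.mem_degreeLE, ← Polynomial.natDegree_le_iff_degree_le]
      exact (hd ⟨z, hz⟩ i).trans (hc _)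
    | zero => exact ⟨N.zero_mem, by
        have : (⟨0, N.zero_mem⟩ : N) = 0 := rfl
        rw [this, map_zero]; exact Submodule.zero_mem _⟩
    | add x y hx hy h1 h2 =>
      obtain ⟨h1, h1'⟩ := h1
      obtain ⟨h2, h2'⟩ := h2
      refine ⟨N.add_mem h1 h2, ?_⟩
      have : (⟨x + y, N.add_mem h1 h2⟩ : N) = ⟨x, h1⟩ + ⟨y, h2⟩ := rfl
      rw [this, map_add]
      exact Submodule.add_mem _ h1' h2'
    | smul a x hx h1 =>
      obtain ⟨h1, h1'⟩ := h1
      have e1 : a • x = (Polynomial.C a : k[X]) • x := by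
        rw [smul_ps, Polynomial.coe_C, PowerSeries.smul_eq_C_mul]
      have h2 : a • x ∈ N := e1 ▸ N.smul_mem _ h1
      refine ⟨h2, ?_⟩
      have : (⟨a • x, h2⟩ : N) = (Polynomial.C a : k[X]) • ⟨x, h1⟩ := Subtype.ext e1
      rw [this, map_smul, Finsupp.smul_apply, smul_eq_mul, ← Polynomial.smul_eq_C_mul]
      exact Submodule.smul_mem _ _ h1'
  refine ⟨c, fun x hx y hy hy0 a b hab => ?_⟩
  have hne : e.repr ⟨y, hGN y hy⟩ ≠ 0 := by
    intro h
    have h1 := (LinearEquiv.map_eq_zero_iff _).1 h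
    exact hy0 (congrArg Subtype.val h1)
  obtain ⟨i, hi⟩ := Finsupp.ne_iff.1 hne
  refine ⟨_, _, hdeg x hx i, hdeg y hy i, hi, ?_⟩
  have h1 : a • (⟨y, hGN y hy⟩ : N) = b • ⟨x, hGN x hx⟩ := by
    apply Subtype.ext
    simpa [smul_ps] using hab
  have h2 := congrArg (fun z => e.repr z i) h1
  simp only [map_smul, Finsupp.smul_apply, smul_eq_mul] at h2
  exact h2

end Shidlovskii

section Shidlovskii
variable {k : Type*} [Field k] [CharZero k]
open PowerSeries

/-- A matrix of power series whose rows span a space stable under differentiation is, up to a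
square factor, constant. -/
theorem exists_constant_factor {l n : ℕ} (T : Matrix (Fin l) (Fin n) k⟦X⟧) (I : Fin l → Fin n)
    (hI : (T.submatrix id I).det ≠ 0) (G : k⟦X⟧) (hG : G ≠ 0) (H : Matrix (Fin l) (Fin l) k⟦X⟧)
    (hT : ∀ i j, G * d⁄dX k (T i j) = ∑ p, H i p * T p j) :
    ∃ V : Matrix (Fin l) (Fin n) k, T = T.submatrix id I * V.map C := by
  set M := T.submatrix id I with hM
  set w := M.det with hw
  set v := M.adjugate * T with hv
  have h1 : M * v = w • T := by
    rw [hv, ← Matrix.mul_assoc, Matrix.mul_adjugate, Matrix.smul_mul, Matrix.one_mul]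
  have h2 : M * v.map (d⁄dX k) = d⁄dX k w • T := by
    ext1 i j
    apply mul_left_cancel₀ hG
    have h3 := congrFun (congrFun h1 i) j
    rw [Matrix.mul_apply, Matrix.smul_apply, smul_eq_mul] at h3
    have h4 := congrArg (fun z => G * d⁄dX k z) h3
    simp only [map_sum, Derivation.leibniz, smul_eq_mul] at h4
    have h5 : ∑ p, v p j * (G * d⁄dX k (M i p)) = w * (G * d⁄dX k (T i j)) := by
      rw [hT]
      have : ∀ p, G * d⁄dX k (M i p) = ∑ q, H i q * M q p := fun p => hT i (I p)
      simp only [this, Finset.mul_sum]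
      rw [Finset.sum_comm]
      refine Finset.sum_congr rfl fun q _ => ?_
      have h6 := congrFun (congrFun h1 q) j
      rw [Matrix.mul_apply, Matrix.smul_apply, smul_eq_mul] at h6
      rw [mul_left_comm, ← h6, Finset.mul_sum]
      exact Finset.sum_congr rfl fun p _ => by ring
    rw [Matrix.mul_apply, Matrix.smul_apply, smul_eq_mul]
    simp only [Matrix.map_apply]
    rw [Finset.sum_add_distrib, mul_add] at h4
    have h7 : G * ∑ p, v p j * d⁄dX k (M i p) = ∑ p, v p j * (G * d⁄dX k (M i p)) := by
      rw [Finset.mul_sum]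
      exact Finset.sum_congr rfl fun p _ => by ring
    rw [h7, h5] at h4
    linear_combination h4
  have h3 : w • v.map (d⁄dX k) = d⁄dX k w • v := by
    have := congrArg (fun z => M.adjugate * z) h2
    simp only [Matrix.mul_smul] at this
    rw [← Matrix.mul_assoc, Matrix.adjugate_mul, Matrix.smul_mul, Matrix.one_mul] at this
    exact this
  have h4 : ∀ i j, ∃ c : k, v i j = C c * w := by
    intro i j
    apply exists_eq_C_mul hI
    have := congrFun (congrFun h3 i) j
    simp only [Matrix.smul_apply, smul_eq_mul, Matrix.map_apply] at this
    rw [this, mul_comm]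
  choose V hV using h4
  refine ⟨Matrix.of V, ?_⟩
  have h5 : v = w • (Matrix.of V).map C := by
    ext1 i j
    simp [hV, mul_comm]
  rw [h5, Matrix.mul_smul] at h1
  ext1 i j
  have := congrFun (congrFun h1 i) j
  simp only [Matrix.smul_apply, smul_eq_mul] at this
  exact (mul_left_cancel₀ hI this).symm

theorem coe_sum_poly {ι : Type*} (s : Finset ι) (f : ι → k[X]) :
    ((∑ i ∈ s, f i : k[X]) : k⟦X⟧) = ∑ i ∈ s, (f i : k⟦X⟧) := by
  rw [← Polynomial.coeToPowerSeries.ringHom_apply, map_sum]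
  simp

theorem coe_det_poly {l : ℕ} (M : Matrix (Fin l) (Fin l) k[X]) :
    ((M.det : k[X]) : k⟦X⟧) = (M.map fun p : k[X] => (p : k⟦X⟧)).det := by
  rw [← Polynomial.coeToPowerSeries.ringHom_apply, RingHom.map_det]
  rfl

/-- If the iterates `P, ∇P, …, ∇ⁿ⁻¹P` are dependent, the space they span contains a nonzero vector
of bounded degree. -/
theorem exists_bounded_vector {n : ℕ} (Q : k[X]) (B : Matrix (Fin n) (Fin n) k[X])
    (hQ : Q.coeff 0 ≠ 0) :
    ∃ c : ℕ, ∀ P : Fin n → k[X], P ≠ 0 →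
      (Matrix.of fun i : Fin n => (nab Q B)^[i] P).det = 0 →
      ∃ l < n, ∃ (g : Fin l → k[X]) (I : Fin l → Fin n) (s : Fin n → k[X]), s ≠ 0 ∧
        (∀ j, (s j).natDegree ≤ c) ∧
        (Matrix.of fun i j : Fin l => (nab Q B)^[i] P (I j)).det ≠ 0 ∧
        ∀ j, (Matrix.of fun i j : Fin l => (nab Q B)^[i] P (I j)).det * s j =
          ∑ i, g i * (nab Q B)^[i] P j := by
  classical
  obtain ⟨Y, hY, hYu⟩ := exists_fundamental Q B hQ
  let S : Submodule k k⟦X⟧ := Submodule.span k (Set.range fun p : Fin n × Fin n => Y⁻¹ p.1 p.2)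
  have hSfg : S.FG := Submodule.fg_span (Set.finite_range _)
  choose c hc using fun l : ℕ => bounded_ratio (S ^ l) (hSfg.pow l)
  refine ⟨n * ∑ l ∈ Finset.range n, c l, fun P hP hdet => ?_⟩
  let Pk : ℕ → Fin n → k[X] := fun i => (nab Q B)^[i] P
  let dep : ℕ → Prop := fun m => ∃ v : Fin m → k[X], v ≠ 0 ∧
    v ᵥ* (Matrix.of fun i : Fin m => Pk i) = 0
  have hdepn : dep n := Matrix.exists_vecMul_eq_zero_iff.2 hdet
  have hex : ∃ m, dep m := ⟨n, hdepn⟩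
  obtain ⟨m, hm, hmin⟩ : ∃ m, dep m ∧ ∀ m' < m, ¬ dep m' :=
    ⟨Nat.find hex, Nat.find_spec hex, fun m' h => Nat.find_min hex h⟩
  have hmn : m ≤ n := not_lt.1 fun h => hmin n h hdepn
  rcases m with _ | l
  · obtain ⟨v, hv, -⟩ := hm
    exact absurd (Subsingleton.elim v 0) hv
  have hl0 : 0 < l := by
    rcases Nat.eq_zero_or_pos l with rfl | h
    · exfalso
      obtain ⟨v, hv, hv2⟩ := hm
      apply hP
      funext j
      have h1 := congrFun hv2 j
      simp only [Matrix.vecMul, dotProduct, Fin.sum_univ_succ, Fin.sum_univ_zero, add_zero,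
        Matrix.of_apply, Pi.zero_apply] at h1
      rcases mul_eq_zero.1 h1 with h2 | h2
      · exact absurd (funext fun i => by rw [Fin.eq_zero i]; exact h2) hv
      · exact h2
    · exact h
  have hind : ∀ v : Fin l → k[X], v ᵥ* (Matrix.of fun i : Fin l => Pk i) = 0 → v = 0 := by
    intro v hv
    by_contra h
    exact hmin l (Nat.lt_succ_self l) ⟨v, h, hv⟩
  obtain ⟨v, hv0, hv⟩ := hm
  have hvl : v (Fin.last l) ≠ 0 := by
    intro h
    apply hv0
    have h1 : (fun i : Fin l => v i.castSucc) = 0 := by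
      apply hind
      funext j
      have h2 := congrFun hv j
      simp only [Matrix.vecMul, dotProduct, Fin.sum_univ_castSucc, h, zero_mul, add_zero] at h2 ⊢
      exact h2
    funext i
    refine Fin.lastCases h (fun i => congrFun h1 i) i
  let Pm : Matrix (Fin l) (Fin n) k[X] := Matrix.of fun i : Fin l => Pk i
  obtain ⟨I, hI⟩ := exists_row_minor_ne_zero Pm hind
  let Ps : Matrix (Fin l) (Fin n) k⟦X⟧ := Pm.map fun p : k[X] => (p : k⟦X⟧)
  have hPsI : (Ps.submatrix id I).det ≠ 0 := by
    have h1 := coe_det_poly (Pm.submatrix id I)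
    intro h2
    apply hI
    have : (((Pm.submatrix id I).det : k[X]) : k⟦X⟧) = 0 := by rw [h1]; exact h2
    exact_mod_cast this
  have hT : ∀ i j, (Ps * Y) i j = frm (Pk i) (fun p => Y p j) := by
    intro i j
    rw [Matrix.mul_apply]
    rfl
  obtain ⟨I', hI'⟩ := exists_row_minor_ne_zero (Ps * Y) (by
    intro u hu
    have h1 : u ᵥ* Ps = 0 := by
      rw [← Matrix.vecMul_vecMul] at hu
      have := congrArg (fun z => z ᵥ* Y⁻¹) hu
      simpa [Matrix.vecMul_vecMul, Matrix.mul_assoc, Matrix.mul_nonsing_inv _ hYu] using this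
    apply Matrix.eq_zero_of_vecMul_eq_zero hPsI
    funext j
    exact congrFun h1 (I j))
  have hH : ∀ i : Fin l, ∃ h : Fin l → k⟦X⟧, ∀ j,
      ((v (Fin.last l) * Q : k[X]) : k⟦X⟧) * d⁄dX k ((Ps * Y) i j) = ∑ p, h p * (Ps * Y) p j := by
    intro i
    have h1 : ∀ j, ((v (Fin.last l) * Q : k[X]) : k⟦X⟧) * d⁄dX k ((Ps * Y) i j) =
        (v (Fin.last l) : k⟦X⟧) * frm (Pk (i + 1)) (fun p => Y p j) := by
      intro j
      rw [hT, nab_iter_frm (hY j), Polynomial.coe_mul, mul_assoc]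
    rcases Nat.lt_or_ge (i + 1) l with hi | hi
    · refine ⟨Pi.single ⟨i + 1, hi⟩ (v (Fin.last l) : k⟦X⟧), fun j => ?_⟩
      rw [h1, Finset.sum_eq_single ⟨i + 1, hi⟩]
      · rw [Pi.single_eq_same, hT]
      · intro b _ hb
        rw [Pi.single_eq_of_ne hb, zero_mul]
      · simp
    · have hil : (i : ℕ) + 1 = l := by omega
      refine ⟨fun p => -(v p.castSucc : k⟦X⟧), fun j => ?_⟩
      rw [h1, hil]
      have h2 : ∀ q, (v (Fin.last l) : k⟦X⟧) * (Pk l q : k⟦X⟧) =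
          -∑ p : Fin l, (v p.castSucc : k⟦X⟧) * (Pk p q : k⟦X⟧) := by
        intro q
        have h3 := congrFun hv q
        simp only [Matrix.vecMul, dotProduct, Fin.sum_univ_castSucc, Matrix.of_apply,
          Pi.zero_apply] at h3
        have h4 := congrArg (fun z : k[X] => (z : k⟦X⟧)) h3
        simp only [Polynomial.coe_add, coe_sum_poly, Polynomial.coe_mul, Polynomial.coe_zero] at h4
        rw [eq_neg_iff_add_eq_zero, add_comm]
        exact h4
      simp only [hT, frm, Finset.mul_sum]
      simp only [← mul_assoc, h2]
      simp only [neg_mul, Finset.sum_neg_distrib, Finset.sum_mul]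
      rw [Finset.sum_comm]
  choose H hH using hH
  obtain ⟨V, hV⟩ := exists_constant_factor (Ps * Y) I' hI'
    ((v (Fin.last l) * Q : k[X]) : k⟦X⟧) (by
      have : v (Fin.last l) * Q ≠ 0 := mul_ne_zero hvl (fun h => hQ (by simp [h]))
      exact_mod_cast this) (Matrix.of H) (fun i j => hH i j)
  set M := (Ps * Y).submatrix id I' with hM
  set U := V.map C * Y⁻¹ with hU
  have hPU : Ps = M * U := by
    have := congrArg (fun z => z * Y⁻¹) hV
    simpa [Matrix.mul_assoc, Matrix.mul_nonsing_inv _ hYu] using this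
  have hUS : ∀ i j, U i j ∈ S := by
    intro i j
    rw [hU, Matrix.mul_apply]
    refine Submodule.sum_mem _ fun p _ => ?_
    rw [Matrix.map_apply, ← PowerSeries.smul_eq_C_mul]
    exact Submodule.smul_mem _ _ (Submodule.subset_span ⟨(p, j), rfl⟩)
  have hdetU : ∀ J : Fin l → Fin n, (U.submatrix id J).det ∈ S ^ l := by
    intro J
    have := det_mem_pow S (U.submatrix id J) fun i j => hUS _ _
    rwa [Fintype.card_fin] at this
  have hfac : ∀ J : Fin l → Fin n,
      (((Pm.submatrix id J).det : k[X]) : k⟦X⟧) = M.det * (U.submatrix id J).det := by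
    intro J
    rw [coe_det_poly, ← Matrix.det_mul]
    congr 1
    change Ps.submatrix id J = _
    rw [hPU]
    rfl
  let i0 : Fin l := ⟨0, hl0⟩
  let num : Fin n → k[X] := fun j => (Pm.submatrix id (Function.update I i0 j)).det
  set den := (Pm.submatrix id I).det with hden
  have hUI : (U.submatrix id I).det ≠ 0 := by
    intro h
    have := hfac I
    rw [h, mul_zero] at this
    exact hI (by exact_mod_cast this)
  have hnum : num (I i0) = den := by simp [num, hden]
  have hcr : ∀ j, num j = ∑ i, (Pm.submatrix id I).adjugate i0 i * Pm i j := by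
    intro j
    have h1 : Pm.submatrix id (Function.update I i0 j) =
        (Pm.submatrix id I).updateCol i0 (fun i => Pm i j) := by
      ext1 p q
      simp only [Matrix.submatrix_apply, Matrix.updateCol_apply, Function.update_apply, id]
      split_ifs <;> rfl
    change Matrix.det _ = _
    rw [h1, ← Matrix.cramer_apply, Matrix.cramer_eq_adjugate_mulVec]
    rfl
  have hpq : ∀ j, ∃ p q : k[X], p.natDegree ≤ c l ∧ q.natDegree ≤ c l ∧ q ≠ 0 ∧
      num j * q = den * p := by
    intro j
    refine hc l _ (hdetU (Function.update I i0 j)) _ (hdetU I) hUI _ _ ?_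
    rw [hfac, hfac]
    ring
  choose p q hp hq hq0 hpq using hpq
  have hs : ∀ j, den * (p j * ∏ i ∈ Finset.univ.erase j, q i) = (∏ i, q i) * num j := by
    intro j
    rw [← mul_assoc, ← hpq, ← Finset.mul_prod_erase Finset.univ q (Finset.mem_univ j)]
    ring
  have hln : l < n := hmn
  refine ⟨l, hln, fun i => (∏ i, q i) * (Pm.submatrix id I).adjugate i0 i, I,
    fun j => p j * ∏ i ∈ Finset.univ.erase j, q i, ?_, ?_, hI, ?_⟩
  · intro h
    have h1 := hs (I i0)
    have h2 := congrFun h (I i0)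
    simp only [Pi.zero_apply] at h2
    rw [h2, mul_zero, hnum] at h1
    exact mul_ne_zero (Finset.prod_ne_zero_iff.2 fun i _ => hq0 i) hI h1.symm
  · intro j
    have hcl : c l ≤ ∑ l ∈ Finset.range n, c l :=
      Finset.single_le_sum (fun _ _ => Nat.zero_le _) (Finset.mem_range.2 hln)
    have hcard : (Finset.univ.erase j).card + 1 = n := by
      rw [Finset.card_erase_add_one (Finset.mem_univ j), Finset.card_univ, Fintype.card_fin]
    calc _ ≤ (p j).natDegree + (∏ i ∈ Finset.univ.erase j, q i).natDegree :=
          Polynomial.natDegree_mul_le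
      _ ≤ c l + ∑ i ∈ Finset.univ.erase j, (q i).natDegree :=
          add_le_add (hp j) (Polynomial.natDegree_prod_le _ _)
      _ ≤ c l + (Finset.univ.erase j).card * c l :=
          Nat.add_le_add_left (by
            rw [← smul_eq_mul]
            exact Finset.sum_le_card_nsmul _ _ _ fun i _ => hq i) _
      _ = n * c l := by conv_rhs => rw [← hcard]
                        ring
      _ ≤ _ := Nat.mul_le_mul_left _ hcl
  · intro j
    change den * _ = _
    rw [hs, hcr, Finset.mul_sum]
    exact Finset.sum_congr rfl fun i _ => by rw [mul_assoc]; rfl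

end Shidlovskii

section Shidlovskii
variable {k : Type*} [Field k] [CharZero k]
open PowerSeries

theorem natDegree_det_le {l : ℕ} (M : Matrix (Fin l) (Fin l) k[X]) (D : ℕ)
    (h : ∀ i j, (M i j).natDegree ≤ D) : M.det.natDegree ≤ l * D := by
  rw [Matrix.det_apply]
  refine Polynomial.natDegree_sum_le_of_forall_le _ _ fun σ _ => ?_
  have h1 : (∏ i, M (σ i) i).natDegree ≤ l * D := by
    refine (Polynomial.natDegree_prod_le _ _).trans ?_
    have := Finset.sum_le_card_nsmul Finset.univ (fun i => (M (σ i) i).natDegree) D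
      (fun i _ => h _ _)
    simpa using this
  rcases Int.units_eq_one_or (Equiv.Perm.sign σ) with h2 | h2 <;> simp only [h2]
  · simpa using h1
  · simpa using h1

theorem natDegree_nab_le {n : ℕ} {Q : k[X]} {B : Matrix (Fin n) (Fin n) k[X]} {d : ℕ}
    (hQ : Q.natDegree ≤ d) (hB : ∀ i j, (B i j).natDegree ≤ d) {N : ℕ} {P : Fin n → k[X]}
    (hP : ∀ j, (P j).natDegree ≤ N) (j : Fin n) : (nab Q B P j).natDegree ≤ N + d := by
  refine Polynomial.natDegree_add_le_of_degree_le ?_ ?_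
  · refine Polynomial.natDegree_mul_le.trans ?_
    have := Polynomial.natDegree_derivative_le (P j)
    have := hP j
    omega
  · refine Polynomial.natDegree_sum_le_of_forall_le _ _ fun i _ => ?_
    exact Polynomial.natDegree_mul_le.trans (add_le_add (hP i) (hB i j))

theorem natDegree_nab_iter_le {n : ℕ} {Q : k[X]} {B : Matrix (Fin n) (Fin n) k[X]} {d : ℕ}
    (hQ : Q.natDegree ≤ d) (hB : ∀ i j, (B i j).natDegree ≤ d) {N : ℕ} {P : Fin n → k[X]}
    (hP : ∀ j, (P j).natDegree ≤ N) (i : ℕ) (j : Fin n) :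
    ((nab Q B)^[i] P j).natDegree ≤ N + i * d := by
  induction i generalizing j with
  | zero => simpa using hP j
  | succ i ih =>
    rw [Function.iterate_succ_apply']
    refine (natDegree_nab_le hQ hB ih j).trans (le_of_eq ?_)
    ring

theorem exists_degree_bound {n : ℕ} (Q : k[X]) (B : Matrix (Fin n) (Fin n) k[X]) :
    ∃ d, Q.natDegree ≤ d ∧ ∀ i j, (B i j).natDegree ≤ d := by
  refine ⟨Q.natDegree + ∑ i, ∑ j, (B i j).natDegree, Nat.le_add_right _ _, fun i j => ?_⟩
  have h1 := Finset.single_le_sum (f := fun j => (B i j).natDegree) (fun _ _ => Nat.zero_le _)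
    (Finset.mem_univ j)
  have h2 := Finset.single_le_sum (f := fun i => ∑ j, (B i j).natDegree)
    (fun _ _ => Nat.zero_le _) (Finset.mem_univ i)
  exact (h1.trans h2).trans (Nat.le_add_left _ _)

theorem X_pow_dvd_of_mul_left {p g : k⟦X⟧} {u v : ℕ} (hp : ¬ (X : k⟦X⟧) ^ (u + 1) ∣ p)
    (h : (X : k⟦X⟧) ^ (u + v) ∣ p * g) : (X : k⟦X⟧) ^ v ∣ g := by
  by_cases hg0 : g = 0
  · rw [hg0]; exact dvd_zero _
  have hp0 : p ≠ 0 := fun h0 => hp (h0 ▸ dvd_zero _)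
  obtain ⟨p1, hp1⟩ := X_pow_order_dvd (φ := p)
  set e := p.order.toNat with he
  have hpu : IsUnit p1 := by
    rw [PowerSeries.isUnit_iff_constantCoeff, isUnit_iff_ne_zero]
    have := coeff_order hp0
    rw [← he, hp1] at this
    simpa [coeff_X_pow_mul'] using this
  have heu : e ≤ u := by
    by_contra h1
    exact hp ((pow_dvd_pow _ (by omega)).trans (Dvd.intro _ hp1.symm))
  have h2 : (X : k⟦X⟧) ^ e * X ^ v ∣ X ^ e * (p1 * g) := by
    rw [← pow_add, ← mul_assoc, ← hp1]
    exact (pow_dvd_pow _ (by omega)).trans h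
  have h3 := (mul_dvd_mul_iff_left (pow_ne_zero _ X_ne_zero)).1 h2
  exact (hpu.dvd_mul_left).1 h3

theorem X_pow_dvd_coe {p : k[X]} {u : ℕ} : (X : k⟦X⟧) ^ u ∣ (p : k⟦X⟧) ↔ (Polynomial.X : k[X]) ^ u ∣ p := by
  rw [X_pow_dvd_iff, Polynomial.X_pow_dvd_iff]
  simp

theorem not_X_pow_dvd_of_natDegree_le {p : k[X]} (hp : p ≠ 0) {u : ℕ} (h : p.natDegree ≤ u) :
    ¬ (X : k⟦X⟧) ^ (u + 1) ∣ (p : k⟦X⟧) := by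
  rw [X_pow_dvd_coe]
  intro h1
  have := Polynomial.natDegree_le_of_dvd h1 hp
  rw [Polynomial.natDegree_X_pow] at this
  omega

/-- Elements of a finite-dimensional space of power series have bounded order. -/
theorem bounded_order {V : Type*} [AddCommGroup V] [Module k V] [FiniteDimensional k V]
    (φ : V →ₗ[k] k⟦X⟧) (hφ : ∀ v, φ v = 0 → v = 0) :
    ∃ c : ℕ, ∀ v, v ≠ 0 → ¬ (X : k⟦X⟧) ^ c ∣ φ v := by
  let W : ℕ →o (Submodule k V)ᵒᵈ :=
    { toFun := fun m => OrderDual.toDual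
        { carrier := {v | (X : k⟦X⟧) ^ m ∣ φ v}
          add_mem' := fun {a b} ha hb => by
            change (X : k⟦X⟧) ^ m ∣ _
            rw [map_add]; exact dvd_add ha hb
          zero_mem' := by simp
          smul_mem' := fun c v hv => by
            change (X : k⟦X⟧) ^ m ∣ φ (c • v)
            rw [map_smul, PowerSeries.smul_eq_C_mul]; exact hv.mul_left _ }
      monotone' := fun a b hab v hv => (pow_dvd_pow _ hab).trans hv }
  obtain ⟨c, hc⟩ := IsArtinian.monotone_stabilizes W
  refine ⟨c, fun v hv h => hv (hφ v (eq_zero_of_X_pow_dvd fun m => ?_))⟩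
  rcases le_total c m with hm | hm
  · have h1 : v ∈ OrderDual.ofDual (W c) := h
    rw [hc m hm] at h1
    exact h1
  · exact (pow_dvd_pow _ hm).trans h

theorem bounded_order_frm {n : ℕ} (b : Fin n → k⟦X⟧) (hb : ∀ P, frm P b = 0 → P = 0) (d : ℕ) :
    ∃ c : ℕ, ∀ s : Fin n → k[X], s ≠ 0 → (∀ j, (s j).natDegree ≤ d) →
      ¬ (X : k⟦X⟧) ^ c ∣ frm s b := by
  let φ : (Fin n → Polynomial.degreeLT k (d + 1)) →ₗ[k] k⟦X⟧ :=
    { toFun := fun s => frm (fun i => (s i : k[X])) b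
      map_add' := fun s t => by
        simp [frm, add_mul, Finset.sum_add_distrib]
      map_smul' := fun c s => by
        simp only [frm, Pi.smul_apply, Submodule.coe_smul, RingHom.id_apply, Finset.smul_sum,
          Polynomial.smul_eq_C_mul, Polynomial.coe_mul, Polynomial.coe_C,
          PowerSeries.smul_eq_C_mul, mul_assoc] }
  have : FiniteDimensional k (Polynomial.degreeLT k (d + 1)) :=
    Module.Finite.equiv (Polynomial.degreeLTEquiv k (d + 1)).symm
  obtain ⟨c, hc⟩ := bounded_order φ (fun s hs => by
    have h1 := hb _ hs
    funext i
    exact Subtype.ext (congrFun h1 i))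
  refine ⟨c, fun s hs hd => ?_⟩
  have hlt : ∀ i, s i ∈ Polynomial.degreeLT k (d + 1) := fun i =>
    Polynomial.mem_degreeLT.2 (Polynomial.degree_le_natDegree.trans_lt
      (by exact_mod_cast Nat.lt_succ_of_le (hd i)))
  refine hc (fun i => ⟨s i, hlt i⟩) fun h => hs ?_
  funext i
  exact congrArg Subtype.val (congrFun h i)

theorem nab_taylor {n : ℕ} (a : k) (Q : k[X]) (B : Matrix (Fin n) (Fin n) k[X])
    (P : Fin n → k[X]) :
    nab (Polynomial.taylor a Q) (B.map (Polynomial.taylor a)) (fun j => Polynomial.taylor a (P j)) =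
      fun j => Polynomial.taylor a (nab Q B P j) := by
  funext j
  have hd : ∀ p : k[X], Polynomial.derivative (Polynomial.taylor a p) =
      Polynomial.taylor a (Polynomial.derivative p) := by
    intro p
    simp [Polynomial.taylor_apply, Polynomial.derivative_comp]
  simp [nab, hd, map_sum, map_add, Polynomial.taylor_mul]

theorem nab_iter_taylor {n : ℕ} (a : k) (Q : k[X]) (B : Matrix (Fin n) (Fin n) k[X])
    (P : Fin n → k[X]) (i : ℕ) :
    (nab (Polynomial.taylor a Q) (B.map (Polynomial.taylor a)))^[i]
      (fun j => Polynomial.taylor a (P j)) =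
      fun j => Polynomial.taylor a ((nab Q B)^[i] P j) := by
  induction i with
  | zero => rfl
  | succ i ih => rw [Function.iterate_succ_apply', ih, nab_taylor, Function.iterate_succ_apply']

theorem X_pow_dvd_nab_iter {n : ℕ} {Q : k[X]} {B : Matrix (Fin n) (Fin n) k[X]} {y : Fin n → k⟦X⟧}
    (hy : IsSol Q B y) {P : Fin n → k[X]} {m : ℕ} (h : (X : k⟦X⟧) ^ m ∣ frm P y) (i : ℕ) :
    (X : k⟦X⟧) ^ (m - i) ∣ frm ((nab Q B)^[i] P) y := by
  induction i with
  | zero => exact h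
  | succ i ih =>
    rw [nab_iter_frm hy]
    refine Dvd.dvd.mul_left ?_ _
    rcases Nat.lt_or_ge i m with h1 | h1
    · exact X_pow_dvd_derivative (by rwa [show m - (i + 1) + 1 = m - i by omega])
    · rw [show m - (i + 1) = 0 by omega, pow_zero]; exact one_dvd _

end Shidlovskii

section Shidlovskii
variable {k : Type*} [Field k] [CharZero k]
open PowerSeries

theorem frm_comb {n l : ℕ} (y : Fin n → k⟦X⟧) (D : k[X]) (s : Fin n → k[X]) (g : Fin l → k[X])
    (P : Fin l → Fin n → k[X]) (h : ∀ j, D * s j = ∑ i, g i * P i j) :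
    (D : k⟦X⟧) * frm s y = ∑ i, (g i : k⟦X⟧) * frm (P i) y := by
  simp only [frm, Finset.mul_sum, ← mul_assoc, ← Polynomial.coe_mul]
  rw [Finset.sum_comm]
  refine Finset.sum_congr rfl fun j _ => ?_
  rw [h, coe_sum_poly, Finset.sum_mul]

/-- Shidlovskii's lemma: a linear form of large order has independent derivatives. -/
theorem shidlovskii {n : ℕ} (Q : k[X]) (B : Matrix (Fin n) (Fin n) k[X]) (a : k)
    (hQ : Q.eval a ≠ 0) (b : Fin n → k⟦X⟧) (hb : ∀ P, frm P b = 0 → P = 0) (hsol : IsSol Q B b) :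
    ∃ c : ℕ, ∀ (N m : ℕ) (P : Fin n → k[X]), P ≠ 0 → (∀ j, (P j).natDegree ≤ N) →
      (X : k⟦X⟧) ^ m ∣ frm P b → (Matrix.of fun i : Fin n => (nab Q B)^[i] P).det = 0 →
      m ≤ (n - 1) * N + c := by
  obtain ⟨c1, hc1⟩ := exists_bounded_vector (Polynomial.taylor a Q) (B.map (Polynomial.taylor a))
    (by rwa [Polynomial.taylor_coeff_zero])
  obtain ⟨c2, hc2⟩ := bounded_order_frm b hb c1
  obtain ⟨d, hQd, hBd⟩ := exists_degree_bound Q B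
  refine ⟨n * (n * d) + c2 + n, fun N m P hP hN hm hdet => ?_⟩
  obtain ⟨l, hln, g, I, s, hs0, hsc, hden, hrel⟩ := hc1 (fun j => Polynomial.taylor a (P j))
    (fun h => hP (funext fun j => (Polynomial.taylor_eq_zero _ _).1 (congrFun h j))) (by
      simp only [nab_iter_taylor]
      have := RingHom.map_det (Polynomial.taylorAlgHom a : k[X] →+* k[X])
        (Matrix.of fun i : Fin n => (nab Q B)^[i] P)
      rw [hdet, map_zero] at this
      exact this.symm)
  simp only [nab_iter_taylor] at hden hrel
  set den := (Matrix.of fun i j : Fin l => (nab Q B)^[i] P (I j)).det with hdendef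
  have hden' : (Matrix.of fun i j : Fin l => Polynomial.taylor a ((nab Q B)^[i] P (I j))).det =
      Polynomial.taylor a den :=
    (RingHom.map_det (Polynomial.taylorAlgHom a : k[X] →+* k[X])
      (Matrix.of fun i j : Fin l => (nab Q B)^[i] P (I j))).symm
  rw [hden'] at hden hrel
  have hden0 : den ≠ 0 := fun h => hden (by rw [h, map_zero])
  have hback : ∀ p : k[X], Polynomial.taylor (-a) (Polynomial.taylor a p) = p := by
    intro p
    rw [Polynomial.taylor_taylor, neg_add_cancel, Polynomial.taylor_zero]
  have hrel' : ∀ j, den * Polynomial.taylor (-a) (s j) =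
      ∑ i : Fin l, Polynomial.taylor (-a) (g i) * (nab Q B)^[i] P j := by
    intro j
    have := congrArg (Polynomial.taylor (-a)) (hrel j)
    simpa only [Polynomial.taylor_mul, map_sum, hback] using this
  have h1 := frm_comb b den _ _ (fun i : Fin l => (nab Q B)^[i] P) hrel'
  have h2 : (X : k⟦X⟧) ^ (m - l) ∣ (den : k⟦X⟧) * frm (fun j => Polynomial.taylor (-a) (s j)) b := by
    rw [h1]
    refine Finset.dvd_sum fun i _ => Dvd.dvd.mul_left ?_ _
    exact (pow_dvd_pow _ (by have := i.2; omega)).trans (X_pow_dvd_nab_iter hsol hm i)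
  have h3 := hc2 (fun j => Polynomial.taylor (-a) (s j))
    (fun h => hs0 (funext fun j => (Polynomial.taylor_eq_zero _ _).1 (congrFun h j)))
    (fun j => by rw [Polynomial.natDegree_taylor]; exact hsc j)
  have hdegden : den.natDegree ≤ l * (N + n * d) := by
    refine natDegree_det_le _ _ fun i j => ?_
    refine (natDegree_nab_iter_le hQd hBd hN i (I j)).trans ?_
    have := Nat.mul_le_mul_right d (i.2.trans hln).le
    omega
  by_contra hcon
  rw [not_le] at hcon
  apply h3
  refine X_pow_dvd_of_mul_left (not_X_pow_dvd_of_natDegree_le hden0 hdegden)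
    ((pow_dvd_pow _ ?_).trans h2)
  have e1 : l * (N + n * d) ≤ (n - 1) * N + n * (n * d) := by
    rw [mul_add]
    exact add_le_add (Nat.mul_le_mul_right _ (by omega)) (Nat.mul_le_mul_right _ hln.le)
  omega

theorem taylor_X_pow_dvd {a : k} {p : k[X]} {u : ℕ}
    (h : (X : k⟦X⟧) ^ u ∣ (Polynomial.taylor a p : k⟦X⟧)) : (Polynomial.X - Polynomial.C a) ^ u ∣ p := by
  rw [X_pow_dvd_coe] at h
  have := map_dvd (Polynomial.taylorAlgHom (-a) : k[X] →+* k[X]) h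
  simpa [Polynomial.taylor_taylor, ← sub_eq_add_neg] using this

/-- The values at a regular point of the first derivatives of a linear form of large order
are independent. -/
theorem values_span {n : ℕ} (Q : k[X]) (B : Matrix (Fin n) (Fin n) k[X]) (a : k) (ha : a ≠ 0)
    (hQ : Q.eval a ≠ 0) (b : Fin n → k⟦X⟧) (hb : ∀ P, frm P b = 0 → P = 0) (hsol : IsSol Q B b) :
    ∃ c : ℕ, ∀ (N L m : ℕ) (P : Fin n → k[X]), P ≠ 0 → (∀ j, (P j).natDegree ≤ N) →
      (X : k⟦X⟧) ^ m ∣ frm P b → n * (N + 1) ≤ m + L → L + c < N → ∀ v : Fin n → k, v ≠ 0 →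
      ∃ i < n + L + c, ∑ j, ((nab Q B)^[i] P j).eval a * v j ≠ 0 := by
  obtain ⟨c1, hc1⟩ := shidlovskii Q B a hQ b hb hsol
  obtain ⟨c2, hc2⟩ := bounded_order_frm b hb 0
  obtain ⟨d, hQd, hBd⟩ := exists_degree_bound Q B
  refine ⟨n * (n * d) + c2 + c1 + 1, fun N L m P hP hN hm hmL hLN v hv => ?_⟩
  set c := n * (n * d) + c2 + c1 + 1 with hc
  obtain ⟨j0, hj0⟩ := Function.ne_iff.1 hv
  have hn : 0 < n := j0.pos
  by_contra! hcon
  set Δ := (Matrix.of fun i : Fin n => (nab Q B)^[i] P).det with hΔ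
  have hΔ0 : Δ ≠ 0 := by
    intro h
    have h1 := hc1 N m P hP hN hm h
    obtain ⟨n', rfl⟩ : ∃ n', n = n' + 1 := ⟨n - 1, by omega⟩
    simp only [Nat.add_sub_cancel] at h1
    have : (n' + 1) * (N + 1) = n' * N + N + n' + 1 := by ring
    omega
  have hΔdeg : Δ.natDegree ≤ n * (N + n * d) := by
    refine natDegree_det_le _ _ fun i j => ?_
    refine (natDegree_nab_iter_le hQd hBd hN i j).trans ?_
    have := Nat.mul_le_mul_right d i.2.le
    omega
  -- order at the origin
  have h0 : (Polynomial.X : k[X]) ^ (m - n - c2) ∣ Δ := by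
    have h1 : (Δ : k⟦X⟧) * frm (Pi.single j0 1) b = ∑ i,
        (((Matrix.of fun i : Fin n => (nab Q B)^[i] P).adjugate j0 i : k[X]) : k⟦X⟧) *
          frm ((nab Q B)^[i] P) b := by
      refine frm_comb b Δ _ _ (fun i : Fin n => (nab Q B)^[i] P) fun j => ?_
      have h2 := congrFun (congrFun
        (Matrix.adjugate_mul (Matrix.of fun i : Fin n => (nab Q B)^[i] P)) j0) j
      rw [Matrix.mul_apply] at h2
      rw [← hΔ] at h2
      simp only [Matrix.of_apply, Matrix.smul_apply, Matrix.one_apply, smul_eq_mul] at h2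
      rw [h2, Pi.single_apply]
      simp only [eq_comm]
    have h3 : (X : k⟦X⟧) ^ (m - n) ∣ (Δ : k⟦X⟧) * frm (Pi.single j0 1) b := by
      rw [h1]
      refine Finset.dvd_sum fun i _ => Dvd.dvd.mul_left ?_ _
      exact (pow_dvd_pow _ (by have := i.2; omega)).trans (X_pow_dvd_nab_iter hsol hm i)
    have h4 := hc2 (Pi.single j0 1) (by simp) (by
      intro j
      by_cases h : j = j0
      · subst h; simp
      · simp [h])
    rw [← X_pow_dvd_coe]
    rcases Nat.lt_or_ge (m - n) c2 with h5 | h5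
    · rw [show m - n - c2 = 0 by omega, pow_zero]; exact one_dvd _
    refine X_pow_dvd_of_mul_left (u := c2) (p := frm (Pi.single j0 1) b)
      (fun h => h4 ((pow_dvd_pow _ (Nat.le_succ c2)).trans h)) ?_
    rw [mul_comm]
    exact (pow_dvd_pow _ (by omega)).trans h3
  -- order at the regular point
  obtain ⟨y, hy, hyv⟩ := exists_sol (Polynomial.taylor a Q) (B.map (Polynomial.taylor a))
    (by rwa [Polynomial.taylor_coeff_zero]) v
  let Pt : ℕ → Fin n → k[X] := fun i j => Polynomial.taylor a ((nab Q B)^[i] P j)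
  have hS : ∀ i, frm (Pt (i + 1)) y =
      (Polynomial.taylor a Q : k⟦X⟧) * d⁄dX k (frm (Pt i) y) := by
    intro i
    have := nab_iter_frm hy (fun j => Polynomial.taylor a (P j)) i
    simp only [nab_iter_taylor] at this
    exact this
  have hS0 : ∀ i < n + L + c, constantCoeff (frm (Pt i) y) = 0 := by
    intro i hi
    rw [← hcon i hi]
    simp [frm, Pt, hyv, Polynomial.taylor_coeff_zero]
  have hQu : IsUnit (Polynomial.taylor a Q : k⟦X⟧) := by
    rw [PowerSeries.isUnit_iff_constantCoeff, isUnit_iff_ne_zero]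
    simpa [Polynomial.taylor_coeff_zero] using hQ
  have hSd : ∀ t i, i + t ≤ n + L + c → (X : k⟦X⟧) ^ t ∣ frm (Pt i) y := by
    intro t
    induction t with
    | zero => intro i _; simp
    | succ t ih =>
      intro i hi
      refine X_pow_dvd_of_derivative ?_ (hS0 i (by omega))
      have := ih (i + 1) (by omega)
      rw [hS] at this
      exact (hQu.dvd_mul_left).1 this
  have h1 : (Polynomial.X - Polynomial.C a) ^ (L + c) ∣ Δ := by
    apply taylor_X_pow_dvd
    have hdet : Polynomial.taylor a Δ = (Matrix.of fun i : Fin n => Pt i).det :=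
      RingHom.map_det (Polynomial.taylorAlgHom a : k[X] →+* k[X])
        (Matrix.of fun i : Fin n => (nab Q B)^[i] P)
    have h2 : (Polynomial.taylor a Δ : k⟦X⟧) * frm (Pi.single j0 1) y = ∑ i,
        (((Matrix.of fun i : Fin n => Pt i).adjugate j0 i : k[X]) : k⟦X⟧) * frm (Pt i) y := by
      refine frm_comb y _ _ _ (fun i : Fin n => Pt i) fun j => ?_
      have h2 := congrFun (congrFun (Matrix.adjugate_mul (Matrix.of fun i : Fin n => Pt i)) j0) j
      rw [Matrix.mul_apply] at h2
      rw [← hdet] at h2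
      simp only [Matrix.of_apply, Matrix.smul_apply, Matrix.one_apply, smul_eq_mul] at h2
      rw [h2, Pi.single_apply]
      simp only [eq_comm]
    have h3 : (X : k⟦X⟧) ^ (L + c) ∣ (Polynomial.taylor a Δ : k⟦X⟧) * frm (Pi.single j0 1) y := by
      rw [h2]
      refine Finset.dvd_sum fun i _ => Dvd.dvd.mul_left ?_ _
      exact hSd _ _ (by have := i.2; omega)
    have h4 : IsUnit (frm (Pi.single j0 (1 : k[X])) y) := by
      have : frm (Pi.single j0 (1 : k[X])) y = y j0 := by
        rw [frm, Finset.sum_eq_single j0]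
        · simp
        · intro j _ hj; simp [hj]
        · simp
      rw [this, PowerSeries.isUnit_iff_constantCoeff, isUnit_iff_ne_zero, hyv]
      exact hj0
    exact (h4.dvd_mul_right).1 h3
  have hcop : IsCoprime ((Polynomial.X : k[X]) ^ (m - n - c2))
      ((Polynomial.X - Polynomial.C a) ^ (L + c)) := by
    apply IsCoprime.pow
    have := Polynomial.isCoprime_X_sub_C_of_isUnit_sub (a := (0 : k)) (b := a)
      (by simpa using ha)
    simpa using this
  have h2 := Polynomial.natDegree_le_of_dvd (hcop.mul_dvd h0 h1) hΔ0
  rw [Polynomial.natDegree_mul (pow_ne_zero _ Polynomial.X_ne_zero)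
    (pow_ne_zero _ (Polynomial.X_sub_C_ne_zero a)), Polynomial.natDegree_X_pow,
    Polynomial.natDegree_pow, Polynomial.natDegree_X_sub_C] at h2
  have e1 : n * (N + 1) = n * N + n := by ring
  have e2 : n * (N + n * d) = n * N + n * (n * d) := by ring
  omega

end Shidlovskii

open scoped Nat

section Siegel
open PowerSeries
variable {K : Type*} [Field K] [NumberField K]

variable (K) in
/-- Siegel's lemma over a number field. -/
theorem siegel_house : ∃ c : ℕ, 1 ≤ c ∧ ∀ {α β : Type} [Fintype α] [Fintype β]
    (A : Matrix α β (𝓞 K)) (m L D e : ℕ),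
    Fintype.card α = m → Fintype.card β = m + L → 0 < L → 0 < m → 1 ≤ D →
    (∀ i j, house (A i j : K) ≤ D) → m ≤ e * L →
    ∃ t : β → 𝓞 K, t ≠ 0 ∧ A *ᵥ t = 0 ∧
      ∀ j, house (t j : K) ≤ (((c * ((m + L) * D)) ^ (e + 1) : ℕ) : ℝ) := by
  classical
  have key : ∃ c : ℝ, ∀ {α β : Type} [Fintype α] [Fintype β] (A : Matrix α β (𝓞 K)) (p q : ℕ)
      (D : ℝ), A ≠ 0 → 0 < p → p < q → Fintype.card α = p → Fintype.card β = q →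
      (∀ i j, house (A i j : K) ≤ D) →
      ∃ t : β → 𝓞 K, t ≠ 0 ∧ A *ᵥ t = 0 ∧
        ∀ j, house (t j : K) ≤ c * ((c * q * D) ^ ((p : ℝ) / (q - p))) := by
    apply Exists.intro
    intro α β _ _ A p q D hA hp hpq hα hβ hD
    exact house.exists_ne_zero_int_vec_house_le K A hA hp hpq hβ hD hα
  obtain ⟨c₁, key⟩ := key
  refine ⟨max 1 ⌈|c₁|⌉₊, le_max_left _ _, ?_⟩
  intro α β _ _ A m L D e hα hβ hL hm hD hA he
  set c := max 1 ⌈|c₁|⌉₊ with hc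
  have hc1 : 1 ≤ c := le_max_left _ _
  have hcc : |c₁| ≤ c := (Nat.le_ceil _).trans (by exact_mod_cast le_max_right _ _)
  have hbase : (1 : ℝ) ≤ c * ((m + L : ℕ) * D) := by
    exact_mod_cast Nat.one_le_iff_ne_zero.2
      (Nat.mul_ne_zero (by omega) (Nat.mul_ne_zero (by omega) (by omega)))
  have hbase' : ((c * ((m + L) * D) : ℕ) : ℝ) = c * ((m + L : ℕ) * D) := by push_cast; ring
  by_cases hA0 : A = 0
  · refine ⟨fun _ => 1, ?_, by rw [hA0]; simp, fun j => ?_⟩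
    · intro h
      have : 0 < Fintype.card β := by omega
      obtain ⟨j⟩ := Fintype.card_pos_iff.1 this
      exact one_ne_zero (congrFun h j)
    · have h1 : house ((1 : 𝓞 K) : K) = 1 := by
        have := house_intCast (K := K) 1
        simpa using this
      rw [h1, Nat.cast_pow, hbase']
      exact one_le_pow₀ hbase
  obtain ⟨t, ht0, ht, hb⟩ := key A m (m + L) D hA0 hm (by omega) hα hβ hA
  refine ⟨t, ht0, ht, fun j => (hb j).trans ?_⟩
  have hL' : (0 : ℝ) < L := by exact_mod_cast hL
  have hsub : ((m + L : ℕ) : ℝ) - m = L := by push_cast; ring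
  rw [hsub, Nat.cast_pow, hbase', pow_succ']
  have h1 : |(c₁ * (m + L : ℕ) * D) ^ ((m : ℝ) / L)| ≤ (c * ((m + L : ℕ) * D) : ℝ) ^ e := by
    refine (Real.abs_rpow_le_abs_rpow _ _).trans ?_
    rw [← Real.rpow_natCast, mul_assoc, abs_mul, abs_of_nonneg (by positivity : 0 ≤ ((m + L : ℕ) * D : ℝ))]
    refine (Real.rpow_le_rpow (by positivity) (mul_le_mul_of_nonneg_right hcc (by positivity))
      (by positivity)).trans (Real.rpow_le_rpow_of_exponent_le hbase ?_)
    rw [div_le_iff₀ hL']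
    exact_mod_cast he
  have h2 : |c₁| ≤ c * ((m + L : ℕ) * D) := hcc.trans
    (le_mul_of_one_le_right (by positivity) (by
      exact_mod_cast Nat.one_le_iff_ne_zero.2 (Nat.mul_ne_zero (by omega) (by omega))))
  refine (le_abs_self _).trans ?_
  rw [abs_mul]
  exact mul_le_mul h2 h1 (by positivity) (by positivity)

/-- Uniform E-type growth for a family of power series over a number field. -/
def EBound {ι : Type*} (b : ι → K⟦X⟧) (C : ℕ) : Prop :=
  1 ≤ C ∧ (∀ i μ, house ((μ ! : K) * coeff μ (b i)) ≤ (C : ℝ) ^ (μ + 1)) ∧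
    ∀ ν : ℕ, ∃ d : ℕ, 0 < d ∧ d ≤ C ^ (ν + 1) ∧
      ∀ i, ∀ μ ≤ ν, IsIntegral ℤ ((d : K) * ((μ ! : K) * coeff μ (b i)))

/-- The polynomial with coefficients `p j * N! / j!`. -/
def padePoly (N : ℕ) (p : Fin (N + 1) → 𝓞 K) : (𝓞 K)[X] :=
  ∑ j : Fin (N + 1), Polynomial.monomial (j : ℕ) (p j * ((N ! / (j : ℕ)! : ℕ) : 𝓞 K))

theorem coeff_padePoly (N : ℕ) (p : Fin (N + 1) → 𝓞 K) (j : Fin (N + 1)) :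
    (padePoly N p).coeff j = p j * ((N ! / (j : ℕ)! : ℕ) : 𝓞 K) := by
  rw [padePoly, Polynomial.finsetSum_coeff, Finset.sum_eq_single j]
  · simp
  · intro i _ hi
    rw [Polynomial.coeff_monomial, if_neg (fun h => hi (Fin.ext h))]
  · simp

theorem natDegree_padePoly (N : ℕ) (p : Fin (N + 1) → 𝓞 K) : (padePoly N p).natDegree ≤ N := by
  refine Polynomial.natDegree_sum_le_of_forall_le _ _ fun j _ => ?_
  exact (Polynomial.natDegree_monomial_le _).trans (Nat.lt_succ_iff.1 j.2)

theorem coeff_padePoly_mul (N : ℕ) (p : Fin (N + 1) → 𝓞 K) (f : K⟦X⟧) (ν : ℕ) :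
    (ν ! : K) * coeff ν (((padePoly N p).map (algebraMap (𝓞 K) K) : K[X]) * f : K⟦X⟧) =
      N ! * ∑ j : Fin (N + 1), (p j : K) * ((ν.choose j : K) *
        (((ν - j)! : K) * coeff (ν - j) f)) := by
  rw [padePoly, Polynomial.map_sum, coe_sum_poly, Finset.sum_mul, map_sum, Finset.mul_sum,
    Finset.mul_sum]
  refine Finset.sum_congr rfl fun j _ => ?_
  rw [Polynomial.map_monomial, ← Polynomial.C_mul_X_pow_eq_monomial, Polynomial.coe_mul,
    Polynomial.coe_C, Polynomial.coe_pow, Polynomial.coe_X, mul_assoc, PowerSeries.coeff_C_mul,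
    PowerSeries.coeff_X_pow_mul']
  have hj : ((j : ℕ)! : K) ≠ 0 := by exact_mod_cast Nat.factorial_ne_zero _
  have hN : (((N ! / (j : ℕ)! : ℕ) : 𝓞 K) : K) = N ! / (j : ℕ)! := by
    rw [show (((N ! / (j : ℕ)! : ℕ) : 𝓞 K) : K) = ((N ! / (j : ℕ)! : ℕ) : K) from
        map_natCast (algebraMap (𝓞 K) K) _,
      Nat.cast_div (Nat.factorial_dvd_factorial (Nat.lt_succ_iff.1 j.2)) hj]
  split_ifs with h
  · have hc : ((ν.choose j : ℕ) : K) * (ν - j)! = ν ! / (j : ℕ)! := by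
      rw [Nat.cast_choose K h]
      have : ((ν - j)! : K) ≠ 0 := by exact_mod_cast Nat.factorial_ne_zero _
      field_simp
    simp only [map_mul, hN]
    rw [show (p j : K) * ((ν.choose j : K) * (((ν - j)! : K) * coeff (ν - j) f)) =
      (p j : K) * (((ν.choose j : K) * (ν - j)!) * coeff (ν - j) f) by ring, hc]
    field_simp
  · rw [Nat.choose_eq_zero_of_lt (by omega)]
    simp


theorem pade_exists {n : ℕ} (hn : 0 < n) (b : Fin n → K⟦X⟧) (C : ℕ) (hC : EBound b C) :
    ∃ C1 : ℕ, 1 ≤ C1 ∧ ∀ L N : ℕ, 1 ≤ L → N = (2 * n + 2) * L → ∃ P : Fin n → (𝓞 K)[X], P ≠ 0 ∧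
      (∀ i, (P i).natDegree ≤ N) ∧ (∀ i j, house ((P i).coeff j : K) ≤ ((N ! * C1 ^ N : ℕ) : ℝ)) ∧
      (X : K⟦X⟧) ^ (n * (N + 1) - L) ∣ frm (fun i => (P i).map (algebraMap (𝓞 K) K)) b ∧
      ∀ ν : ℕ, house ((ν ! : K) * coeff ν (frm (fun i => (P i).map (algebraMap (𝓞 K) K)) b)) ≤
        ((N ! * C1 ^ (N + ν + 1) : ℕ) : ℝ) := by
  obtain ⟨c, hc1, hsieg⟩ := siegel_house K
  obtain ⟨hC1, hCb, hCd⟩ := hC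
  set e := 2 * n * (2 * n + 2) with he
  set C0 := (c * (4 * C ^ 2)) ^ (2 * n * (e + 1)) with hC0
  have hC01 : 1 ≤ C0 := Nat.one_le_pow _ _ (by positivity)
  refine ⟨C0 * 4 ^ n * (2 * C), Nat.one_le_iff_ne_zero.2 (by positivity), fun L N hL hN => ?_⟩
  set m := n * (N + 1) - L with hm
  have hLN : (2 * n + 2) * L = 2 * n * L + 2 * L := by ring
  have hnN : n * (N + 1) = n * N + n := by ring
  have hNn : N ≤ n * N := Nat.le_mul_of_pos_left _ hn
  have hmL : m + L = n * (N + 1) := by omega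
  have hm0 : 0 < m := by omega
  obtain ⟨d, hd0, hdC, hdz⟩ := hCd m
  have hz : ∀ i (μ : ℕ), ∃ z : 𝓞 K, μ ≤ m → (d : K) * ((μ ! : K) * coeff μ (b i)) = z := by
    intro i μ
    by_cases h : μ ≤ m
    · exact ⟨⟨_, hdz i μ h⟩, fun _ => rfl⟩
    · exact ⟨0, fun h' => absurd h' h⟩
  choose z hz using hz
  let A : Matrix (Fin m) (Fin n × Fin (N + 1)) (𝓞 K) := fun ν q =>
    ((ν : ℕ).choose q.2 : 𝓞 K) * z q.1 (ν - q.2)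
  have hAb : ∀ ν q, house (A ν q : K) ≤ (((2 * C ^ 2) ^ (m + 1) : ℕ) : ℝ) := by
    intro ν q
    have hν : (ν : ℕ) - q.2 ≤ m := by have := ν.2; omega
    have h1 : house (z q.1 (ν - q.2) : K) ≤ ((C ^ (m + 1) * C ^ (m + 1) : ℕ) : ℝ) := by
      rw [← hz q.1 _ hν, house_nat_mul]
      push_cast
      have h2 := hCb q.1 (ν - q.2)
      have h3 : (C : ℝ) ^ ((ν : ℕ) - q.2 + 1) ≤ (C : ℝ) ^ (m + 1) :=
        pow_le_pow_right₀ (by exact_mod_cast hC1) (by omega)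
      have h4 : (d : ℝ) ≤ (C : ℝ) ^ (m + 1) := by exact_mod_cast hdC
      exact mul_le_mul h4 (h2.trans h3) (house_nonneg _) (by positivity)
    have h5 : ((ν : ℕ).choose q.2 : ℝ) ≤ ((2 ^ (m + 1) : ℕ) : ℝ) := by
      have := (Nat.choose_le_two_pow (ν : ℕ) (q.2 : ℕ)).trans
        (Nat.pow_le_pow_right (n := 2) (by norm_num) (show (ν : ℕ) ≤ m + 1 by have := ν.2; omega))
      exact_mod_cast this
    have h6 : (A ν q : K) = ((ν : ℕ).choose q.2 : K) * (z q.1 (ν - q.2) : K) := by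
      simp only [A, map_mul, map_natCast]
    rw [h6, house_nat_mul]
    refine (mul_le_mul h5 h1 (house_nonneg _) (by positivity)).trans (le_of_eq ?_)
    push_cast
    rw [mul_pow, ← pow_mul, ← pow_add]
    ring
  obtain ⟨t, ht0, ht, htb⟩ := hsieg A m L ((2 * C ^ 2) ^ (m + 1)) e (by simp)
    (by rw [hmL]; simp) (by omega) hm0 (Nat.one_le_pow _ _ (by positivity)) hAb (by
      have h1 : m ≤ n * (2 * N) := by
        have : N + 1 ≤ 2 * N := by omega
        exact (by omega : m ≤ n * (N + 1)).trans (Nat.mul_le_mul_left _ this)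
      refine h1.trans (le_of_eq ?_)
      rw [hN, he]; ring)
  have htb' : ∀ q, house (t q : K) ≤ ((C0 ^ N : ℕ) : ℝ) := by
    intro q
    refine (htb q).trans ?_
    have h1 : c * ((m + L) * (2 * C ^ 2) ^ (m + 1)) ≤ (c * (4 * C ^ 2)) ^ (2 * n * N) := by
      have h2 : m + L ≤ 2 ^ (2 * n * N) := by
        have h3 : m + L ≤ 2 * n * N := by
          rw [hmL, mul_assoc, mul_left_comm]
          exact Nat.mul_le_mul_left _ (by omega)
        exact h3.trans Nat.lt_two_pow_self.le
      have h4 : (2 * C ^ 2) ^ (m + 1) ≤ (2 * C ^ 2) ^ (2 * n * N) := by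
        refine Nat.pow_le_pow_right (by positivity) ?_
        have : 2 * n * N = n * N + n * N := by ring
        have : n ≤ n * N := Nat.le_mul_of_pos_right _ (by omega)
        omega
      have h5 : c ≤ c ^ (2 * n * N) := Nat.le_self_pow
        (Nat.mul_ne_zero (by omega) (by omega)) _
      calc _ ≤ c ^ (2 * n * N) * (2 ^ (2 * n * N) * (2 * C ^ 2) ^ (2 * n * N)) :=
            Nat.mul_le_mul h5 (Nat.mul_le_mul h2 h4)
        _ = _ := by rw [← mul_pow, ← mul_pow]; congr 1; ring
    have h5 := Nat.pow_le_pow_left h1 (e + 1)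
    have h6 : ((c * (4 * C ^ 2)) ^ (2 * n * N)) ^ (e + 1) = C0 ^ N := by
      rw [hC0, ← pow_mul, ← pow_mul]; congr 1; ring
    rw [h6] at h5
    exact_mod_cast h5
  let P : Fin n → (𝓞 K)[X] := fun i => padePoly N fun j => t (i, j)
  have hcoef : ∀ ν : ℕ, (ν ! : K) * coeff ν (frm (fun i => (P i).map (algebraMap (𝓞 K) K)) b) =
      N ! * ∑ i, ∑ j : Fin (N + 1), (t (i, j) : K) * ((ν.choose j : K) *
        (((ν - j)! : K) * coeff (ν - j) (b i))) := by
    intro ν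
    rw [frm, map_sum, Finset.mul_sum, Finset.mul_sum]
    exact Finset.sum_congr rfl fun i _ => coeff_padePoly_mul N _ (b i) ν
  have hC1' : (1 : ℝ) ≤ C := by exact_mod_cast hC1
  refine ⟨P, ?_, fun i => natDegree_padePoly _ _, ?_, ?_, ?_⟩
  · intro h
    apply ht0
    funext q
    have h1 := congrArg (fun p : (𝓞 K)[X] => p.coeff q.2) (congrFun h q.1)
    simp only [P, coeff_padePoly, Pi.zero_apply, Polynomial.coeff_zero] at h1
    rcases mul_eq_zero.1 h1 with h2 | h2
    · exact h2
    · exfalso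
      have h3 : 0 < N ! / (q.2 : ℕ)! := Nat.div_pos
        (Nat.factorial_le (Nat.lt_succ_iff.1 q.2.2)) (Nat.factorial_pos _)
      have : N ! / (q.2 : ℕ)! = 0 := by exact_mod_cast h2
      omega
  · intro i j
    rcases Nat.lt_or_ge j (N + 1) with hj | hj
    · have h1 := coeff_padePoly N (fun j => t (i, j)) ⟨j, hj⟩
      have h2 : ((P i).coeff j : K) = ((N ! / j ! : ℕ) : K) * (t (i, ⟨j, hj⟩) : K) := by
        rw [show (P i).coeff j = _ from h1, mul_comm]
        simp only [map_mul, map_natCast]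
      rw [h2, house_nat_mul]
      push_cast
      refine mul_le_mul ?_ ?_ (house_nonneg _) (by positivity)
      · exact_mod_cast Nat.div_le_self _ _
      · refine (htb' _).trans ?_
        have : C0 ^ N ≤ (C0 * 4 ^ n * (2 * C)) ^ N := Nat.pow_le_pow_left (by
          rw [mul_assoc]
          exact Nat.le_mul_of_pos_right _ (by positivity)) _
        exact_mod_cast this
    · rw [Polynomial.coeff_eq_zero_of_natDegree_lt
        (lt_of_le_of_lt (natDegree_padePoly _ _) (by omega))]
      have := house_intCast (K := K) 0
      simp only [Int.cast_zero, abs_zero] at this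
      rw [show ((0 : 𝓞 K) : K) = 0 from map_zero (algebraMap (𝓞 K) K), this]
      positivity
  · rw [X_pow_dvd_iff]
    intro ν hν
    have h1 := hcoef ν
    have h2 := congrFun ht ⟨ν, hν⟩
    have h3 : (d : K) * ∑ i, ∑ j : Fin (N + 1), (t (i, j) : K) * ((ν.choose j : K) *
        (((ν - j)! : K) * coeff (ν - j) (b i))) = 0 := by
      have h4 : ((A *ᵥ t) ⟨ν, hν⟩ : K) = 0 := by rw [h2]; simp
      rw [← h4]
      simp only [Matrix.mulVec, dotProduct, A, Fintype.sum_prod_type, map_sum, map_mul, map_natCast,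
        Finset.mul_sum]
      refine Finset.sum_congr rfl fun i _ => Finset.sum_congr rfl fun j _ => ?_
      rw [show algebraMap (𝓞 K) K (z i (ν - j)) = _ from (hz i (ν - j) (by omega)).symm]
      ring
    have hd' : (d : K) ≠ 0 := by exact_mod_cast hd0.ne'
    rw [(mul_eq_zero.1 h3).resolve_left hd', mul_zero] at h1
    exact (mul_eq_zero.1 h1).resolve_left (by exact_mod_cast Nat.factorial_ne_zero _)
  · intro ν
    rw [hcoef, house_nat_mul]
    push_cast
    refine mul_le_mul_of_nonneg_left ?_ (by positivity)
    have hterm : ∀ i (j : Fin (N + 1)), house ((t (i, j) : K) * ((ν.choose j : K) *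
        (((ν - j)! : K) * coeff (ν - j) (b i)))) ≤ (C0 : ℝ) ^ N * (2 ^ ν * (C : ℝ) ^ (ν + 1)) := by
      intro i j
      refine (house_mul_le _ _).trans ?_
      rw [house_nat_mul]
      refine mul_le_mul ?_ (mul_le_mul ?_ ?_ (house_nonneg _) (by positivity))
        (mul_nonneg (by positivity) (house_nonneg _)) (by positivity)
      · exact_mod_cast htb' (i, j)
      · exact_mod_cast Nat.choose_le_two_pow _ _
      · exact (hCb i _).trans (pow_le_pow_right₀ hC1' (by omega))
    have h2 : house (∑ i, ∑ j : Fin (N + 1), (t (i, j) : K) * ((ν.choose j : K) *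
        (((ν - j)! : K) * coeff (ν - j) (b i)))) ≤
        ∑ i : Fin n, ∑ j : Fin (N + 1), (C0 : ℝ) ^ N * (2 ^ ν * (C : ℝ) ^ (ν + 1)) :=
      (house_sum_le_sum_house _ _).trans (Finset.sum_le_sum fun i _ =>
        (house_sum_le_sum_house _ _).trans (Finset.sum_le_sum fun j _ => hterm i j))
    refine h2.trans ?_
    simp only [Finset.sum_const, Finset.card_univ, Fintype.card_fin, nsmul_eq_mul]
    have h3 : ((n : ℝ) * ((N + 1 : ℕ) : ℝ)) ≤ (4 ^ n) ^ N := by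
      have h4 : n * (N + 1) ≤ (4 ^ n) ^ N := by
        have h5 : n * (N + 1) ≤ 2 * n * N := by
          rw [mul_assoc, mul_left_comm]
          exact Nat.mul_le_mul_left _ (by omega)
        have h6 : (4 ^ n) ^ N = 2 ^ (2 * n * N) := by
          rw [show 4 = 2 ^ 2 by norm_num, ← pow_mul, ← pow_mul, mul_assoc]
        rw [h6]
        exact h5.trans Nat.lt_two_pow_self.le
      exact_mod_cast h4
    have h7 : (2 : ℝ) ^ ν * (C : ℝ) ^ (ν + 1) ≤ (2 * C) ^ (N + ν + 1) := by
      calc (2 : ℝ) ^ ν * (C : ℝ) ^ (ν + 1) ≤ 2 ^ (ν + 1) * (C : ℝ) ^ (ν + 1) := by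
            gcongr
            · norm_num
            · omega
        _ = (2 * C) ^ (ν + 1) := by rw [mul_pow]
        _ ≤ _ := pow_le_pow_right₀ (by linarith) (by omega)
    have h8 : (C0 : ℝ) ^ N ≤ (C0 : ℝ) ^ (N + ν + 1) :=
      pow_le_pow_right₀ (by exact_mod_cast hC01) (by omega)
    have h9 : ((4 : ℝ) ^ n) ^ N ≤ (4 ^ n) ^ (N + ν + 1) :=
      pow_le_pow_right₀ (one_le_pow₀ (by norm_num)) (by omega)
    calc _ = ((n : ℝ) * ((N + 1 : ℕ) : ℝ)) * ((C0 : ℝ) ^ N * (2 ^ ν * (C : ℝ) ^ (ν + 1))) := by ring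
      _ ≤ ((4 : ℝ) ^ n) ^ (N + ν + 1) * ((C0 : ℝ) ^ (N + ν + 1) * (2 * C) ^ (N + ν + 1)) := by
          refine mul_le_mul (h3.trans h9) (mul_le_mul h8 h7 ?_ ?_) ?_ ?_ <;> positivity
      _ = _ := by rw [mul_pow, mul_pow]; ring

end Siegel

section Norms
open PowerSeries
variable {K : Type*} [Field K] [CharZero K]

/-- A subadditive and submultiplicative size function. -/
structure IsSize (s : K → ℝ≥0∞) : Prop where
  zero : s 0 = 0
  add : ∀ a b, s (a + b) ≤ s a + s b
  mul : ∀ a b, s (a * b) ≤ s a * s b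

theorem IsSize.sum {s : K → ℝ≥0∞} (hs : IsSize s) {ι : Type*} (t : Finset ι) (f : ι → K) :
    s (∑ i ∈ t, f i) ≤ ∑ i ∈ t, s (f i) := by
  classical
  induction t using Finset.induction_on with
  | empty => simp [hs.zero]
  | insert a t ha ih =>
    rw [Finset.sum_insert ha, Finset.sum_insert ha]
    exact (hs.add _ _).trans (add_le_add le_rfl ih)

theorem IsSize.nat_mul {s : K → ℝ≥0∞} (hs : IsSize s) (n : ℕ) (a : K) :
    s (n * a) ≤ n * s a := by
  induction n with
  | zero => simp [hs.zero]
  | succ n ih =>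
    rw [Nat.cast_succ, Nat.cast_succ, add_mul, one_mul, add_mul, one_mul]
    exact (hs.add _ _).trans (add_le_add ih le_rfl)

/-- The weighted sum of the sizes of the coefficients. -/
def wsum (s : K → ℝ≥0∞) (w : ℕ → ℝ≥0∞) (f : K⟦X⟧) : ℝ≥0∞ := ∑' ν, s (coeff ν f) * w ν

/-- The sum of the sizes of the coefficients of a polynomial. -/
def psize (s : K → ℝ≥0∞) (p : K[X]) : ℝ≥0∞ := ∑ i ∈ Finset.range (p.natDegree + 1), s (p.coeff i)

theorem wsum_add {s : K → ℝ≥0∞} (hs : IsSize s) (w : ℕ → ℝ≥0∞) (f g : K⟦X⟧) :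
    wsum s w (f + g) ≤ wsum s w f + wsum s w g := by
  rw [wsum, wsum, wsum, ← ENNReal.tsum_add]
  refine ENNReal.tsum_le_tsum fun ν => ?_
  rw [map_add, ← add_mul]
  gcongr
  exact hs.add _ _

theorem wsum_sum {s : K → ℝ≥0∞} (hs : IsSize s) (w : ℕ → ℝ≥0∞) {ι : Type*} (t : Finset ι)
    (f : ι → K⟦X⟧) : wsum s w (∑ i ∈ t, f i) ≤ ∑ i ∈ t, wsum s w (f i) := by
  classical
  induction t using Finset.induction_on with
  | empty => simp [wsum, hs.zero]
  | insert a t ha ih =>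
    rw [Finset.sum_insert ha, Finset.sum_insert ha]
    exact (wsum_add hs _ _ _).trans (add_le_add le_rfl ih)

theorem wsum_poly_mul {s : K → ℝ≥0∞} (hs : IsSize s) (w w' : ℕ → ℝ≥0∞) (q : K[X]) (g : K⟦X⟧)
    (hw : ∀ i ≤ q.natDegree, ∀ ν, w (ν + i) ≤ w' ν) :
    wsum s w ((q : K⟦X⟧) * g) ≤ psize s q * wsum s w' g := by
  have hq : (q : K⟦X⟧) = ∑ i ∈ Finset.range (q.natDegree + 1),
      PowerSeries.C (q.coeff i) * (PowerSeries.X : K⟦X⟧) ^ i := by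
    conv_lhs => rw [q.as_sum_range_C_mul_X_pow]
    rw [coe_sum_poly]
    simp
  rw [hq, Finset.sum_mul, psize, Finset.sum_mul]
  refine (wsum_sum hs _ _ _).trans (Finset.sum_le_sum fun i hi => ?_)
  have hi' : i ≤ q.natDegree := by simpa [Nat.lt_succ_iff] using hi
  rw [wsum, wsum, ← ENNReal.tsum_mul_left, ← ENNReal.summable.sum_add_tsum_nat_add' (k := i),
    Finset.sum_eq_zero, zero_add]
  · refine ENNReal.tsum_le_tsum fun ν => ?_
    rw [mul_assoc, PowerSeries.coeff_C_mul, PowerSeries.coeff_X_pow_mul, ← mul_assoc]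
    exact mul_le_mul' (hs.mul _ _) (hw i hi' ν)
  · intro ν hν
    rw [mul_assoc, PowerSeries.coeff_C_mul, PowerSeries.coeff_X_pow_mul',
      if_neg (by simpa using hν), mul_zero, hs.zero, zero_mul]

theorem wsum_derivative {s : K → ℝ≥0∞} (hs : IsSize s) (w w' : ℕ → ℝ≥0∞) (g : K⟦X⟧)
    (hw : ∀ ν, coeff (ν + 1) g ≠ 0 → (ν + 1 : ℕ) * w ν ≤ w' (ν + 1)) :
    wsum s w (d⁄dX K g) ≤ wsum s w' g := by
  rw [wsum, wsum, tsum_eq_zero_add' (f := fun ν => s (coeff ν g) * w' ν) ENNReal.summable]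
  refine le_add_left (ENNReal.tsum_le_tsum fun ν => ?_)
  rw [PowerSeries.coeff_derivative]
  by_cases h : coeff (ν + 1) g = 0
  · rw [h, zero_mul, hs.zero, zero_mul, zero_mul]
  · rw [mul_comm, mul_comm (s _)]
    have h1 : s (coeff (ν + 1) g * ((ν : K) + 1)) ≤ (ν + 1 : ℕ) * s (coeff (ν + 1) g) := by
      rw [mul_comm]
      exact_mod_cast hs.nat_mul (ν + 1) (coeff (ν + 1) g)
    calc _ ≤ w ν * ((ν + 1 : ℕ) * s (coeff (ν + 1) g)) := by gcongr
      _ = ((ν + 1 : ℕ) * w ν) * s (coeff (ν + 1) g) := by ring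
      _ ≤ _ := by gcongr; exact hw ν h

theorem size_eval_one_le {s : K → ℝ≥0∞} (hs : IsSize s) (p : K[X]) :
    s (p.eval 1) ≤ wsum s 1 (p : K⟦X⟧) := by
  rw [Polynomial.eval_eq_sum_range]
  refine (hs.sum _ _).trans ?_
  simp only [one_pow, mul_one]
  refine le_trans (le_of_eq ?_) (ENNReal.sum_le_tsum (Finset.range (p.natDegree + 1)))
  simp

end Norms

section Sides
open PowerSeries
variable {K : Type*} [Field K] [CharZero K] {n : ℕ}

/-- Growth of the iterated derivatives of a linear form. -/
theorem wsum_nab_iter {s : K → ℝ≥0∞} (hs : IsSize s) (Q : K[X]) (B : Matrix (Fin n) (Fin n) K[X])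
    (q : ℝ≥0∞) (hQ : psize s Q ≤ q) (hB : ∀ i j, psize s (B i j) ≤ q) (δ : ℕ)
    (hδ : ∀ k N (P : Fin n → K[X]), (∀ j, (P j).natDegree ≤ N) →
      ∀ j, ((nab Q B)^[k] P j).natDegree ≤ N + k * δ) (N T : ℕ) (P : Fin n → K[X])
    (hP : ∀ j, (P j).natDegree ≤ N) (E : ℝ≥0∞) (hE : ∀ j, wsum s 1 (P j : K⟦X⟧) ≤ E) (k : ℕ)
    (hk : N + k * δ + n ≤ T) (j : Fin n) :
    wsum s 1 (((nab Q B)^[k] P j : K[X]) : K⟦X⟧) ≤ (q * T) ^ k * E := by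
  induction k generalizing j with
  | zero => simpa using hE j
  | succ k ih =>
    have hkT : N + k * δ + n ≤ T := by
      have : (k + 1) * δ = k * δ + δ := by ring
      omega
    replace ih := ih hkT
    set P' := (nab Q B)^[k] P with hP'
    rw [Function.iterate_succ_apply', ← hP']
    have hdeg := hδ k N P hP
    rw [nab, Polynomial.coe_add, Polynomial.coe_mul, coe_sum_poly]
    refine (wsum_add hs _ _ _).trans ?_
    have h1 : wsum s 1 ((Q : K⟦X⟧) * (Polynomial.derivative (P' j) : K[X])) ≤
        q * ((N + k * δ : ℕ) * ((q * T) ^ k * E)) := by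
      refine (wsum_poly_mul hs 1 1 Q _ (fun _ _ _ => le_rfl)).trans (mul_le_mul' hQ ?_)
      rw [← PowerSeries.derivative_coe]
      refine (wsum_derivative hs 1 (fun _ => (N + k * δ : ℕ)) _ ?_).trans ?_
      · intro ν hν
        rw [Pi.one_apply, mul_one]
        by_contra hlt
        apply hν
        rw [Polynomial.coeff_coe]
        refine Polynomial.coeff_eq_zero_of_natDegree_lt (lt_of_le_of_lt (hdeg j) ?_)
        rw [not_le] at hlt
        exact_mod_cast hlt
      · rw [wsum, ENNReal.tsum_mul_right, mul_comm]
        refine mul_le_mul' le_rfl ?_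
        simpa [wsum] using ih j
    have h2 : wsum s 1 (∑ i, ((P' i * B i j : K[X]) : K⟦X⟧)) ≤ q * (n * ((q * T) ^ k * E)) := by
      refine (wsum_sum hs _ _ _).trans ?_
      have : ∀ i ∈ Finset.univ, wsum s 1 ((P' i * B i j : K[X]) : K⟦X⟧) ≤ q * ((q * T) ^ k * E) := by
        intro i _
        rw [mul_comm, Polynomial.coe_mul]
        exact (wsum_poly_mul hs 1 1 _ _ (fun _ _ _ => le_rfl)).trans (mul_le_mul' (hB i j) (ih i))
      refine (Finset.sum_le_card_nsmul _ _ _ this).trans (le_of_eq ?_)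
      rw [Finset.card_univ, Fintype.card_fin, nsmul_eq_mul]
      ring
    refine (add_le_add h1 h2).trans ?_
    rw [← mul_add, ← add_mul, pow_succ']
    have h3 : ((N + k * δ : ℕ) : ℝ≥0∞) + n ≤ T := by exact_mod_cast hkT
    calc _ ≤ q * (T * ((q * T) ^ k * E)) := by gcongr
      _ = _ := by ring

/-- Growth of the iterated derivatives of the remainder. -/
theorem wsum_iter_derivative {s : K → ℝ≥0∞} (hs : IsSize s) (Q : K[X]) (δ : ℕ)
    (hδ : Q.natDegree ≤ δ) (R : ℕ → K⟦X⟧)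
    (hR : ∀ k, R (k + 1) = (Q : K⟦X⟧) * d⁄dX K (R k)) (k p : ℕ) :
    wsum s (fun ν => ((ν + p * δ) ^ p : ℕ)) (R k) ≤
      psize s Q ^ k * wsum s (fun ν => ((ν + (p + k) * δ) ^ (p + k) : ℕ)) (R 0) := by
  induction k generalizing p with
  | zero => simp
  | succ k ih =>
    rw [hR]
    refine (wsum_poly_mul hs _ (fun ν => ((ν + (p + 1) * δ) ^ p : ℕ)) Q _ ?_).trans ?_
    · intro i hi ν
      have : ν + i + p * δ ≤ ν + (p + 1) * δ := by
        have : (p + 1) * δ = p * δ + δ := by ring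
        omega
      exact_mod_cast Nat.pow_le_pow_left this p
    · rw [pow_succ', mul_assoc]
      refine mul_le_mul' le_rfl ?_
      refine (wsum_derivative hs _ (fun ν => ((ν + (p + 1) * δ) ^ (p + 1) : ℕ)) _ ?_).trans ?_
      · intro ν _
        have h1 : ν + (p + 1) * δ ≤ ν + 1 + (p + 1) * δ := by omega
        have h2 : (ν + 1) * (ν + (p + 1) * δ) ^ p ≤ (ν + 1 + (p + 1) * δ) ^ (p + 1) := by
          rw [pow_succ']
          exact Nat.mul_le_mul (by omega) (Nat.pow_le_pow_left h1 p)
        exact_mod_cast h2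
      · have := ih (p + 1)
        rwa [show p + 1 + k = p + (k + 1) by ring] at this

end Sides

section Entire
open PowerSeries

/-- Everywhere absolutely convergent power series. -/
def IsEntire (f : ℂ⟦X⟧) : Prop := ∀ r : ℝ, 0 ≤ r → Summable fun ν => ‖coeff ν f‖ * r ^ ν

theorem IsEntire.summable_norm {f : ℂ⟦X⟧} (hf : IsEntire f) (z : ℂ) :
    Summable fun ν => ‖coeff ν f * z ^ ν‖ := by
  simpa [norm_mul, norm_pow] using hf ‖z‖ (norm_nonneg z)

theorem coeff_mul_mul_pow (f g : ℂ⟦X⟧) (z : ℂ) (ν : ℕ) :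
    coeff ν (f * g) * z ^ ν = ∑ p ∈ Finset.HasAntidiagonal.antidiagonal ν,
      (coeff p.1 f * z ^ p.1) * (coeff p.2 g * z ^ p.2) := by
  rw [coeff_mul, Finset.sum_mul]
  refine Finset.sum_congr rfl fun p hp => ?_
  rw [← Finset.HasAntidiagonal.mem_antidiagonal.1 hp, pow_add]
  ring

theorem IsEntire.mul {f g : ℂ⟦X⟧} (hf : IsEntire f) (hg : IsEntire g) : IsEntire (f * g) := by
  intro r hr
  have h1 := summable_norm_sum_mul_antidiagonal_of_summable_norm (hf.summable_norm r)
    (hg.summable_norm r)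
  refine h1.congr fun ν => ?_
  rw [← coeff_mul_mul_pow, norm_mul, norm_pow, Complex.norm_real, Real.norm_of_nonneg hr]

theorem isEntire_of_finite {f : ℂ⟦X⟧} (N : ℕ) (hf : ∀ ν, N ≤ ν → coeff ν f = 0) : IsEntire f := by
  intro r _
  refine summable_of_ne_finset_zero (s := Finset.range N) fun ν hν => ?_
  rw [hf ν (by simpa using hν), norm_zero, zero_mul]

theorem isEntire_coe (p : ℂ[X]) : IsEntire (p : ℂ⟦X⟧) :=
  isEntire_of_finite (p.natDegree + 1) fun ν hν => by
    rw [Polynomial.coeff_coe, Polynomial.coeff_eq_zero_of_natDegree_lt (by omega)]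

theorem IsEntire.add {f g : ℂ⟦X⟧} (hf : IsEntire f) (hg : IsEntire g) : IsEntire (f + g) := by
  intro r hr
  refine Summable.of_nonneg_of_le (fun ν => by positivity) (fun ν => ?_) ((hf r hr).add (hg r hr))
  rw [map_add, ← add_mul]
  gcongr
  exact norm_add_le _ _

/-- The subalgebra of everywhere convergent power series. -/
def entire : Subalgebra ℂ ℂ⟦X⟧ where
  carrier := {f | IsEntire f}
  mul_mem' := IsEntire.mul
  add_mem' := IsEntire.add
  algebraMap_mem' c := by
    have := isEntire_coe (Polynomial.C c)
    rw [Polynomial.coe_C] at this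
    exact this

/-- Evaluation of an everywhere convergent power series. -/
def evalEntire (z : ℂ) : entire →ₐ[ℂ] ℂ where
  toFun f := ∑' ν, coeff ν f.1 * z ^ ν
  map_one' := by
    rw [tsum_eq_single 0]
    · simp
    · intro ν hν
      simp [coeff_one, hν]
  map_zero' := by simp
  map_add' f g := by
    have hf := (IsEntire.summable_norm f.2 z).of_norm
    have hg := (IsEntire.summable_norm g.2 z).of_norm
    rw [← hf.tsum_add hg]
    simp [add_mul]
  map_mul' f g := by
    rw [tsum_mul_tsum_eq_tsum_sum_antidiagonal_of_summable_norm (IsEntire.summable_norm f.2 z)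
      (IsEntire.summable_norm g.2 z)]
    refine tsum_congr fun ν => ?_
    rw [← coeff_mul_mul_pow]
    rfl
  commutes' c := by
    rw [tsum_eq_single 0]
    · simp
    · intro ν hν
      have : coeff ν ((algebraMap ℂ entire c : entire) : ℂ⟦X⟧) = 0 := by
        change coeff ν (PowerSeries.C c) = 0
        rw [coeff_C, if_neg hν]
      rw [this, zero_mul]

theorem evalEntire_apply (z : ℂ) (f : entire) :
    evalEntire z f = ∑' ν, coeff ν f.1 * z ^ ν := rfl

theorem evalEntire_coe (z : ℂ) (p : ℂ[X]) :
    evalEntire z ⟨p, isEntire_coe p⟩ = p.eval z := by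
  rw [evalEntire_apply, Polynomial.eval_eq_sum_range, tsum_eq_sum (s := Finset.range (p.natDegree + 1))]
  · simp
  · intro ν hν
    rw [Polynomial.coeff_coe, Polynomial.coeff_eq_zero_of_natDegree_lt (by simpa using hν), zero_mul]

theorem norm_evalEntire_one_le (f : entire) {c : ℝ} (hc : 0 ≤ c)
    (h : ∑' ν, ‖coeff ν f.1‖ₑ ≤ ENNReal.ofReal c) : ‖evalEntire 1 f‖ ≤ c := by
  have h1 : Summable fun ν => ‖coeff ν f.1‖ := by simpa using f.2 1 zero_le_one
  rw [evalEntire_apply]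
  simp only [one_pow, mul_one]
  refine (norm_tsum_le_tsum_norm h1).trans ?_
  rw [← ENNReal.ofReal_le_ofReal_iff hc, ENNReal.ofReal_tsum_of_nonneg (fun _ => norm_nonneg _) h1]
  simpa [ofReal_norm] using h

end Entire

section DetBound

theorem norm_det_le {m : Type*} [Fintype m] [DecidableEq m] (A : Matrix m m ℂ) (β γ : m → ℝ)
    (h : ∀ i j, ‖A i j‖ ≤ β i * γ j) :
    ‖A.det‖ ≤ (Fintype.card m)! * ((∏ i, β i) * ∏ j, γ j) := by
  rw [Matrix.det_apply]
  refine (norm_sum_le _ _).trans ?_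
  have : ∀ σ ∈ (Finset.univ : Finset (Equiv.Perm m)),
      ‖Equiv.Perm.sign σ • ∏ i, A (σ i) i‖ ≤ (∏ i, β i) * ∏ j, γ j := by
    intro σ _
    have h1 : ‖Equiv.Perm.sign σ • ∏ i, A (σ i) i‖ = ‖∏ i, A (σ i) i‖ := by
      rcases Int.units_eq_one_or (Equiv.Perm.sign σ) with h | h <;> simp [h]
    rw [h1, norm_prod, ← Equiv.prod_comp σ β, ← Finset.prod_mul_distrib]
    exact Finset.prod_le_prod (fun _ _ => norm_nonneg _) fun i _ => h _ _
  refine (Finset.sum_le_card_nsmul _ _ _ this).trans (le_of_eq ?_)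
  rw [Finset.card_univ, Fintype.card_perm, nsmul_eq_mul]

/-- Independent rows can be completed to an invertible matrix by rows from a spanning family. -/
theorem exists_completion {K : Type*} [Field K] {n q M : ℕ} (c : Fin q → Fin n → K)
    (hc : LinearIndependent K c) (w : Fin M → Fin n → K)
    (hw : ∀ v : Fin n → K, v ≠ 0 → ∃ i, ∑ j, w i j * v j ≠ 0) :
    ∃ r : Fin n → Fin q ⊕ Fin M, (Matrix.of fun i => Sum.elim c w (r i)).det ≠ 0 ∧
      (Finset.univ.filter fun i => (r i).isLeft).card = q := by
  classical
  have hcs : LinearIndepOn K id (Set.range c) := hc.linearIndepOn_id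
  obtain ⟨b, hb2, hb1, hb3, hb4⟩ := exists_linearIndepOn_id_extension hcs
    (show Set.range c ⊆ Set.range c ∪ Set.range w from Set.subset_union_left)
  have hspan : Submodule.span K b = ⊤ := by
    rw [eq_top_iff]
    have h1 : Submodule.span K (Set.range w) ≤ Submodule.span K b :=
      Submodule.span_le.2 (Set.subset_union_right.trans hb3)
    refine le_trans ?_ h1
    by_contra hne
    have hlt : Submodule.span K (Set.range w) < ⊤ := lt_of_le_of_ne le_top fun h => hne h.ge
    obtain ⟨f, hf0, hf⟩ := Submodule.exists_le_ker_of_lt_top _ hlt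
    have hfv : ∀ x : Fin n → K, f x = ∑ j, x j * f (Pi.single j 1) := by
      intro x
      conv_lhs => rw [pi_eq_sum_univ' x]
      simp [map_sum]
    obtain ⟨i, hi⟩ := hw (fun j => f (Pi.single j 1)) (by
      intro h0
      apply hf0
      refine LinearMap.ext fun x => ?_
      rw [hfv]
      simp [show ∀ j, f (Pi.single j 1) = 0 from fun j => congrFun h0 j])
    apply hi
    rw [← hfv]
    exact hf (Submodule.subset_span ⟨i, rfl⟩)
  have hbfin : b.Finite := hb4.setFinite
  let bb : Module.Basis b K (Fin n → K) := Module.Basis.mk hb4 (by simpa using hspan.ge)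
  have : Fintype b := hbfin.fintype
  have hcard : Fintype.card b = n := by
    rw [← Module.finrank_eq_card_basis bb]; simp
  let e : Fin n ≃ b := (Fintype.equivFinOfCardEq hcard).symm
  have hr : ∀ i : Fin n, ∃ x : Fin q ⊕ Fin M, Sum.elim c w x = (e i : Fin n → K) ∧
      (x.isLeft ↔ (e i : Fin n → K) ∈ Set.range c) := by
    intro i
    by_cases h : (e i : Fin n → K) ∈ Set.range c
    · obtain ⟨j, hj⟩ := h
      exact ⟨Sum.inl j, hj, by simp [← hj]⟩
    · rcases hb2 (e i).2 with h' | ⟨j, hj⟩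
      · exact absurd h' h
      · exact ⟨Sum.inr j, hj, by simpa using h⟩
  choose r hr1 hr2 using hr
  refine ⟨r, ?_, ?_⟩
  · have hli : LinearIndependent K fun i : Fin n => Sum.elim c w (r i) := by
      have h1 : (fun i : Fin n => Sum.elim c w (r i)) = (fun x : b => (x : Fin n → K)) ∘ e := by
        funext i; rw [hr1]; rfl
      rw [h1]
      exact LinearIndependent.comp hb4 e e.injective
    have := Matrix.linearIndependent_rows_iff_isUnit.1
      (show LinearIndependent K (Matrix.of fun i => Sum.elim c w (r i)).row from hli)
    exact ((Matrix.isUnit_iff_isUnit_det _).1 this).ne_zero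
  · have hq : q = Fintype.card (Fin q) := by simp
    conv_rhs => rw [hq, ← Finset.card_univ]
    symm
    have hmem : ∀ j : Fin q, c j ∈ b := fun j => hb1 ⟨j, rfl⟩
    refine Finset.card_bij (fun j _ => e.symm ⟨c j, hmem j⟩) ?_ ?_ ?_
    · intro j _
      simp [hr2]
    · intro j _ j' _ h
      have := e.symm.injective h
      exact hc.injective (Subtype.ext_iff.1 this)
    · intro i hi
      simp only [Finset.mem_filter, Finset.mem_univ, true_and] at hi
      obtain ⟨j, hj⟩ := (hr2 i).1 hi
      refine ⟨j, Finset.mem_univ _, ?_⟩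
      rw [Equiv.symm_apply_eq]
      exact Subtype.ext hj

end DetBound

section Growth

theorem factorial_pow_mul_factorial_le (N m k : ℕ) : N ! ^ k * m ! ≤ (k * N + m)! := by
  induction k with
  | zero => simp
  | succ k ih =>
    calc N ! ^ (k + 1) * m ! = N ! * (N ! ^ k * m !) := by ring
      _ ≤ N ! * (k * N + m)! := Nat.mul_le_mul_left _ ih
      _ ≤ (N + (k * N + m))! :=
        Nat.le_of_dvd (Nat.factorial_pos _) (Nat.factorial_mul_factorial_dvd_factorial_add _ _)
      _ = _ := by congr 1; ring

/-- The factorial growth that beats every geometric factor. -/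
theorem factorial_growth (n e c : ℕ) (hn : 0 < n) (A G : ℝ) :
    ∃ L0 : ℕ, ∀ L : ℕ, L0 ≤ L → ∀ N : ℕ,
      G * A ^ L * ((N ! : ℝ) ^ (n - 1) * (L : ℝ) ^ ((L + e) * (n - 1))) <
        ((((n - 1) * N + (2 * n * L - c))! : ℕ) : ℝ) := by
  have ht := (FloorSemiring.tendsto_pow_div_factorial_atTop A).const_mul G
  rw [mul_zero] at ht
  obtain ⟨L1, hL1⟩ := Filter.eventually_atTop.1 (ht.eventually_lt_const one_pos)
  refine ⟨max (max L1 1) (c + e * (n - 1)), fun L hL N => ?_⟩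
  have h1 : L1 ≤ L := by omega
  have h2 : 1 ≤ L := by omega
  have h3 : c + e * (n - 1) ≤ L := by omega
  have hlt : G * A ^ L < L ! := by
    have := hL1 L h1
    rwa [← mul_div_assoc, div_lt_one (by positivity)] at this
  have hLL : L ! * L ^ ((L + e) * (n - 1)) ≤ (2 * n * L - c)! := by
    calc L ! * L ^ ((L + e) * (n - 1)) ≤ L ! * (L + 1) ^ ((L + e) * (n - 1)) := by gcongr; omega
      _ ≤ (L + (L + e) * (n - 1))! := Nat.factorial_mul_pow_le_factorial
      _ ≤ (2 * n * L - c)! := by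
        apply Nat.factorial_le
        obtain ⟨m, rfl⟩ : ∃ m, n = m + 1 := ⟨n - 1, by omega⟩
        simp only [Nat.add_sub_cancel] at *
        apply Nat.le_sub_of_add_le
        nlinarith [Nat.zero_le (m * L)]
  calc G * A ^ L * ((N ! : ℝ) ^ (n - 1) * (L : ℝ) ^ ((L + e) * (n - 1)))
      < L ! * ((N ! : ℝ) ^ (n - 1) * (L : ℝ) ^ ((L + e) * (n - 1))) := by
        have : (0 : ℝ) < L := by exact_mod_cast h2
        gcongr
    _ = (N ! : ℝ) ^ (n - 1) * ((L ! * L ^ ((L + e) * (n - 1)) : ℕ) : ℝ) := by push_cast; ring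
    _ ≤ (N ! : ℝ) ^ (n - 1) * ((2 * n * L - c)! : ℕ) := by gcongr
    _ ≤ _ := by exact_mod_cast factorial_pow_mul_factorial_le N (2 * n * L - c) (n - 1)

theorem pow_div_factorial_le (M K ν : ℕ) (hK : K ≤ M) (hν : M ≤ ν) :
    (ν : ℝ) ^ K / ν ! ≤ 3 ^ ν / ((M - K)! * (ν - M)!) := by
  have h1 : (ν : ℝ) ^ K / K ! ≤ 3 ^ ν := by
    refine (Real.pow_div_factorial_le_exp ν (by positivity) K).trans ?_
    rw [← Real.exp_one_pow]
    gcongr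
    linarith [Real.exp_one_lt_d9]
  rw [div_le_iff₀ (by positivity)] at h1
  rw [div_le_div_iff₀ (by positivity) (by positivity)]
  have h2 : K ! * ((M - K)! * (ν - M)!) ≤ ν ! := by
    have a1 := Nat.le_of_dvd (Nat.factorial_pos _)
      (Nat.factorial_mul_factorial_dvd_factorial_add (M - K) (ν - M))
    have a2 := Nat.le_of_dvd (Nat.factorial_pos _)
      (Nat.factorial_mul_factorial_dvd_factorial_add K (M - K + (ν - M)))
    rw [show K + (M - K + (ν - M)) = ν by omega] at a2
    exact (Nat.mul_le_mul_left _ a1).trans a2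
  have h2' : (K ! : ℝ) * ((M - K)! * (ν - M)!) ≤ ν ! := by exact_mod_cast h2
  calc (ν : ℝ) ^ K * ((M - K)! * (ν - M)!) ≤ 3 ^ ν * K ! * ((M - K)! * (ν - M)!) := by gcongr
    _ = 3 ^ ν * (K ! * ((M - K)! * (ν - M)!)) := by ring
    _ ≤ _ := by gcongr

end Growth

section Tail
open PowerSeries
variable {K : Type*} [Field K] [CharZero K]

theorem tail_bound {s : K → ℝ≥0∞} (hs : IsSize s) (R : K⟦X⟧) (M m δ k C : ℕ) (D : ℝ) (hD : 0 ≤ D)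
    (hM : 1 ≤ M) (hm : m ≤ M) (hk : k ≤ m) (hR : X ^ M ∣ R)
    (hb : ∀ ν, s ((ν ! : K) * coeff ν R) ≤ ENNReal.ofReal (D * C ^ ν))
    (hfac : ∀ ν, s (coeff ν R) * ν ! ≤ s ((ν ! : K) * coeff ν R)) :
    ∑' ν, s (coeff ν R) * (((ν + k * δ) ^ k : ℕ) : ℝ≥0∞) ≤
      ENNReal.ofReal (D * (1 + δ) ^ m * (3 * C) ^ M / (M - m)! * Real.exp (3 * C)) := by
  have h0 : ∀ ν < M, coeff ν R = 0 := fun ν hν => X_pow_dvd_iff.1 hR ν hν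
  have hterm : ∀ j, s (coeff (j + M) R) * (((j + M + k * δ) ^ k : ℕ) : ℝ≥0∞) ≤
      ENNReal.ofReal (D * (1 + δ) ^ m * (3 * C) ^ M / (M - m)! * ((3 * C) ^ j / j !)) := by
    intro j
    set ν := j + M with hν
    have h1 : s (coeff ν R) ≤ ENNReal.ofReal (D * C ^ ν / ν !) := by
      rw [ENNReal.ofReal_div_of_pos (by positivity), ENNReal.ofReal_natCast,
        ENNReal.le_div_iff_mul_le (Or.inl (by positivity)) (Or.inl (ENNReal.natCast_ne_top _))]
      exact (hfac ν).trans (hb ν)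
    have h2 : (((ν + k * δ) ^ k : ℕ) : ℝ) ≤ (1 + δ) ^ m * ν ^ m := by
      have : (ν + k * δ) ^ k ≤ ((1 + δ) * ν) ^ m := by
        calc (ν + k * δ) ^ k ≤ ((1 + δ) * ν) ^ k := by
              gcongr
              nlinarith [show k ≤ ν by omega]
          _ ≤ _ := Nat.pow_le_pow_right (Nat.mul_pos (by omega) (by omega)) hk
      rw [← mul_pow]
      exact_mod_cast this
    have h3 := pow_div_factorial_le M m ν hm (by omega)
    rw [show ν - M = j by omega] at h3
    calc s (coeff ν R) * (((ν + k * δ) ^ k : ℕ) : ℝ≥0∞)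
        ≤ ENNReal.ofReal (D * C ^ ν / ν !) * ENNReal.ofReal ((1 + δ) ^ m * ν ^ m) := by
          refine mul_le_mul' h1 ?_
          rw [← ENNReal.ofReal_natCast]
          exact ENNReal.ofReal_le_ofReal h2
      _ = ENNReal.ofReal (D * C ^ ν / ν ! * ((1 + δ) ^ m * ν ^ m)) := by
          rw [← ENNReal.ofReal_mul (by positivity)]
      _ ≤ _ := by
          apply ENNReal.ofReal_le_ofReal
          calc D * C ^ ν / ν ! * ((1 + δ) ^ m * ν ^ m)
              = D * C ^ ν * (1 + δ) ^ m * (ν ^ m / ν !) := by ring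
            _ ≤ D * C ^ ν * (1 + δ) ^ m * (3 ^ ν / ((M - m)! * j !)) := by gcongr
            _ = _ := by
              rw [hν, mul_pow, mul_pow, pow_add, pow_add]
              field_simp
  have hsplit : ∑' ν, s (coeff ν R) * (((ν + k * δ) ^ k : ℕ) : ℝ≥0∞) =
      ∑' j, s (coeff (j + M) R) * (((j + M + k * δ) ^ k : ℕ) : ℝ≥0∞) := by
    rw [← ENNReal.summable.sum_add_tsum_nat_add' (k := M)
      (f := fun ν => s (coeff ν R) * (((ν + k * δ) ^ k : ℕ) : ℝ≥0∞)), Finset.sum_eq_zero, zero_add]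
    intro ν hν
    rw [h0 ν (by simpa using hν), hs.zero, zero_mul]
  rw [hsplit]
  refine (ENNReal.tsum_le_tsum hterm).trans ?_
  have hsum := Real.summable_pow_div_factorial (3 * C : ℝ)
  rw [← ENNReal.ofReal_tsum_of_nonneg (fun j => by positivity) (hsum.mul_left _), tsum_mul_left,
    Real.exp_eq_exp_ℝ, NormedSpace.exp_eq_tsum_div]

end Tail

section IntCoeff
variable {K : Type*} [Field K]

/-- A polynomial with algebraic integer coefficients. -/
def IntCoeff (p : K[X]) : Prop := ∀ i, IsIntegral ℤ (p.coeff i)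

theorem IntCoeff.add {p q : K[X]} (hp : IntCoeff p) (hq : IntCoeff q) : IntCoeff (p + q) :=
  fun i => by rw [Polynomial.coeff_add]; exact (hp i).add (hq i)

theorem IntCoeff.mul {p q : K[X]} (hp : IntCoeff p) (hq : IntCoeff q) : IntCoeff (p * q) :=
  fun i => by
    rw [Polynomial.coeff_mul]
    exact IsIntegral.sum _ fun x _ => (hp _).mul (hq _)

theorem IntCoeff.sum {ι : Type*} {s : Finset ι} {p : ι → K[X]} (hp : ∀ i, IntCoeff (p i)) :
    IntCoeff (∑ i ∈ s, p i) :=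
  fun i => by
    rw [Polynomial.finsetSum_coeff]
    exact IsIntegral.sum _ fun x _ => hp _ _

theorem IntCoeff.derivative {p : K[X]} (hp : IntCoeff p) :
    IntCoeff (Polynomial.derivative p) :=
  fun i => by
    rw [Polynomial.coeff_derivative]
    refine (hp _).mul ?_
    have := isIntegral_algebraMap (R := ℤ) (A := K) (x := (i + 1 : ℤ))
    simpa using this

theorem IntCoeff.eval_one {p : K[X]} (hp : IntCoeff p) : IsIntegral ℤ (p.eval 1) := by
  rw [Polynomial.eval_eq_sum_range]
  exact IsIntegral.sum _ fun x _ => by simpa using hp x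

theorem IntCoeff.nab_iter [CharZero K] {n : ℕ} {Q : K[X]} {B : Matrix (Fin n) (Fin n) K[X]}
    (hQ : IntCoeff Q)
    (hB : ∀ i j, IntCoeff (B i j)) {P : Fin n → K[X]} (hP : ∀ j, IntCoeff (P j)) (m : ℕ) (j : Fin n) :
    IntCoeff ((nab Q B)^[m] P j) := by
  induction m generalizing j with
  | zero => exact hP j
  | succ m ih =>
    rw [Function.iterate_succ_apply']
    exact (hQ.mul (ih j).derivative).add (IntCoeff.sum fun i => (ih i).mul (hB i j))

end IntCoeff

section RankBound
open PowerSeries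
variable {K : Type*} [Field K] [NumberField K] (ι : K →+* ℂ)

theorem isSize_house : IsSize (fun x : K => ENNReal.ofReal (house x)) where
  zero := by simp [house]
  add a b := by
    rw [← ENNReal.ofReal_add (house_nonneg _) (house_nonneg _)]
    exact ENNReal.ofReal_le_ofReal (house_add_le _ _)
  mul a b := by
    rw [← ENNReal.ofReal_mul (house_nonneg _)]
    exact ENNReal.ofReal_le_ofReal (house_mul_le _ _)

theorem isSize_embedding : IsSize (fun x : K => ‖ι x‖ₑ) where
  zero := by simp
  add a b := by
    rw [map_add]
    exact enorm_add_le _ _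
  mul a b := by
    rw [map_mul, enorm_mul]

theorem EBound.isEntire {J : Type*} {b : J → K⟦X⟧} {C : ℕ} (h : EBound b C) (i : J) :
    IsEntire ((b i).map ι) := by
  intro r hr
  have h1 : Summable fun ν : ℕ => (C : ℝ) * ((C * r) ^ ν / ν !) :=
    (Real.summable_pow_div_factorial (C * r)).mul_left _
  refine Summable.of_nonneg_of_le (fun ν => by positivity) (fun ν => ?_) h1
  have h2 := (norm_embedding_le_house _ ι).trans (h.2.1 i ν)
  rw [map_mul, map_natCast, norm_mul, Complex.norm_natCast] at h2
  rw [coeff_map]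
  have h3 : ‖ι (coeff ν (b i))‖ ≤ C ^ (ν + 1) / ν ! := by
    rw [le_div_iff₀ (by positivity), mul_comm]
    exact h2
  calc ‖ι (coeff ν (b i))‖ * r ^ ν ≤ C ^ (ν + 1) / ν ! * r ^ ν := by gcongr
    _ = _ := by rw [mul_pow, pow_succ]; ring

theorem det_estimate {n q : ℕ} (W : Matrix (Fin n) (Fin n) K) (hInt : ∀ i j, IsIntegral ℤ (W i j))
    (hdet : W.det ≠ 0) (p : Fin n → Prop) [DecidablePred p] (Γ x y : ℝ) (hΓ : 1 ≤ Γ) (hx : 1 ≤ x)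
    (hy : 0 ≤ y) (h1 : ∀ i j, p i → house (W i j) ≤ Γ) (h2 : ∀ i j, ¬ p i → house (W i j) ≤ x)
    (v : Fin n → ℂ) (h3 : ∀ i, p i → ∑ j, ι (W i j) * v j = 0)
    (h4 : ∀ i, ¬ p i → ‖∑ j, ι (W i j) * v j‖ ≤ y) (j0 : Fin n)
    (hq : (Finset.univ.filter p).card = q) :
    ‖v j0‖ * x ≤ (n ! * Γ ^ q) ^ Module.finrank ℚ K * x ^ ((n - q) * Module.finrank ℚ K) * y := by
  have hx0 : 0 < x := by linarith
  set β : Fin n → ℝ := fun i => if p i then Γ else x with hβ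
  have hβprod : ∏ i, β i = Γ ^ q * x ^ (n - q) := by
    rw [hβ, Finset.prod_ite, Finset.prod_const, Finset.prod_const, hq]
    congr 2
    have := Finset.card_filter_add_card_filter_not (s := (Finset.univ : Finset (Fin n))) p
    rw [hq, Finset.card_univ, Fintype.card_fin] at this
    omega
  have hhouse : house W.det ≤ n ! * (Γ ^ q * x ^ (n - q)) := by
    have : ∀ τ : K →+* ℂ, ‖τ W.det‖ ≤ n ! * (Γ ^ q * x ^ (n - q)) := by
      intro τ
      rw [RingHom.map_det]
      have := norm_det_le (τ.mapMatrix W) β (fun _ => 1) (fun i j => by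
        rw [mul_one, RingHom.mapMatrix_apply, Matrix.map_apply]
        refine (norm_embedding_le_house _ τ).trans ?_
        by_cases hp : p i
        · simpa [hβ, hp] using h1 i j hp
        · simpa [hβ, hp] using h2 i j hp)
      simpa [hβprod] using this
    refine (pi_norm_le_iff_of_nonneg (by positivity)).2 fun τ => ?_
    rw [canonicalEmbedding.apply_at]
    exact this τ
  have hD : ‖ι W.det‖ * ‖v j0‖ ≤ n ! * (Γ ^ q * x ^ (n - q) * (y / x)) := by
    have hcr : ι W.det * v j0 = ((ι.mapMatrix W).updateCol j0 ((ι.mapMatrix W) *ᵥ v)).det := by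
      have := congrFun (Matrix.cramer_eq_adjugate_mulVec (ι.mapMatrix W) ((ι.mapMatrix W) *ᵥ v)) j0
      rw [Matrix.mulVec_mulVec, Matrix.adjugate_mul, Matrix.smul_mulVec, Matrix.one_mulVec,
        Matrix.cramer_apply] at this
      rw [this, RingHom.map_det]
      rfl
    rw [← norm_mul, hcr]
    have := norm_det_le ((ι.mapMatrix W).updateCol j0 ((ι.mapMatrix W) *ᵥ v)) β
      (fun j => if j = j0 then y / x else 1) (fun i j => by
        rw [Matrix.updateCol_apply]
        by_cases hj : j = j0
        · rw [if_pos hj, if_pos hj]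
          have hmv : ((ι.mapMatrix W) *ᵥ v) i = ∑ j, ι (W i j) * v j := rfl
          rw [hmv]
          by_cases hp : p i
          · rw [h3 i hp, norm_zero]
            simp only [hβ, hp, if_true]
            positivity
          · refine (h4 i hp).trans (le_of_eq ?_)
            simp only [hβ, hp, if_false]
            field_simp
        · rw [if_neg hj, if_neg hj, mul_one, RingHom.mapMatrix_apply, Matrix.map_apply]
          refine (norm_embedding_le_house _ ι).trans ?_
          by_cases hp : p i
          · simpa [hβ, hp] using h1 i j hp
          · simpa [hβ, hp] using h2 i j hp)
    simpa [hβprod, Finset.prod_ite_eq'] using this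
  have hnorm : 1 ≤ ‖ι W.det‖ * house W.det ^ (Module.finrank ℚ K - 1) := by
    refine le_trans ?_ (norm_norm_le_norm_mul_house_pow W.det ι)
    have hI : IsIntegral ℤ W.det := by
      rw [Matrix.det_apply]
      refine IsIntegral.sum _ fun σ _ => ?_
      have : IsIntegral ℤ (∏ i, W (σ i) i) := IsIntegral.prod _ fun i _ => hInt _ _
      rcases Int.units_eq_one_or (Equiv.Perm.sign σ) with h | h
      · simpa [h] using this
      · simpa [h] using this.neg
    obtain ⟨m, hm⟩ := IsIntegrallyClosed.isIntegral_iff.1 (Algebra.isIntegral_norm ℚ hI)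
    have hne : Algebra.norm ℚ W.det ≠ 0 := Algebra.norm_ne_zero_iff.2 hdet
    rw [← hm] at hne ⊢
    have : m ≠ 0 := by rintro rfl; simp at hne
    have : (1 : ℤ) ≤ |m| := Int.one_le_abs this
    simp only [algebraMap_int_eq, eq_intCast, Int.norm_cast_rat, Int.norm_eq_abs]
    exact_mod_cast this
  obtain ⟨h, hh⟩ : ∃ h, Module.finrank ℚ K = h + 1 :=
    ⟨Module.finrank ℚ K - 1, by have := Module.finrank_pos (R := ℚ) (M := K); omega⟩
  rw [hh] at hnorm ⊢
  rw [Nat.add_sub_cancel] at hnorm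
  calc ‖v j0‖ * x ≤ ‖v j0‖ * x * (‖ι W.det‖ * house W.det ^ h) :=
        le_mul_of_one_le_right (by positivity) hnorm
    _ = (‖ι W.det‖ * ‖v j0‖) * house W.det ^ h * x := by ring
    _ ≤ (n ! * (Γ ^ q * x ^ (n - q) * (y / x))) * (n ! * (Γ ^ q * x ^ (n - q))) ^ h * x := by
        have := house_nonneg W.det
        gcongr
    _ = _ := by
        rw [pow_mul, pow_succ (n ! * Γ ^ q : ℝ), pow_succ (x ^ (n - q))]
        field_simp
        ring

theorem coeff_frm_map {n : ℕ} (P : Fin n → K[X]) (b : Fin n → K⟦X⟧) :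
    (frm P b).map ι = ∑ j, (((P j).map ι : ℂ[X]) : ℂ⟦X⟧) * (b j).map ι := by
  unfold frm
  rw [map_sum]
  refine Finset.sum_congr rfl fun j _ => ?_
  rw [map_mul, Polynomial.polynomial_map_coe]

theorem evalEntire_frm {n : ℕ} (P : Fin n → K[X]) (b : Fin n → K⟦X⟧)
    (hb : ∀ j, IsEntire ((b j).map ι)) :
    ∃ h : IsEntire ((frm P b).map ι), evalEntire 1 ⟨_, h⟩ =
      ∑ j, ι ((P j).eval 1) * evalEntire 1 ⟨_, hb j⟩ := by
  have h : (frm P b).map ι = ((∑ j, (⟨_, isEntire_coe ((P j).map ι)⟩ : entire) * ⟨_, hb j⟩ :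
      entire) : ℂ⟦X⟧) := by
    rw [coeff_frm_map, AddSubmonoidClass.coe_finsetSum]
    rfl
  have h1 : IsEntire ((frm P b).map ι) := by rw [h]; exact Subtype.property _
  refine ⟨h1, ?_⟩
  have h2 : (⟨(frm P b).map ι, h1⟩ : entire) = _ := Subtype.ext h
  rw [h2, map_sum]
  refine Finset.sum_congr rfl fun j _ => ?_
  rw [map_mul, evalEntire_coe, Polynomial.eval_map, Polynomial.eval₂_at_one]

set_option maxHeartbeats 1000000 in
/-- Linear relations over `K` between the values at `1`. -/
theorem rank_bound_of_integral {n q : ℕ} (Q : K[X]) (B : Matrix (Fin n) (Fin n) K[X])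
    (hQi : IntCoeff Q) (hBi : ∀ i j, IntCoeff (B i j)) (hQ : Q.eval 1 ≠ 0) (b : Fin n → K⟦X⟧)
    (hb : ∀ P, frm P b = 0 → P = 0) (hsol : IsSol Q B b) (C : ℕ) (hC : EBound b C)
    (c : Fin q → Fin n → K) (hc : LinearIndependent K c) (hci : ∀ i j, IsIntegral ℤ (c i j))
    (hv : ∀ i, ∑ j, ι (c i j) * evalEntire 1 ⟨_, hC.isEntire ι j⟩ = 0) (j0 : Fin n)
    (hj0 : evalEntire 1 ⟨_, hC.isEntire ι j0⟩ ≠ 0) :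
    n ≤ Module.finrank ℚ K * (n - q) := by
  by_contra! hlt
  have hn : 0 < n := by omega
  set v : Fin n → ℂ := fun j => evalEntire 1 ⟨_, hC.isEntire ι j⟩ with hvdef
  obtain ⟨c', hspan⟩ := values_span Q B 1 one_ne_zero hQ b hb hsol
  obtain ⟨δ, hδQ, hδB⟩ := exists_degree_bound Q B
  obtain ⟨C1, hC1, hpade⟩ := pade_exists hn b C hC
  obtain ⟨q0, hq0, hq0Q, hq0B⟩ : ∃ q0 : ℕ, 1 ≤ q0 ∧
      psize (fun x : K => ENNReal.ofReal (house x)) Q ≤ q0 ∧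
      ∀ i j, psize (fun x : K => ENNReal.ofReal (house x)) (B i j) ≤ q0 := by
    have hfin : ∀ p : K[X], psize (fun x : K => ENNReal.ofReal (house x)) p ≠ ⊤ := fun p =>
      ENNReal.sum_ne_top.2 fun _ _ => ENNReal.ofReal_ne_top
    obtain ⟨m, hm⟩ := ENNReal.exists_nat_gt (r := psize (fun x : K => ENNReal.ofReal (house x)) Q +
      ∑ i, ∑ j, psize (fun x : K => ENNReal.ofReal (house x)) (B i j))
      (ENNReal.add_ne_top.2 ⟨hfin _, ENNReal.sum_ne_top.2 fun _ _ =>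
        ENNReal.sum_ne_top.2 fun _ _ => hfin _⟩)
    have hmm : (m : ℝ≥0∞) ≤ (m + 1 : ℕ) := by exact_mod_cast Nat.le_succ m
    refine ⟨m + 1, by omega, ?_, fun i j => ?_⟩
    · exact (le_self_add.trans hm.le).trans hmm
    · refine le_trans (le_trans ?_ (le_add_self.trans hm.le)) hmm
      exact (Finset.single_le_sum (f := fun j => psize (fun x : K => ENNReal.ofReal (house x)) (B i j))
        (fun _ _ => zero_le) (Finset.mem_univ j)).trans
        (Finset.single_le_sum (f := fun i => ∑ j, psize (fun x : K => ENNReal.ofReal (house x)) (B i j))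
        (fun _ _ => zero_le) (Finset.mem_univ i))
  obtain ⟨Γ, hΓ1, hΓ⟩ : ∃ Γ : ℝ, 1 ≤ Γ ∧ ∀ i j, house (c i j) ≤ Γ := by
    refine ⟨1 + ∑ i, ∑ j, house (c i j), ?_, fun i j => ?_⟩
    · have : 0 ≤ ∑ i, ∑ j, house (c i j) :=
        Finset.sum_nonneg fun _ _ => Finset.sum_nonneg fun _ _ => house_nonneg _
      linarith
    · have h1 := Finset.single_le_sum (f := fun j => house (c i j))
        (fun _ _ => house_nonneg _) (Finset.mem_univ j)
      have h2 := Finset.single_le_sum (f := fun i => ∑ j, house (c i j))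
        (fun _ _ => Finset.sum_nonneg fun _ _ => house_nonneg _) (Finset.mem_univ i)
      linarith
  set e := n + c' with he
  set A1 : ℕ := q0 * (2 * n + 2 + (1 + e) * δ + n) with hA1
  set A2 : ℕ := (2 * C1) ^ (2 * n + 2) * A1 with hA2
  set A3 : ℕ := q0 * C1 ^ (2 * n + 2) * (1 + δ) * (3 * C1) ^ (n * (2 * n + 2)) with hA3
  set G0 : ℝ := (n ! * Γ ^ q) ^ Module.finrank ℚ K with hG0
  set A : ℝ := (A2 : ℝ) ^ (n - 1) * A3 with hA
  have hvpos : 0 < ‖v j0‖ := norm_pos_iff.2 hj0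
  obtain ⟨L0, hL0⟩ := factorial_growth n e c' hn A (G0 * Real.exp (3 * C1) * A ^ e / ‖v j0‖)
  set L := max (max L0 1) (c' + 1) with hL
  have hL0L : L0 ≤ L := by omega
  have hL1 : 1 ≤ L := by omega
  have hLc : c' + 1 ≤ L := by omega
  set N := (2 * n + 2) * L with hN
  have hnL : n * L + n * L + L + L = N := by rw [hN]; ring
  have hNL : L ≤ n * L := Nat.le_mul_of_pos_left _ hn
  have hNN : N ≤ n * N := Nat.le_mul_of_pos_left _ hn
  set M := n * (N + 1) - L with hM
  have hMe : M + L = n * N + n := by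
    have : n * (N + 1) = n * N + n := by ring
    omega
  set kk := n + L + c' with hkk
  have hkL : kk = L + e := by omega
  have hkM : kk ≤ M := by omega
  obtain ⟨P, hP0, hPdeg, hPh, hPdvd, hPr⟩ := hpade L N hL1 hN
  set P' : Fin n → K[X] := fun i => (P i).map (algebraMap (𝓞 K) K) with hP'
  have hP'0 : P' ≠ 0 := by
    intro h
    apply hP0
    funext i
    have := congrFun h i
    rw [hP'] at this
    exact (Polynomial.map_eq_zero_iff (RingOfIntegers.coe_injective)).1 this
  have hP'deg : ∀ i, (P' i).natDegree ≤ N := fun i =>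
    (Polynomial.natDegree_map_le).trans (hPdeg i)
  have hP'i : ∀ i, IntCoeff (P' i) := fun i j => by
    rw [hP', Polynomial.coeff_map]
    exact RingOfIntegers.isIntegral_coe _
  set T := N + kk * δ + n with hT
  set x : ℕ := (N + 1) * (N ! * C1 ^ N) * (q0 * T) ^ kk with hx
  have hT1 : 1 ≤ q0 * T := Nat.mul_pos hq0 (by omega)
  have hNx : N ! ≤ x := by
    calc N ! = 1 * (N ! * 1) * 1 := by ring
      _ ≤ (N + 1) * (N ! * C1 ^ N) * (q0 * T) ^ kk := by
        gcongr
        · omega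
        · exact Nat.one_le_pow _ _ hC1
        · exact Nat.one_le_pow _ _ hT1
  have hhouse : ∀ k < kk, ∀ j, house (((nab Q B)^[k] P' j).eval 1) ≤ x := by
    intro k hk j
    have h1 := wsum_nab_iter isSize_house Q B q0 hq0Q hq0B δ
      (fun k N P hP j => natDegree_nab_iter_le hδQ hδB hP k j) N T P' hP'deg
      (((N + 1) * (N ! * C1 ^ N) : ℕ) : ℝ≥0∞) (fun j => by
        unfold wsum
        rw [tsum_eq_sum (s := Finset.range (N + 1))]
        · refine (Finset.sum_le_card_nsmul _ _ ((N ! * C1 ^ N : ℕ) : ℝ≥0∞) fun i _ => ?_).trans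
            (le_of_eq ?_)
          · rw [Pi.one_apply, mul_one, Polynomial.coeff_coe, hP', Polynomial.coeff_map,
              ← ENNReal.ofReal_natCast]
            exact ENNReal.ofReal_le_ofReal (hPh j i)
          · rw [Finset.card_range, nsmul_eq_mul, Nat.cast_mul (N + 1)]
        · intro i hi
          rw [Polynomial.coeff_coe, Polynomial.coeff_eq_zero_of_natDegree_lt,
            show (fun x : K => ENNReal.ofReal (house x)) 0 = 0 from isSize_house.zero, zero_mul]
          have := hP'deg j
          simp only [Finset.mem_range] at hi
          omega) k (by rw [hT]; gcongr) j
    have h2 := (size_eval_one_le isSize_house _).trans h1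
    have h3 : ((q0 : ℝ≥0∞) * T) ^ k * (((N + 1) * (N ! * C1 ^ N) : ℕ) : ℝ≥0∞) ≤ ENNReal.ofReal x := by
      rw [ENNReal.ofReal_natCast]
      have : (q0 * T) ^ k * ((N + 1) * (N ! * C1 ^ N)) ≤ x := by
        rw [hx, mul_comm]
        gcongr
      exact_mod_cast this
    exact (ENNReal.ofReal_le_ofReal_iff (by positivity)).1 (h2.trans h3)
  set y : ℝ := q0 ^ kk * (N ! * C1 ^ (N + 1) * (1 + δ) ^ kk * (3 * C1) ^ M / (M - kk)! *
    Real.exp (3 * C1)) with hy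
  have hval : ∀ k < kk, ‖∑ j, ι (((nab Q B)^[k] P' j).eval 1) * v j‖ ≤ y := by
    intro k hk
    obtain ⟨hent, heq⟩ := evalEntire_frm ι ((nab Q B)^[k] P') b (hC.isEntire ι)
    rw [hvdef, ← heq]
    refine norm_evalEntire_one_le _ (by positivity) ?_
    have h1 := wsum_iter_derivative (isSize_embedding ι) Q δ hδQ (fun k => frm ((nab Q B)^[k] P') b)
      (fun k => nab_iter_frm hsol P' k) k 0
    have h2 := tail_bound (isSize_embedding ι) (frm P' b) M kk δ k C1 (N ! * C1 ^ (N + 1))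
      (by positivity) (by omega) hkM hk.le hPdvd (fun ν => by
        rw [← ofReal_norm]
        refine ENNReal.ofReal_le_ofReal (((norm_embedding_le_house _ ι).trans (hPr ν)).trans
          (le_of_eq ?_))
        push_cast
        ring) (fun ν => by
        rw [map_mul, enorm_mul, map_natCast, mul_comm, ← ofReal_norm (ν ! : ℂ), Complex.norm_natCast,
          ENNReal.ofReal_natCast])
    have h3 : psize (fun x : K => ‖ι x‖ₑ) Q ≤ q0 := by
      refine le_trans (Finset.sum_le_sum fun i _ => ?_) hq0Q
      beta_reduce
      rw [← ofReal_norm]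
      exact ENNReal.ofReal_le_ofReal (norm_embedding_le_house _ ι)
    have h4 : ∑' ν, ‖coeff ν ((frm ((nab Q B)^[k] P') b).map ι)‖ₑ =
        wsum (fun x : K => ‖ι x‖ₑ) (fun ν => ((ν + 0 * δ) ^ 0 : ℕ)) (frm ((nab Q B)^[k] P') b) := by
      unfold wsum
      simp
    rw [h4]
    refine h1.trans ?_
    rw [hy, ENNReal.ofReal_mul (by positivity), ENNReal.ofReal_pow (by positivity),
      ENNReal.ofReal_natCast]
    refine mul_le_mul' ?_ ?_
    · calc psize (fun x : K => ‖ι x‖ₑ) Q ^ k ≤ (q0 : ℝ≥0∞) ^ k := by gcongr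
        _ ≤ (q0 : ℝ≥0∞) ^ kk := pow_le_pow_right₀ (by exact_mod_cast hq0) hk.le
    · rw [zero_add]
      exact h2
  obtain ⟨r, hrdet, hrcard⟩ := exists_completion c hc
    (fun (k : Fin kk) j => ((nab Q B)^[k] P' j).eval 1) (fun w hw => by
      obtain ⟨k, hk, hk'⟩ := hspan N L M P' hP'0 hP'deg hPdvd
        (le_of_eq (by rw [hMe]; ring)) (by omega) w hw
      exact ⟨⟨k, hk⟩, hk'⟩)
  have hmain := det_estimate ι _ (fun i j => by
      rw [Matrix.of_apply]
      rcases r i with k | k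
      · exact hci _ _
      · exact (IntCoeff.nab_iter hQi hBi hP'i _ _).eval_one) hrdet
    (fun i => (r i).isLeft = true) Γ x y hΓ1
    (by exact_mod_cast (Nat.factorial_pos N).trans_le hNx) (by positivity)
    (fun i j hi => by
      rw [Matrix.of_apply]
      obtain ⟨k, hk⟩ := Sum.isLeft_iff.1 hi
      rw [hk]
      exact hΓ _ _)
    (fun i j hi => by
      rw [Matrix.of_apply]
      rw [Sum.not_isLeft, Sum.isRight_iff] at hi
      obtain ⟨k, hk⟩ := hi
      rw [hk]
      exact hhouse _ k.2 _) v
    (fun i hi => by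
      obtain ⟨k, hk⟩ := Sum.isLeft_iff.1 hi
      simp only [Matrix.of_apply, hk, Sum.elim_inl]
      exact hv k)
    (fun i hi => by
      rw [Sum.not_isLeft, Sum.isRight_iff] at hi
      obtain ⟨k, hk⟩ := hi
      simp only [Matrix.of_apply, hk, Sum.elim_inr]
      exact hval k k.2) j0 hrcard
  have hxle : x ≤ N ! * (A2 ^ (L + e) * L ^ (L + e)) := by
    have h1 : N + 1 ≤ 2 ^ N := Nat.lt_two_pow_self
    have h2 : q0 * T ≤ A1 * L := by
      rw [hA1, mul_assoc]
      refine Nat.mul_le_mul_left _ ?_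
      have e1 : kk * δ ≤ (1 + e) * δ * L := by
        rw [hkL]
        have : L + e ≤ (1 + e) * L := by nlinarith
        calc (L + e) * δ ≤ ((1 + e) * L) * δ := by gcongr
          _ = _ := by ring
      have e2 : (2 * n + 2 + (1 + e) * δ + n) * L = N + (1 + e) * δ * L + n * L := by rw [hN]; ring
      have e3 : n ≤ n * L := Nat.le_mul_of_pos_right _ hL1
      omega
    calc x ≤ 2 ^ N * (N ! * C1 ^ N) * (A1 * L) ^ kk := by rw [hx]; gcongr
      _ = N ! * (((2 * C1) ^ (2 * n + 2)) ^ L * A1 ^ (L + e) * L ^ (L + e)) := by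
        rw [hkL, hN, ← pow_mul]; ring_nf
      _ ≤ N ! * (((2 * C1) ^ (2 * n + 2)) ^ (L + e) * A1 ^ (L + e) * L ^ (L + e)) := by
        gcongr
        · exact Nat.one_le_pow _ _ (by omega)
        · omega
      _ = _ := by rw [hA2]; ring_nf
  have hyle : y ≤ N ! * A3 ^ (L + e) * Real.exp (3 * C1) / (M - kk)! := by
    have h1 : (C1 : ℝ) ^ (N + 1) ≤ (C1 ^ (2 * n + 2)) ^ (L + e) := by
      rw [← pow_mul]
      refine pow_le_pow_right₀ (by exact_mod_cast hC1) ?_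
      rw [mul_add, ← hN]
      nlinarith
    have h2 : (3 * C1 : ℝ) ^ M ≤ ((3 * C1) ^ (n * (2 * n + 2))) ^ (L + e) := by
      rw [← pow_mul]
      refine pow_le_pow_right₀ (by have : (1 : ℝ) ≤ C1 := by exact_mod_cast hC1
                                   linarith) ?_
      have : n * (2 * n + 2) * (L + e) = n * N + n * (2 * n + 2) * e := by rw [hN]; ring
      rw [this]
      have : n ≤ n * (2 * n + 2) * e := by
        nlinarith [Nat.zero_le (n * n * e), Nat.mul_le_mul_left n (show 1 ≤ e by omega)]
      omega
    rw [hy, hkL]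
    calc (q0 : ℝ) ^ (L + e) * (N ! * C1 ^ (N + 1) * (1 + δ) ^ (L + e) * (3 * C1) ^ M / (M - (L + e))! *
          Real.exp (3 * C1))
        ≤ (q0 : ℝ) ^ (L + e) * (N ! * (C1 ^ (2 * n + 2)) ^ (L + e) * (1 + δ) ^ (L + e) *
          ((3 * C1) ^ (n * (2 * n + 2))) ^ (L + e) / (M - (L + e))! * Real.exp (3 * C1)) := by
          gcongr
      _ = _ := by
          rw [hA3]; push_cast; simp only [mul_pow]; ring
  have hbig := hL0 L hL0L N
  have hMk : (n - 1) * N + (2 * n * L - c') = M - kk := by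
    obtain ⟨m, hm⟩ : ∃ m, n = m + 1 := ⟨n - 1, by omega⟩
    have e1 : (n - 1) * N + N = n * N := by rw [hm]; simp; ring
    have e2 : 2 * n * L = n * L + n * L := by ring
    omega
  rw [hMk] at hbig
  have hexp : (n - q) * Module.finrank ℚ K ≤ n - 1 := by rw [mul_comm]; omega
  have hfac : (0 : ℝ) < (M - kk)! := by positivity
  have hN0 : (0 : ℝ) < N ! := by positivity
  have hx1 : (1 : ℝ) ≤ x := by exact_mod_cast (Nat.factorial_pos N).trans_le hNx
  have hxle' : (x : ℝ) ≤ N ! * (A2 ^ (L + e) * L ^ (L + e)) := by exact_mod_cast hxle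
  have hfinal : ‖v j0‖ * N ! ≤ G0 * (N ! * (A2 ^ (L + e) * L ^ (L + e))) ^ (n - 1) *
      (N ! * A3 ^ (L + e) * Real.exp (3 * C1) / (M - kk)!) := by
    calc ‖v j0‖ * N ! ≤ ‖v j0‖ * x := by gcongr
      _ ≤ G0 * x ^ ((n - q) * Module.finrank ℚ K) * y := hmain
      _ ≤ G0 * x ^ (n - 1) * y := by gcongr
      _ ≤ _ := by gcongr
  rw [← mul_div_assoc, le_div_iff₀ hfac] at hfinal
  rw [div_mul_eq_mul_div, div_mul_eq_mul_div, div_lt_iff₀ hvpos] at hbig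
  have : ‖v j0‖ * N ! * (M - kk)! < ‖v j0‖ * N ! * (M - kk)! := by
    refine hfinal.trans_lt ?_
    calc _ = (G0 * Real.exp (3 * C1) * A ^ e * A ^ L *
          ((N ! : ℝ) ^ (n - 1) * (L : ℝ) ^ ((L + e) * (n - 1)))) * N ! := by
          rw [hA, pow_mul]
          simp only [mul_pow, ← pow_mul, pow_add]
          ring
      _ < ((M - kk)! * ‖v j0‖) * N ! := by gcongr
      _ = _ := by ring
  exact lt_irrefl _ this

end RankBound

section EClosure
open PowerSeries
variable {K : Type*} [Field K] [NumberField K]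

/-- Power series satisfying the arithmetic growth conditions of an E-function. -/
def IsEB (f : K⟦X⟧) : Prop := ∃ C : ℕ, EBound (fun _ : Unit => f) C

theorem isEB_iff {f : K⟦X⟧} : IsEB f ↔ ∃ C : ℕ, 1 ≤ C ∧
    (∀ μ, house ((μ ! : K) * coeff μ f) ≤ (C : ℝ) ^ (μ + 1)) ∧
    ∀ ν : ℕ, ∃ d : ℕ, 0 < d ∧ d ≤ C ^ (ν + 1) ∧
      ∀ μ ≤ ν, IsIntegral ℤ ((d : K) * ((μ ! : K) * coeff μ f)) := by
  constructor
  · rintro ⟨C, h1, h2, h3⟩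
    exact ⟨C, h1, fun μ => h2 () μ, fun ν => by
      obtain ⟨d, hd, hd', h⟩ := h3 ν
      exact ⟨d, hd, hd', h ()⟩⟩
  · rintro ⟨C, h1, h2, h3⟩
    exact ⟨C, h1, fun _ μ => h2 μ, fun ν => by
      obtain ⟨d, hd, hd', h⟩ := h3 ν
      exact ⟨d, hd, hd', fun _ => h⟩⟩

theorem isIntegral_natCast (d : ℕ) : IsIntegral ℤ (d : K) := by
  have := isIntegral_algebraMap (R := ℤ) (A := K) (x := (d : ℤ))
  simpa using this

theorem exists_nat_mul_isIntegral (a : K) : ∃ d : ℕ, 0 < d ∧ IsIntegral ℤ ((d : K) * a) := by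
  have ha : IsAlgebraic ℤ a := (IsFractionRing.isAlgebraic_iff ℤ ℚ K).2 (Algebra.IsAlgebraic.isAlgebraic a)
  obtain ⟨y, hy, h⟩ := ha.exists_integral_multiple
  refine ⟨y.natAbs, Int.natAbs_pos.2 hy, ?_⟩
  rw [zsmul_eq_mul] at h
  have hc : ((y.natAbs : ℤ) : K) = (y.natAbs : K) := Int.cast_natCast _
  rcases Int.natAbs_eq y with h' | h'
  · rw [h'] at h; rw [← hc]; exact h
  · rw [h'] at h; rw [← hc]
    have := h.neg
    simpa using this

theorem EBound.pi {n : ℕ} {b : Fin n → K⟦X⟧} (h : ∀ i, IsEB (b i)) : ∃ C, EBound b C := by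
  have h' := fun i => isEB_iff.1 (h i)
  choose C h1 h2 h3 using h'
  have hle : ∀ i, C i ≤ ∏ i, C i := fun i =>
    Finset.single_le_prod' (f := C) (fun j _ => h1 j) (Finset.mem_univ i)
  refine ⟨∏ i, C i, Finset.one_le_prod' fun i _ => h1 i, fun i μ => ?_, fun ν => ?_⟩
  · refine (h2 i μ).trans ?_
    gcongr
    exact_mod_cast hle i
  · choose d hd hd' hInt using fun i => h3 i ν
    refine ⟨∏ i, d i, Finset.prod_pos fun i _ => hd i, ?_, fun i μ hμ => ?_⟩
    · rw [← Finset.prod_pow]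
      exact Finset.prod_le_prod' fun i _ => hd' i
    · rw [← Finset.mul_prod_erase _ _ (Finset.mem_univ i)]
      have := (isIntegral_natCast (K := K) (∏ x ∈ Finset.univ.erase i, d x)).mul (hInt i μ hμ)
      have e : ((d i * ∏ x ∈ Finset.univ.erase i, d x : ℕ) : K) * ((μ ! : K) * coeff μ (b i)) =
          ((∏ x ∈ Finset.univ.erase i, d x : ℕ) : K) * (d i * ((μ ! : K) * coeff μ (b i))) := by
        rw [Nat.cast_mul]; ring
      rw [e]
      exact this

theorem IsEB.add {f g : K⟦X⟧} (hf : IsEB f) (hg : IsEB g) : IsEB (f + g) := by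
  obtain ⟨C, c1, c2, c3⟩ := isEB_iff.1 hf
  obtain ⟨D, d1, d2, d3⟩ := isEB_iff.1 hg
  refine isEB_iff.2 ⟨C + D + C * D, by omega, fun μ => ?_, fun ν => ?_⟩
  · rw [map_add, mul_add]
    refine (house_add_le _ _).trans ((add_le_add (c2 μ) (d2 μ)).trans ?_)
    have : (C : ℝ) ^ (μ + 1) + (D : ℝ) ^ (μ + 1) ≤ ((C : ℝ) + D) ^ (μ + 1) :=
      pow_add_pow_le (by positivity) (by positivity) (by omega)
    refine this.trans ?_
    push_cast
    have : (0 : ℝ) ≤ C * D := by positivity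
    exact pow_le_pow_left₀ (by positivity) (by linarith) _
  · obtain ⟨d, hd, hd', h⟩ := c3 ν
    obtain ⟨d', he, he', h'⟩ := d3 ν
    refine ⟨d * d', Nat.mul_pos hd he, ?_, fun μ hμ => ?_⟩
    · calc d * d' ≤ C ^ (ν + 1) * D ^ (ν + 1) := Nat.mul_le_mul hd' he'
        _ = (C * D) ^ (ν + 1) := by rw [mul_pow]
        _ ≤ _ := by gcongr; omega
    · have := ((isIntegral_natCast (K := K) d').mul (h μ hμ)).add
        ((isIntegral_natCast (K := K) d).mul (h' μ hμ))
      have e : ((d * d' : ℕ) : K) * ((μ ! : K) * coeff μ (f + g)) =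
          d' * (d * ((μ ! : K) * coeff μ f)) + d * (d' * ((μ ! : K) * coeff μ g)) := by
        rw [map_add, Nat.cast_mul]; ring
      rw [e]
      exact this

theorem factorial_mul_coeff_mul (f g : K⟦X⟧) (μ : ℕ) :
    (μ ! : K) * coeff μ (f * g) = ∑ p ∈ Finset.HasAntidiagonal.antidiagonal μ,
      ((μ.choose p.1 : ℕ) : K) * ((p.1 ! * coeff p.1 f) * (p.2 ! * coeff p.2 g)) := by
  rw [coeff_mul, Finset.mul_sum]
  refine Finset.sum_congr rfl fun p hp => ?_
  have hp' := Finset.HasAntidiagonal.mem_antidiagonal.1 hp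
  have := Nat.choose_mul_factorial_mul_factorial (n := μ) (k := p.1) (by omega)
  rw [show μ - p.1 = p.2 by omega] at this
  rw [← this]
  push_cast
  ring

theorem IsEB.mul {f g : K⟦X⟧} (hf : IsEB f) (hg : IsEB g) : IsEB (f * g) := by
  obtain ⟨C, c1, c2, c3⟩ := isEB_iff.1 hf
  obtain ⟨D, d1, d2, d3⟩ := isEB_iff.1 hg
  refine isEB_iff.2 ⟨C + D + C * D, by omega, fun μ => ?_, fun ν => ?_⟩
  · rw [factorial_mul_coeff_mul]
    refine (house_sum_le_sum_house _ _).trans ?_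
    have : ∀ p ∈ Finset.HasAntidiagonal.antidiagonal μ,
        house (((μ.choose p.1 : ℕ) : K) * ((p.1 ! * coeff p.1 f) * (p.2 ! * coeff p.2 g))) ≤
        C * D * ((μ.choose p.1 : ℕ) * (C ^ p.1 * D ^ p.2)) := by
      intro p _
      rw [house_nat_mul]
      calc (μ.choose p.1 : ℝ) * house ((p.1 ! * coeff p.1 f) * (p.2 ! * coeff p.2 g))
          ≤ (μ.choose p.1 : ℝ) * (C ^ (p.1 + 1) * D ^ (p.2 + 1)) := by
            gcongr
            refine (house_mul_le _ _).trans ?_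
            gcongr
            · exact house_nonneg _
            · exact c2 _
            · exact d2 _
        _ = _ := by ring
    refine (Finset.sum_le_sum this).trans ?_
    rw [← Finset.mul_sum]
    have hb := (Commute.all (C : ℝ) D).add_pow' μ
    simp only [nsmul_eq_mul] at hb
    rw [← hb, pow_succ, mul_comm]
    push_cast
    have : (0 : ℝ) ≤ C * D := by positivity
    exact mul_le_mul (pow_le_pow_left₀ (by positivity) (by linarith) _)
      (by linarith [(Nat.cast_nonneg C : (0 : ℝ) ≤ C), (Nat.cast_nonneg D : (0 : ℝ) ≤ D)])
      this (by positivity)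
  · obtain ⟨d, hd, hd', h⟩ := c3 ν
    obtain ⟨d', he, he', h'⟩ := d3 ν
    refine ⟨d * d', Nat.mul_pos hd he, ?_, fun μ hμ => ?_⟩
    · calc d * d' ≤ C ^ (ν + 1) * D ^ (ν + 1) := Nat.mul_le_mul hd' he'
        _ = (C * D) ^ (ν + 1) := by rw [mul_pow]
        _ ≤ _ := by gcongr; omega
    · rw [factorial_mul_coeff_mul, Finset.mul_sum]
      refine IsIntegral.sum _ fun p hp => ?_
      have hp' := Finset.HasAntidiagonal.mem_antidiagonal.1 hp
      have := (isIntegral_natCast (K := K) (μ.choose p.1)).mul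
        ((h p.1 (by omega)).mul (h' p.2 (by omega)))
      have e : ((d * d' : ℕ) : K) * (((μ.choose p.1 : ℕ) : K) *
          ((p.1 ! * coeff p.1 f) * (p.2 ! * coeff p.2 g))) = ((μ.choose p.1 : ℕ) : K) *
          (d * (p.1 ! * coeff p.1 f) * (d' * (p.2 ! * coeff p.2 g))) := by
        rw [Nat.cast_mul]; ring
      rw [e]
      exact this

theorem isEB_C (a : K) : IsEB (PowerSeries.C a) := by
  obtain ⟨d, hd, hInt⟩ := exists_nat_mul_isIntegral a
  obtain ⟨m, hm⟩ := exists_nat_ge (house a)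
  refine isEB_iff.2 ⟨d + m, by omega, fun μ => ?_, fun ν => ⟨d, hd, ?_, fun μ _ => ?_⟩⟩
  · rw [coeff_C]
    split_ifs with h
    · subst h
      simp only [Nat.factorial_zero, Nat.cast_one, one_mul, zero_add, pow_one]
      push_cast
      linarith [(Nat.cast_nonneg d : (0 : ℝ) ≤ d)]
    · simp only [mul_zero]
      rw [show house (0 : K) = 0 by simp [house]]
      positivity
  · calc d ≤ d + m := by omega
      _ ≤ _ := Nat.le_self_pow (by omega) _
  · rw [coeff_C]
    split_ifs with h
    · subst h
      simpa using hInt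
    · simp [isIntegral_zero]

theorem isEB_X : IsEB (X : K⟦X⟧) := by
  refine isEB_iff.2 ⟨1, le_rfl, fun μ => ?_, fun ν => ⟨1, one_pos, by simp, fun μ _ => ?_⟩⟩
  · rw [coeff_X]
    split_ifs with h
    · subst h
      have : house (1 : K) = 1 := by simpa using house_intCast (K := K) 1
      simp [this]
    · simp only [mul_zero]
      rw [show house (0 : K) = 0 by simp [house]]
      positivity
  · rw [coeff_X]
    split_ifs with h
    · subst h
      simp [isIntegral_one]
    · simp [isIntegral_zero]

theorem IsEB.derivative {f : K⟦X⟧} (hf : IsEB f) : IsEB (d⁄dX K f) := by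
  obtain ⟨C, c1, c2, c3⟩ := isEB_iff.1 hf
  have key : ∀ μ : ℕ, (μ ! : K) * coeff μ (d⁄dX K f) = ((μ + 1)! : ℕ) * coeff (μ + 1) f := by
    intro μ
    rw [coeff_derivative, Nat.factorial_succ]
    push_cast
    ring
  have hC : ∀ ν : ℕ, C ^ (ν + 1 + 1) ≤ (C ^ 2) ^ (ν + 1) := fun ν => by
    rw [← pow_mul]
    exact Nat.pow_le_pow_right c1 (by omega)
  refine isEB_iff.2 ⟨C ^ 2, Nat.one_le_pow _ _ c1, fun μ => ?_, fun ν => ?_⟩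
  · rw [key]
    refine (c2 _).trans ?_
    exact_mod_cast hC μ
  · obtain ⟨d, hd, hd', h⟩ := c3 (ν + 1)
    exact ⟨d, hd, hd'.trans (hC ν), fun μ hμ => by rw [key]; exact h _ (by omega)⟩

theorem IsEB.rescale {f : K⟦X⟧} (hf : IsEB f) (a : K) : IsEB (PowerSeries.rescale a f) := by
  obtain ⟨C, c1, c2, c3⟩ := isEB_iff.1 hf
  obtain ⟨d, hd, hInt⟩ := exists_nat_mul_isIntegral a
  obtain ⟨m, hm⟩ := exists_nat_ge (house a)
  refine isEB_iff.2 ⟨C * (d + m), Nat.mul_pos c1 (by omega), fun μ => ?_, fun ν => ?_⟩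
  · rw [coeff_rescale, mul_left_comm]
    refine (house_mul_le _ _).trans ?_
    have h1 : house (a ^ μ) ≤ (d + m : ℝ) ^ (μ + 1) := by
      have hd1 : (1 : ℝ) ≤ d := by exact_mod_cast hd
      calc house (a ^ μ) ≤ house a ^ μ := house_pow_le _ _
        _ ≤ (d + m : ℝ) ^ μ := by
          have := house_nonneg a
          gcongr
          linarith
        _ ≤ _ := pow_le_pow_right₀ (by linarith [(Nat.cast_nonneg m : (0 : ℝ) ≤ m)]) (by omega)
    push_cast
    rw [mul_pow, mul_comm]
    gcongr
    · exact house_nonneg _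
    · exact c2 μ
  · obtain ⟨e, he, he', h⟩ := c3 ν
    refine ⟨e * d ^ (ν + 1), by positivity, ?_, fun μ hμ => ?_⟩
    · rw [mul_pow]
      gcongr
      omega
    · have h1 := (((isIntegral_natCast (K := K) d).pow (ν + 1 - μ)).mul (hInt.pow μ)).mul (h μ hμ)
      have e : ((e * d ^ (ν + 1) : ℕ) : K) * ((μ ! : K) * coeff μ (PowerSeries.rescale a f)) =
          (d : K) ^ (ν + 1 - μ) * (d * a) ^ μ * (e * ((μ ! : K) * coeff μ f)) := by
        have : (d : K) ^ (ν + 1) = (d : K) ^ (ν + 1 - μ) * (d : K) ^ μ := by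
          rw [← pow_add]; congr 1; omega
        rw [coeff_rescale, Nat.cast_mul, Nat.cast_pow, this]
        ring
      rw [e]
      exact h1

/-- The ring of power series with the arithmetic growth of E-functions. -/
def ebSub (K : Type*) [Field K] [NumberField K] : Subalgebra K K⟦X⟧ where
  carrier := {f | IsEB f}
  mul_mem' := IsEB.mul
  add_mem' := IsEB.add
  algebraMap_mem' a := isEB_C a

theorem isEB_coe (p : K[X]) : IsEB (p : K⟦X⟧) := by
  induction p using Polynomial.induction_on' with
  | add p q hp hq => rw [Polynomial.coe_add]; exact hp.add hq
  | monomial n a =>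
    rw [← Polynomial.C_mul_X_pow_eq_monomial, Polynomial.coe_mul, Polynomial.coe_C,
      Polynomial.coe_pow, Polynomial.coe_X]
    exact (isEB_C a).mul ((ebSub K).pow_mem (x := (X : K⟦X⟧)) isEB_X n)

end EClosure

section RankBound
open PowerSeries
variable {K : Type*} [Field K] [NumberField K]

theorem IsEB.isEntire {f : K⟦X⟧} (h : IsEB f) (ι : K →+* ℂ) : IsEntire (f.map ι) :=
  h.choose_spec.isEntire ι ()

theorem exists_common_nat_mul_isIntegral {J : Type*} (s : Finset J) (a : J → K) :
    ∃ d : ℕ, 0 < d ∧ ∀ i ∈ s, IsIntegral ℤ ((d : K) * a i) := by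
  classical
  choose d hd h using fun i => exists_nat_mul_isIntegral (a i)
  refine ⟨∏ i ∈ s, d i, Finset.prod_pos fun i _ => hd i, fun i hi => ?_⟩
  have e : ((∏ i ∈ s, d i : ℕ) : K) * a i =
      ((∏ x ∈ s.erase i, d x : ℕ) : K) * (d i * a i) := by
    rw [← Finset.mul_prod_erase _ _ hi, Nat.cast_mul]; ring
  rw [e]
  exact (isIntegral_natCast _).mul (h i)

theorem exists_nat_mul_intCoeff {J : Type*} [Fintype J] (p : J → K[X]) :
    ∃ d : ℕ, 0 < d ∧ ∀ i, IntCoeff (Polynomial.C (d : K) * p i) := by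
  obtain ⟨d, hd, h⟩ := exists_common_nat_mul_isIntegral
    (Finset.univ.sigma fun i : J => (p i).support) (fun x => (p x.1).coeff x.2)
  refine ⟨d, hd, fun i m => ?_⟩
  rw [Polynomial.coeff_C_mul]
  by_cases hm : m ∈ (p i).support
  · exact h ⟨i, m⟩ (by simp at hm ⊢; exact hm)
  · rw [Polynomial.notMem_support_iff.1 hm, mul_zero]
    exact isIntegral_zero

variable [Algebra K ℂ]

variable (K) in
/-- Evaluation at `1` of power series with the growth of E-functions. -/
def evEB : ebSub K →ₐ[K] ℂ where
  toFun f := evalEntire 1 ⟨f.1.map (algebraMap K ℂ), IsEB.isEntire f.2 _⟩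
  map_one' := (congrArg (evalEntire 1)
    (Subtype.ext (map_one (PowerSeries.map (algebraMap K ℂ))))).trans (map_one (evalEntire 1))
  map_mul' f g := by
    rw [← map_mul (evalEntire 1)]; congr 1; exact Subtype.ext (map_mul _ _ _)
  map_zero' := by
    rw [← map_zero (evalEntire 1)]; congr 1; exact Subtype.ext (map_zero (PowerSeries.map (algebraMap K ℂ)))
  map_add' f g := by
    rw [← map_add (evalEntire 1)]; congr 1; exact Subtype.ext (map_add _ _ _)
  commutes' c := by
    have := (evalEntire 1).commutes (algebraMap K ℂ c)
    rw [Algebra.algebraMap_self, RingHom.id_apply] at this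
    rw [← this]
    congr 1
    exact Subtype.ext (PowerSeries.map_C _ _)

theorem evEB_apply {f : K⟦X⟧} (hf : IsEB f) :
    evEB K ⟨f, hf⟩ = evalEntire 1 ⟨f.map (algebraMap K ℂ), IsEB.isEntire hf _⟩ := rfl

theorem rank_bound (M : Submodule K[X] K⟦X⟧) (hM : M.FG) (hE : ∀ f ∈ M, IsEB f) (Q : K[X])
    (hQ : Q.eval 1 ≠ 0) (hst : ∀ f ∈ M, (Q : K⟦X⟧) * d⁄dX K f ∈ M) (h1 : (1 : K⟦X⟧) ∈ M)
    (V : Submodule K ℂ) [FiniteDimensional K V]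
    (hV : ∀ f (hf : f ∈ M), evEB K ⟨f, hE f hf⟩ ∈ V) :
    Module.finrank K[X] M ≤ Module.finrank ℚ K * Module.finrank K V := by
  classical
  have := torsionFree_ps (k := K)
  have : Module.Finite K[X] M := Module.Finite.iff_fg.2 hM
  have : Module.Free K[X] M := Module.free_of_finite_type_torsion_free'
  set n := Module.finrank K[X] M with hn
  let e : Module.Basis (Fin n) K[X] M := Module.finBasis K[X] M
  let b : Fin n → K⟦X⟧ := fun i => (e i : K⟦X⟧)
  have hsum : ∀ f : M, (f : K⟦X⟧) = ∑ j, (e.repr f j : K⟦X⟧) * b j := by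
    intro f
    conv_lhs => rw [← e.sum_repr f]
    rw [Submodule.coe_sum]
    exact Finset.sum_congr rfl fun j _ => by rw [Submodule.coe_smul, smul_ps]
  have hb : ∀ P, frm P b = 0 → P = 0 := by
    intro P hP
    have := Fintype.linearIndependent_iff.1 e.linearIndependent P (by
      apply Subtype.ext
      rw [Submodule.coe_sum]
      rw [Submodule.coe_zero, ← hP]
      exact Finset.sum_congr rfl fun j _ => by rw [Submodule.coe_smul, smul_ps])
    exact funext this
  have hbE : ∀ i, IsEB (b i) := fun i => hE _ (e i).2
  let B : Matrix (Fin n) (Fin n) K[X] := fun i j => e.repr ⟨_, hst _ (e i).2⟩ j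
  have hsol : IsSol Q B b := fun i => hsum ⟨_, hst _ (e i).2⟩
  obtain ⟨d, hd, hInt⟩ := exists_nat_mul_intCoeff (fun x : Option (Fin n × Fin n) =>
    x.elim Q fun y => B y.1 y.2)
  have hdK : (d : K) ≠ 0 := by exact_mod_cast hd.ne'
  obtain ⟨C, hC⟩ := EBound.pi hbE
  let v : Fin n → ℂ := fun j => evEB K ⟨b j, hbE j⟩
  let L : (Fin n → K) →ₗ[K] ℂ := Fintype.linearCombination K v
  have hL : ∀ c, L c = ∑ j, algebraMap K ℂ (c j) * v j := fun c => by
    rw [Fintype.linearCombination_apply]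
    exact Finset.sum_congr rfl fun j _ => Algebra.smul_def _ _
  have hrange : LinearMap.range L ≤ V := by
    rintro _ ⟨c, rfl⟩
    rw [Fintype.linearCombination_apply]
    exact V.sum_mem fun j _ => V.smul_mem _ (hV _ (e j).2)
  have hrank := L.finrank_range_add_finrank_ker
  rw [Module.finrank_fin_fun] at hrank
  have hrV : Module.finrank K (LinearMap.range L) ≤ Module.finrank K V :=
    Submodule.finrank_mono hrange
  set q := Module.finrank K (LinearMap.ker L) with hq
  let c' := Module.finBasis K (LinearMap.ker L)
  obtain ⟨d', hd', hInt'⟩ := exists_common_nat_mul_isIntegral (Finset.univ : Finset (Fin q × Fin n))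
    (fun x => (c' x.1 : Fin n → K) x.2)
  have hd'K : (d' : K) ≠ 0 := by exact_mod_cast hd'.ne'
  have hc : LinearIndependent K fun i => (d' : K) • (c' i : Fin n → K) :=
    (c'.linearIndependent.map' (LinearMap.ker L).subtype (Submodule.ker_subtype _)).units_smul
      (fun _ => Units.mk0 (d' : K) hd'K)
  obtain ⟨j0, hj0⟩ : ∃ j0, v j0 ≠ 0 := by
    by_contra! h
    have h0 := hsum ⟨1, h1⟩
    have h2 : (1 : ebSub K) = ∑ j, (⟨_, isEB_coe (e.repr ⟨1, h1⟩ j)⟩ : ebSub K) * ⟨b j, hbE j⟩ := by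
      apply Subtype.ext
      rw [AddSubmonoidClass.coe_finsetSum]
      exact h0
    have h3 := congrArg (evEB K) h2
    rw [map_one, map_sum] at h3
    simp only [map_mul] at h3
    rw [Finset.sum_eq_zero fun j _ => by rw [show evEB K ⟨b j, hbE j⟩ = 0 from h j, mul_zero]] at h3
    exact one_ne_zero h3
  have main := rank_bound_of_integral (algebraMap K ℂ) (Polynomial.C (d : K) * Q)
    (fun i j => Polynomial.C (d : K) * B i j) (hInt none) (fun i j => hInt (some (i, j)))
    (by rw [Polynomial.eval_mul, Polynomial.eval_C]; exact mul_ne_zero hdK hQ) b hb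
    (fun i => by
      rw [Polynomial.coe_mul, mul_assoc, hsol i, Finset.mul_sum]
      exact Finset.sum_congr rfl fun j _ => by rw [Polynomial.coe_mul, mul_assoc])
    C hC (fun i => (d' : K) • (c' i : Fin n → K)) hc
    (fun i j => hInt' (i, j) (Finset.mem_univ _))
    (fun i => by
      have h : L ((d' : K) • (c' i : Fin n → K)) = 0 := by
        rw [map_smul, show L (c' i : Fin n → K) = 0 from (c' i).2, smul_zero]
      rw [hL] at h
      exact h) j0 hj0
  calc n ≤ Module.finrank ℚ K * (n - q) := main
    _ ≤ _ := Nat.mul_le_mul_left _ (by omega)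

end RankBound

section Hilbert

theorem le_of_pow_growth {τ t A B : ℕ} (h : ∀ u : ℕ, (u + 1) ^ τ ≤ A * (B * (u + 1)) ^ t) :
    τ ≤ t := by
  by_contra! hlt
  have h1 : ∀ u : ℕ, u + 1 ≤ A * B ^ t := fun u => by
    have h2 : (u + 1) ^ (t + 1) ≤ A * (B * (u + 1)) ^ t :=
      (Nat.pow_le_pow_right (by omega) hlt).trans (h u)
    rw [mul_pow, ← mul_assoc, pow_succ, mul_comm ((u + 1) ^ t)] at h2
    exact Nat.le_of_mul_le_mul_right h2 (by positivity)
  have := h1 (A * B ^ t)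
  omega

variable {K S : Type*} [Field K] [CommRing S] [Algebra K S]

theorem finrank_pow_le {t : ℕ} (g : MvPolynomial (Fin t) K →ₐ[K] S) (hg : g.Finite)
    (V : Submodule K S) (hV : V.FG) :
    ∃ A B : ℕ, ∀ e : ℕ, FiniteDimensional K ↥(V ^ e) ∧
      Module.finrank K ↥(V ^ e) ≤ A * (B * (e + 1)) ^ t := by
  classical
  let _ := g.toRingHom.toAlgebra
  have hfin : Module.Finite (MvPolynomial (Fin t) K) S := hg
  have hsm : ∀ (p : MvPolynomial (Fin t) K) (x : S), p • x = g p * x := fun p x => rfl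
  obtain ⟨M, w, hw⟩ := Module.Finite.exists_fin (R := MvPolynomial (Fin t) K) (M := S)
  have hrep : ∀ x : S, ∃ p : Fin M → MvPolynomial (Fin t) K, x = ∑ m, g (p m) * w m := fun x => by
    have hx : x ∈ Submodule.span (MvPolynomial (Fin t) K) (Set.range w) := hw ▸ Submodule.mem_top
    obtain ⟨p, hp⟩ := (Submodule.mem_span_range_iff_exists_fun _).1 hx
    exact ⟨p, hp.symm⟩
  choose p hp using hrep
  obtain ⟨G, hG⟩ := hV
  let T : Finset S := insert 1 ((G ×ˢ Finset.univ).image fun x : S × Fin M => x.1 * w x.2)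
  obtain ⟨δ, hδ⟩ : ∃ δ : ℕ, ∀ x ∈ T, ∀ m, ∀ ν ∈ (p x m).support, ∀ i, ν i ≤ δ := by
    refine ⟨T.sup fun x => Finset.univ.sup fun m => (p x m).support.sup fun ν =>
      Finset.univ.sup fun i => ν i, fun x hx m ν hν i => ?_⟩
    refine le_trans ?_ (Finset.le_sup (f := fun x => Finset.univ.sup fun m =>
      (p x m).support.sup fun ν => Finset.univ.sup fun i => ν i) hx)
    refine le_trans ?_ (Finset.le_sup (f := fun m =>
      (p x m).support.sup fun ν => Finset.univ.sup fun i => ν i) (Finset.mem_univ m))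
    refine le_trans ?_ (Finset.le_sup (f := fun ν : Fin t →₀ ℕ => Finset.univ.sup fun i => ν i) hν)
    exact Finset.le_sup (f := fun i => ν i) (Finset.mem_univ i)
  let gen : (Fin t →₀ ℕ) → Fin M → S := fun μ m => g (MvPolynomial.monomial μ 1) * w m
  let W : ℕ → Submodule K S := fun n =>
    Submodule.span K {x | ∃ μ m, (∀ i, μ i ≤ n) ∧ x = gen μ m}
  have hmul : ∀ x ∈ T, ∀ n (μ : Fin t →₀ ℕ), (∀ i, μ i ≤ n) →
      g (MvPolynomial.monomial μ 1) * x ∈ W (n + δ) := by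
    intro x hx n μ hμ
    rw [hp x, Finset.mul_sum]
    refine Submodule.sum_mem _ fun m _ => ?_
    rw [(p x m).as_sum, map_sum, Finset.sum_mul, Finset.mul_sum]
    refine Submodule.sum_mem _ fun ν hν => ?_
    have : g (MvPolynomial.monomial μ 1) *
        (g (MvPolynomial.monomial ν (MvPolynomial.coeff ν (p x m))) * w m) =
        MvPolynomial.coeff ν (p x m) • gen (μ + ν) m := by
      change _ = _ • (g _ * w m)
      rw [← mul_assoc, ← map_mul, MvPolynomial.monomial_mul, one_mul, ← smul_mul_assoc, ← map_smul,
        MvPolynomial.smul_monomial, smul_eq_mul, mul_one]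
    rw [this]
    exact Submodule.smul_mem _ _ (Submodule.subset_span
      ⟨_, _, fun i => add_le_add (hμ i) (hδ x hx m ν hν i), rfl⟩)
  have hW0 : (1 : S) ∈ W δ := by
    have := hmul 1 (Finset.mem_insert_self _ _) 0 0 (fun i => le_rfl)
    rwa [zero_add, mul_one, show MvPolynomial.monomial (0 : Fin t →₀ ℕ) (1 : K) = 1 from rfl,
      map_one] at this
  have hVW : ∀ n, V * W n ≤ W (n + δ) := by
    intro n
    rw [← hG, Submodule.span_mul_span, Submodule.span_le]
    rintro _ ⟨v, hv, _, ⟨μ, m, hμ, rfl⟩, rfl⟩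
    have := hmul (v * w m) (Finset.mem_insert_of_mem
      (Finset.mem_image.2 ⟨(v, m), by simpa using hv, rfl⟩)) n μ hμ
    have e : v * gen μ m = g (MvPolynomial.monomial μ 1) * (v * w m) := by
      change v * (g _ * w m) = _
      ring
    exact (congrArg (· ∈ W (n + δ)) e).mpr this
  have hpow : ∀ e, V ^ e ≤ W (δ * (e + 1)) := by
    intro e
    induction e with
    | zero =>
      rw [pow_zero, Submodule.one_le]
      simpa using hW0
    | succ e ih =>
      rw [pow_succ']
      exact (mul_le_mul_right ih V).trans ((hVW _).trans (le_of_eq (by ring_nf)))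
  have hWfin : ∀ n, ∃ s : Finset S, (Submodule.span K (s : Set S)) = W n ∧
      s.card ≤ (n + 1) ^ t * M := by
    intro n
    refine ⟨(Finset.univ : Finset ((Fin t → Fin (n + 1)) × Fin M)).image
      fun x => gen (Finsupp.equivFunOnFinite.symm fun i => (x.1 i : ℕ)) x.2, ?_, ?_⟩
    · congr 1
      ext x
      simp only [Finset.coe_image, Finset.coe_univ, Set.image_univ, Set.mem_range, Set.mem_ofPred_eq]
      constructor
      · rintro ⟨y, rfl⟩
        exact ⟨_, _, fun i => Nat.lt_succ_iff.1 (y.1 i).2, rfl⟩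
      · rintro ⟨μ, m, hμ, rfl⟩
        refine ⟨(fun i => ⟨μ i, Nat.lt_succ_iff.2 (hμ i)⟩, m), ?_⟩
        congr 1
        ext i
        rfl
    · refine Finset.card_image_le.trans ?_
      simp
  refine ⟨M, δ + 1, fun e => ?_⟩
  obtain ⟨s, hs, hcard⟩ := hWfin (δ * (e + 1))
  have hfd : FiniteDimensional K ↥(W (δ * (e + 1))) := by
    rw [← hs]; exact FiniteDimensional.span_finset K s
  refine ⟨Submodule.finiteDimensional_of_le (hpow e), ?_⟩
  calc Module.finrank K ↥(V ^ e) ≤ Module.finrank K ↥(W (δ * (e + 1))) :=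
        Submodule.finrank_mono (hpow e)
    _ ≤ s.card := by rw [← hs]; exact finrank_span_finset_le_card s
    _ ≤ (δ * (e + 1) + 1) ^ t * M := hcard
    _ ≤ M * ((δ + 1) * (e + 1)) ^ t := by
      rw [mul_comm]
      gcongr
      nlinarith

end Hilbert

section Values
open PowerSeries

section Span
variable {k : Type*} [Field k] [CharZero k]

/-- The `k[X]`-module generated by `1` and the series `F a`. -/
def oneSpan {A : Type*} (F : A → k⟦X⟧) : Submodule k[X] k⟦X⟧ :=
  Submodule.span k[X] (insert 1 (Set.range F))

theorem one_mem_oneSpan {A : Type*} (F : A → k⟦X⟧) : (1 : k⟦X⟧) ∈ oneSpan F :=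
  Submodule.subset_span (Set.mem_insert _ _)

theorem mem_oneSpan {A : Type*} (F : A → k⟦X⟧) (a : A) : F a ∈ oneSpan F :=
  Submodule.subset_span (Set.mem_insert_of_mem _ ⟨a, rfl⟩)

theorem fg_oneSpan {A : Type*} [Finite A] (F : A → k⟦X⟧) : (oneSpan F).FG :=
  Submodule.fg_span ((Set.finite_range F).insert 1)

theorem algebraMap_ps (r : k[X]) : algebraMap k[X] k⟦X⟧ r = (r : k⟦X⟧) := by
  rw [Algebra.algebraMap_eq_smul_one, smul_ps, mul_one]

theorem one_mem_pow {N : Submodule k[X] k⟦X⟧} (h : (1 : k⟦X⟧) ∈ N) (e : ℕ) : (1 : k⟦X⟧) ∈ N ^ e := by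
  simpa using Submodule.pow_mem_pow N h e

theorem derivative_mem_oneSpan {A : Type*} {F : A → k⟦X⟧} {Q : k[X]}
    (hst : ∀ a, (Q : k⟦X⟧) * d⁄dX k (F a) ∈ oneSpan F) {f : k⟦X⟧} (hf : f ∈ oneSpan F) :
    (Q : k⟦X⟧) * d⁄dX k f ∈ oneSpan F := by
  induction hf using Submodule.span_induction with
  | mem x hx =>
    rcases hx with rfl | ⟨a, rfl⟩
    · rw [← map_one (algebraMap k k⟦X⟧), Derivation.map_algebraMap, mul_zero]
      exact Submodule.zero_mem _
    · exact hst a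
  | zero => rw [map_zero, mul_zero]; exact Submodule.zero_mem _
  | add x y _ _ hx hy => rw [map_add, mul_add]; exact Submodule.add_mem _ hx hy
  | smul r x hx' hx =>
    have : (Q : k⟦X⟧) * d⁄dX k (r • x) =
        (Q * Polynomial.derivative r) • x + r • ((Q : k⟦X⟧) * d⁄dX k x) := by
      rw [smul_ps, smul_ps, smul_ps, Derivation.leibniz, smul_eq_mul, smul_eq_mul,
        derivative_coe, Polynomial.coe_mul]
      ring
    rw [this]
    exact Submodule.add_mem _ (Submodule.smul_mem _ _ hx') (Submodule.smul_mem _ _ hx)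

theorem derivative_mem_pow {N : Submodule k[X] k⟦X⟧} {Q : k[X]}
    (hst : ∀ f ∈ N, (Q : k⟦X⟧) * d⁄dX k f ∈ N) {e : ℕ} {f : k⟦X⟧} (hf : f ∈ N ^ e) :
    (Q : k⟦X⟧) * d⁄dX k f ∈ N ^ e := by
  induction hf using Submodule.pow_induction_on_left' with
  | algebraMap r =>
    rw [algebraMap_ps, derivative_coe, ← Polynomial.coe_mul, ← algebraMap_ps]
    exact Submodule.algebraMap_mem _
  | add x y i hx hy h1 h2 => rw [map_add, mul_add]; exact Submodule.add_mem _ h1 h2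
  | mem_mul m hm i x hx h =>
    have : (Q : k⟦X⟧) * d⁄dX k (m * x) =
        ((Q : k⟦X⟧) * d⁄dX k m) * x + m * ((Q : k⟦X⟧) * d⁄dX k x) := by
      rw [Derivation.leibniz, smul_eq_mul, smul_eq_mul]
      ring
    rw [this, Nat.succ_eq_add_one, pow_succ']
    exact Submodule.add_mem _ (Submodule.mul_mem_mul (hst m hm) hx) (Submodule.mul_mem_mul hm h)

theorem prod_pow_mem_pow {N : Submodule k[X] k⟦X⟧} (h1 : (1 : k⟦X⟧) ∈ N) {J : Type*}
    (s : Finset J) (f : J → k⟦X⟧) (hf : ∀ i, f i ∈ N) {u : ℕ} (μ : J → ℕ) (hμ : ∀ i, μ i ≤ u) :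
    ∏ i ∈ s, f i ^ μ i ∈ N ^ (u * s.card) := by
  classical
  have hmono : ∀ {a b : ℕ}, a ≤ b → N ^ a ≤ N ^ b := fun h =>
    pow_le_pow_right₀ (Submodule.one_le.2 h1) h
  induction s using Finset.induction_on with
  | empty => rw [Finset.prod_empty]; exact one_mem_pow h1 _
  | insert a s ha ih =>
    rw [Finset.prod_insert ha, Finset.card_insert_of_notMem ha, mul_add, mul_one, add_comm, pow_add]
    exact Submodule.mul_mem_mul (hmono (hμ a) (Submodule.pow_mem_pow N (hf a) _)) ih

theorem le_finrank_pow {τ : ℕ} {N : Submodule k[X] k⟦X⟧} (hN : N.FG) (h1 : (1 : k⟦X⟧) ∈ N)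
    (f : Fin τ → k⟦X⟧) (hf : ∀ i, f i ∈ N) (hind : AlgebraicIndependent k[X] f) (u : ℕ) :
    (u + 1) ^ τ ≤ Module.finrank k[X] ↥(N ^ (u * τ)) := by
  have : Module.Finite k[X] ↥(N ^ (u * τ)) := Module.Finite.iff_fg.2 (hN.pow _)
  have hmem : ∀ μ : Fin τ → Fin (u + 1), ∏ i, f i ^ (μ i : ℕ) ∈ N ^ (u * τ) := fun μ => by
    have := prod_pow_mem_pow h1 Finset.univ f hf (u := u) (fun i => (μ i : ℕ))
      (fun i => Nat.lt_succ_iff.1 (μ i).2)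
    simpa using this
  have hli : LinearIndependent k[X] fun μ : Fin τ → Fin (u + 1) => ∏ i, f i ^ (μ i : ℕ) := by
    have h2 := (MvPolynomial.basisMonomials (Fin τ) k[X]).linearIndependent.map'
      (MvPolynomial.aeval f).toLinearMap (LinearMap.ker_eq_bot.2 hind)
    have h3 := h2.comp (fun μ : Fin τ → Fin (u + 1) =>
      Finsupp.equivFunOnFinite.symm fun i => (μ i : ℕ)) (fun μ ν h => by
        have := Finsupp.equivFunOnFinite.symm.injective h
        funext i
        exact Fin.ext (congrFun this i))
    have e : (fun μ : Fin τ → Fin (u + 1) => ∏ i, f i ^ (μ i : ℕ)) =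
        ((MvPolynomial.aeval f).toLinearMap ∘ MvPolynomial.basisMonomials (Fin τ) k[X]) ∘
          (fun μ => Finsupp.equivFunOnFinite.symm fun i => (μ i : ℕ)) := by
      funext μ
      simp [MvPolynomial.aeval_monomial, Finsupp.prod_fintype]
    rw [e]
    exact h3
  have h4 : LinearIndependent k[X] fun μ : Fin τ → Fin (u + 1) =>
      (⟨_, hmem μ⟩ : ↥(N ^ (u * τ))) :=
    LinearIndependent.of_comp (N ^ (u * τ)).subtype hli
  simpa using h4.fintype_card_le_finrank

end Span

variable {K : Type*} [Field K] [NumberField K] [Algebra K ℂ]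

theorem trdeg_values {s τ : ℕ} (F : Fin s → K⟦X⟧) (hF : ∀ a, IsEB (F a)) (Q : K[X])
    (hQ : Q.eval 1 ≠ 0) (hst : ∀ a, (Q : K⟦X⟧) * d⁄dX K (F a) ∈ oneSpan F) (J : Fin τ → Fin s)
    (hJ : AlgebraicIndependent K[X] (F ∘ J)) :
    ∃ y : Fin τ → ℂ, AlgebraicIndependent K y ∧
      ∀ i, y i ∈ Algebra.adjoin K (Set.range fun a => evEB K ⟨F a, hF a⟩) := by
  set v : Fin s → ℂ := fun a => evEB K ⟨F a, hF a⟩ with hv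
  set N := oneSpan F with hN
  have hEN : ∀ f ∈ N, IsEB f := by
    intro f hf
    induction hf using Submodule.span_induction with
    | mem x hx =>
      rcases hx with rfl | ⟨a, rfl⟩
      · exact (ebSub K).one_mem
      · exact hF a
    | zero => exact (ebSub K).zero_mem
    | add x y _ _ hx hy => exact hx.add hy
    | smul r x _ hx => rw [smul_ps]; exact (isEB_coe r).mul hx
  have hE : ∀ e, ∀ f ∈ N ^ e, IsEB f := by
    intro e f hf
    induction hf using Submodule.pow_induction_on_left' with
    | algebraMap r => rw [algebraMap_ps]; exact isEB_coe r
    | add x y i hx hy h1 h2 => exact h1.add h2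
    | mem_mul m hm i x hx h => exact (hEN m hm).mul h
  let S := Algebra.adjoin K (Set.range v)
  have hSft : Algebra.FiniteType K S := (Subalgebra.fg_iff_finiteType _).1
    (Subalgebra.fg_def.2 ⟨_, Set.finite_range v, rfl⟩)
  obtain ⟨t, g, hginj, hgfin⟩ := exists_finite_inj_algHom_of_fg K S
  let V : Submodule K S := Submodule.span K
    (insert 1 (Set.range fun a => (⟨v a, Algebra.subset_adjoin ⟨a, rfl⟩⟩ : S)))
  have hVFG : V.FG := Submodule.fg_span ((Set.finite_range _).insert 1)
  have hevC : ∀ r : K[X], evEB K ⟨r, isEB_coe r⟩ = algebraMap K ℂ (r.eval 1) := by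
    intro r
    rw [evEB_apply]
    have := evalEntire_coe 1 (r.map (algebraMap K ℂ))
    rw [Polynomial.eval_one_map] at this
    rw [← this]
    congr 1
    apply Subtype.ext
    exact (Polynomial.polynomial_map_coe).symm
  have hVN : ∀ f (hf : f ∈ N), ∃ y ∈ V, (y : ℂ) = evEB K ⟨f, hEN f hf⟩ := by
    intro f hf
    suffices h : ∀ f' : ebSub K, f'.1 = f → ∃ y ∈ V, (y : ℂ) = evEB K f' from h _ rfl
    induction hf using Submodule.span_induction with
    | mem x hx =>
      rintro f' rfl
      rcases hx with h | ⟨a, ha⟩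
      · refine ⟨1, Submodule.subset_span (Set.mem_insert _ _), ?_⟩
        rw [show f' = 1 from Subtype.ext h, map_one]; rfl
      · refine ⟨_, Submodule.subset_span (Set.mem_insert_of_mem _ ⟨a, rfl⟩), ?_⟩
        rw [show f' = ⟨F a, hF a⟩ from Subtype.ext ha.symm]
    | zero =>
      rintro f' hf'
      refine ⟨0, V.zero_mem, ?_⟩
      rw [show f' = 0 from Subtype.ext hf', map_zero]; rfl
    | add x y hx hy h1 h2 =>
      rintro f' hf'
      obtain ⟨y1, hy1, e1⟩ := h1 ⟨x, hEN x hx⟩ rfl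
      obtain ⟨y2, hy2, e2⟩ := h2 ⟨y, hEN y hy⟩ rfl
      refine ⟨y1 + y2, V.add_mem hy1 hy2, ?_⟩
      rw [show f' = ⟨x, hEN x hx⟩ + ⟨y, hEN y hy⟩ from Subtype.ext hf', map_add, ← e1, ← e2]; rfl
    | smul r x hx h1 =>
      rintro f' hf'
      obtain ⟨y1, hy1, e1⟩ := h1 ⟨x, hEN x hx⟩ rfl
      refine ⟨r.eval 1 • y1, V.smul_mem _ hy1, ?_⟩
      rw [show f' = ⟨r, isEB_coe r⟩ * ⟨x, hEN x hx⟩ from Subtype.ext (hf'.trans (smul_ps _ _)),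
        map_mul, hevC, ← e1, ← Algebra.smul_def]; rfl
  have hVpow : ∀ e, ∀ f (hf : f ∈ N ^ e), ∃ y ∈ V ^ e, (y : ℂ) = evEB K ⟨f, hE e f hf⟩ := by
    intro e f hf
    suffices h : ∀ f' : ebSub K, f'.1 = f → ∃ y ∈ V ^ e, (y : ℂ) = evEB K f' from h _ rfl
    induction hf using Submodule.pow_induction_on_left' with
    | algebraMap r =>
      rintro f' hf'
      refine ⟨algebraMap K S (r.eval 1), Submodule.algebraMap_mem _, ?_⟩
      rw [show f' = ⟨r, isEB_coe r⟩ from Subtype.ext (hf'.trans (algebraMap_ps _)), hevC]; rfl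
    | add x y i hx hy h1 h2 =>
      rintro f' hf'
      obtain ⟨y1, hy1, e1⟩ := h1 ⟨x, hE i x hx⟩ rfl
      obtain ⟨y2, hy2, e2⟩ := h2 ⟨y, hE i y hy⟩ rfl
      refine ⟨y1 + y2, Submodule.add_mem _ hy1 hy2, ?_⟩
      rw [show f' = ⟨x, hE i x hx⟩ + ⟨y, hE i y hy⟩ from Subtype.ext hf', map_add, ← e1, ← e2]; rfl
    | mem_mul m hm i x hx h =>
      rintro f' hf'
      obtain ⟨y1, hy1, e1⟩ := hVN m hm
      obtain ⟨y2, hy2, e2⟩ := h ⟨x, hE i x hx⟩ rfl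
      refine ⟨y1 * y2, by rw [Nat.succ_eq_add_one, pow_succ']; exact Submodule.mul_mem_mul hy1 hy2, ?_⟩
      rw [show f' = ⟨m, hEN m hm⟩ * ⟨x, hE i x hx⟩ from Subtype.ext hf', map_mul, ← e1, ← e2]; rfl
  obtain ⟨A, B, hAB⟩ := finrank_pow_le g hgfin V hVFG
  have hbound : ∀ e, Module.finrank K[X] ↥(N ^ e) ≤
      Module.finrank ℚ K * (A * (B * (e + 1)) ^ t) := by
    intro e
    have := (hAB e).1
    have h := rank_bound (N ^ e) ((fg_oneSpan F).pow _) (hE e) Q hQ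
      (fun f hf => derivative_mem_pow (fun f hf => derivative_mem_oneSpan hst hf) hf)
      (one_mem_pow (one_mem_oneSpan F) e) ((V ^ e).map S.val.toLinearMap)
      (fun f hf => by
        obtain ⟨y, hy, e1⟩ := hVpow e f hf
        exact ⟨y, hy, e1⟩)
    refine h.trans (Nat.mul_le_mul_left _ (le_trans ?_ (hAB e).2))
    exact Submodule.finrank_map_le _ _
  have hτ : τ ≤ t := by
    apply le_of_pow_growth (A := Module.finrank ℚ K * A) (B := B * (τ + 1))
    intro u
    refine (le_finrank_pow (fg_oneSpan F) (one_mem_oneSpan F) (F ∘ J)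
      (fun i => mem_oneSpan F _) hJ u).trans ((hbound _).trans ?_)
    rw [mul_assoc]
    gcongr 2
    rw [mul_assoc]
    gcongr 2
    nlinarith
  refine ⟨fun i => (g (MvPolynomial.X (Fin.castLE hτ i)) : ℂ), ?_, fun i => SetLike.coe_mem _⟩
  have h1 : AlgebraicIndependent K fun i : Fin t => (g (MvPolynomial.X i) : ℂ) := by
    have h2 : AlgebraicIndependent K fun i : Fin t => g (MvPolynomial.X i) := by
      have : MvPolynomial.aeval (fun i : Fin t => g (MvPolynomial.X i)) = g := by
        ext i; simp
      rw [AlgebraicIndependent, this]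
      exact hginj
    exact h2.map' (f := S.val) Subtype.val_injective
  exact h1.comp _ (Fin.castLE_injective hτ)

end Values

section EntireFunctions
open PowerSeries Filter Topology

theorem hasFPowerSeriesOnBall_evalEntire (f : entire) :
    HasFPowerSeriesOnBall (fun z => evalEntire z f)
      (FormalMultilinearSeries.ofScalars ℂ fun n => coeff n f.1) 0 ⊤ := by
  have hr : (FormalMultilinearSeries.ofScalars ℂ fun n => coeff n f.1).radius = ⊤ := by
    rw [FormalMultilinearSeries.radius_eq_top_iff_summable_norm]
    intro r
    simpa [FormalMultilinearSeries.ofScalars_norm] using f.2 r r.2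
  have h := (FormalMultilinearSeries.ofScalars ℂ fun n => coeff n f.1).hasFPowerSeriesOnBall
    (by rw [hr]; exact ENNReal.zero_lt_top)
  rw [hr] at h
  convert h using 1
  funext z
  rw [evalEntire_apply, ← FormalMultilinearSeries.ofScalarsSum,
    FormalMultilinearSeries.ofScalars_sum_eq]
  simp

theorem differentiable_evalEntire (f : entire) : Differentiable ℂ fun z => evalEntire z f := by
  intro z
  exact (hasFPowerSeriesOnBall_evalEntire f).differentiableOn.differentiableAt
    (by simp)

theorem entire_eq_zero {f : entire} (h : ∀ z, evalEntire z f = 0) : f = 0 := by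
  have h1 := (hasFPowerSeriesOnBall_evalEntire f).hasFPowerSeriesAt
  have h2 : (fun z => evalEntire z f) = 0 := funext h
  rw [h2] at h1
  have h3 := h1.eq_zero
  rw [FormalMultilinearSeries.ofScalars_series_eq_zero] at h3
  apply Subtype.ext
  ext n
  simpa using congrFun h3 n

theorem exists_polynomial_of_growth {h : ℂ → ℂ} (hd : Differentiable ℂ h) {C : ℝ} {D : ℕ}
    (hb : ∀ z, ‖h z‖ ≤ C * (1 + ‖z‖) ^ D) : ∃ w : ℂ[X], ∀ z, w.eval z = h z := by
  have hzero : ∀ n, D < n → iteratedDeriv n h 0 = 0 := by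
    intro n hn
    have hC : 0 ≤ C := by
      have := (norm_nonneg _).trans (hb 0)
      simpa using this
    have hle : ∀ R : ℝ, 1 ≤ R → ‖iteratedDeriv n h 0‖ ≤ (n.factorial * C * 2 ^ D) * R⁻¹ := by
      intro R hR
      have hR0 : 0 < R := by linarith
      have := Complex.norm_iteratedDeriv_le_of_forall_mem_sphere_norm_le n hR0
        (hd.diffContOnCl (s := Metric.ball 0 R)) (C := C * (2 * R) ^ D) (fun z hz => by
          rw [mem_sphere_zero_iff_norm] at hz
          refine (hb z).trans ?_
          rw [hz]
          gcongr
          linarith)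
      refine this.trans ?_
      rw [mul_pow, div_le_iff₀ (by positivity)]
      have h1 : R ^ D ≤ R⁻¹ * R ^ n := by
        rw [show n = (n - 1) + 1 by omega, pow_succ]
        field_simp
        exact pow_le_pow_right₀ hR (by omega)
      calc (n.factorial : ℝ) * (C * (2 ^ D * R ^ D))
          = (n.factorial * C * 2 ^ D) * R ^ D := by ring
        _ ≤ (n.factorial * C * 2 ^ D) * (R⁻¹ * R ^ n) := by gcongr
        _ = _ := by ring
    have ht : Tendsto (fun R : ℝ => (n.factorial * C * 2 ^ D) * R⁻¹) atTop (𝓝 0) := by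
      simpa using tendsto_inv_atTop_zero.const_mul ((n.factorial : ℝ) * C * 2 ^ D)
    have := ge_of_tendsto ht ((eventually_ge_atTop 1).mono hle)
    exact norm_le_zero_iff.1 this
  refine ⟨∑ n ∈ Finset.range (D + 1), Polynomial.monomial n ((n ! : ℂ)⁻¹ * iteratedDeriv n h 0),
    fun z => ?_⟩
  rw [← Complex.taylorSeries_eq_of_entire' 0 z hd, tsum_eq_sum (s := Finset.range (D + 1)),
    Polynomial.eval_finsetSum]
  · simp [Polynomial.eval_monomial]
  · intro n hn
    rw [hzero n (by simpa using hn)]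
    simp

theorem exists_polynomial_quotient {P q : ℂ → ℂ} (hP : Differentiable ℂ P)
    (hq : Differentiable ℂ q) (hq0 : ∃ z, q z ≠ 0) {C : ℝ} {D : ℕ}
    (hb : ∀ z, ‖P z‖ ≤ C * (1 + ‖z‖) ^ D * ‖q z‖) :
    ∃ w : ℂ[X], ∀ z, w.eval z * q z = P z := by
  have hC : 0 ≤ C := by
    obtain ⟨z, hz⟩ := hq0
    have h1 := (norm_nonneg _).trans (hb z)
    have h2 : 0 < ‖q z‖ := norm_pos_iff.2 hz
    have h3 : 0 ≤ C * (1 + ‖z‖) ^ D := nonneg_of_mul_nonneg_left h1 h2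
    exact nonneg_of_mul_nonneg_left h3 (by positivity)
  have hne : ∀ z0, ∀ᶠ z in 𝓝[≠] z0, q z ≠ 0 := by
    intro z0
    rcases (hq.analyticAt z0).eventually_eq_zero_or_eventually_ne_zero with h | h
    · exfalso
      obtain ⟨z, hz⟩ := hq0
      have := AnalyticOnNhd.eq_of_eventuallyEq (f := q) (g := 0) (fun z _ => hq.analyticAt z)
        (fun z _ => analyticAt_const) (z₀ := z0) h
      exact hz (congrFun this z)
    · exact h
  set g : ℂ → ℂ := fun z => P z / q z with hg
  have hgb : ∀ z, ‖g z‖ ≤ C * (1 + ‖z‖) ^ D := by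
    intro z
    by_cases hz : q z = 0
    · simp only [hg, hz, div_zero, norm_zero]; positivity
    · rw [hg, norm_div, div_le_iff₀ (norm_pos_iff.2 hz)]
      exact hb z
  set h : ℂ → ℂ := fun z => limUnder (𝓝[≠] z) g with hh
  have hhg : ∀ z, q z ≠ 0 → h z = g z := by
    intro z hz
    have : ContinuousAt g z := (hP.continuous.continuousAt).div hq.continuous.continuousAt hz
    exact (this.tendsto.mono_left nhdsWithin_le_nhds).limUnder_eq
  have hd : Differentiable ℂ h := by
    intro z0
    obtain ⟨ε, hε, hball⟩ := Metric.eventually_nhds_iff_ball.1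
      (eventually_nhdsWithin_iff.1 (hne z0))
    set s := Metric.ball z0 (min ε 1) with hs
    have hsn : s ∈ 𝓝 z0 := Metric.ball_mem_nhds _ (lt_min hε one_pos)
    have hsq : ∀ z ∈ s, z ≠ z0 → q z ≠ 0 := fun z hz hzz =>
      hball z (Metric.ball_subset_ball (min_le_left _ _) hz) hzz
    have hupd := Complex.differentiableOn_update_limUnder_of_bddAbove (f := g) hsn
      (fun z hz => ((hP z).div (hq z) (hsq z hz.1 hz.2)).differentiableWithinAt)
      (by
        refine ⟨C * (1 + (‖z0‖ + 1)) ^ D, ?_⟩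
        rintro _ ⟨z, hz, rfl⟩
        refine (hgb z).trans ?_
        have h1 : dist z z0 < 1 := lt_of_lt_of_le hz.1 (min_le_right _ _)
        have h2 : ‖z‖ ≤ ‖z0‖ + 1 := by
          have := norm_le_norm_add_norm_sub z0 z
          rw [dist_eq_norm] at h1
          rw [norm_sub_rev] at this
          linarith
        gcongr)
    refine (hupd.differentiableAt hsn).congr_of_eventuallyEq ?_
    filter_upwards [hsn] with z hz
    by_cases hzz : z = z0
    · subst hzz; rw [Function.update_self]
    · rw [Function.update_of_ne hzz]
      exact hhg z (hsq z hz hzz)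
  have hhb : ∀ z, ‖h z‖ ≤ C * (1 + ‖z‖) ^ D := by
    intro z0
    have h1 : Tendsto (fun z => ‖h z‖) (𝓝[≠] z0) (𝓝 ‖h z0‖) :=
      (hd.continuous.norm.tendsto z0).mono_left nhdsWithin_le_nhds
    have h2 : Tendsto (fun z : ℂ => C * (1 + ‖z‖) ^ D) (𝓝[≠] z0) (𝓝 (C * (1 + ‖z0‖) ^ D)) := by
      have : Continuous fun z : ℂ => C * (1 + ‖z‖) ^ D := by fun_prop
      exact (this.tendsto z0).mono_left nhdsWithin_le_nhds
    refine le_of_tendsto_of_tendsto h1 h2 ((hne z0).mono fun z hz => ?_)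
    simp only [hhg z hz]
    exact hgb z
  obtain ⟨w, hw⟩ := exists_polynomial_of_growth hd hhb
  refine ⟨w, fun z => ?_⟩
  rw [hw]
  by_cases hz : q z = 0
  · have := hb z
    rw [hz, norm_zero, mul_zero, norm_le_zero_iff] at this
    rw [hz, this, mul_zero]
  · rw [hhg z hz, hg, div_mul_cancel₀ _ hz]

theorem le_of_pow_le_sum {m : ℕ} {x y : ℝ} (hy : 0 ≤ y) (a : ℕ → ℝ)
    (ha : ∀ i, 0 ≤ a i) (h : x ^ m ≤ ∑ i ∈ Finset.range m, a i * x ^ i * y ^ (m - i)) :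
    x ≤ (1 + ∑ i ∈ Finset.range m, a i) * y := by
  set A := ∑ i ∈ Finset.range m, a i with hA
  have hA0 : 0 ≤ A := Finset.sum_nonneg fun i _ => ha i
  by_contra! hlt
  have hyx : y < x := by nlinarith
  have hx0 : 0 < x := by linarith
  have hm : 0 < m := by
    rcases Nat.eq_zero_or_pos m with rfl | hm
    · simp at h
      linarith
    · exact hm
  have h1 : ∑ i ∈ Finset.range m, a i * x ^ i * y ^ (m - i) ≤
      ∑ i ∈ Finset.range m, a i * (x ^ (m - 1) * y) := by
    refine Finset.sum_le_sum fun i hi => ?_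
    have hi' := Finset.mem_range.1 hi
    rw [mul_assoc]
    refine mul_le_mul_of_nonneg_left ?_ (ha i)
    calc x ^ i * y ^ (m - i) = x ^ i * (y ^ (m - i - 1) * y) := by
          rw [← pow_succ]; congr 2; omega
      _ ≤ x ^ i * (x ^ (m - i - 1) * y) := by gcongr
      _ = x ^ (m - 1) * y := by rw [← mul_assoc, ← pow_add]; congr 2; omega
  rw [← Finset.sum_mul, ← hA] at h1
  have h2 : x ^ m = x ^ (m - 1) * x := by rw [← pow_succ]; congr 1; omega
  have h3 : x ^ (m - 1) * x ≤ x ^ (m - 1) * (A * y) := by rw [← h2]; linarith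
  have h4 : x ≤ A * y := le_of_mul_le_mul_left h3 (by positivity)
  nlinarith

theorem exists_norm_eval_le (d : ℂ[X]) : ∃ (C : ℝ) (D : ℕ), 0 ≤ C ∧
    ∀ z : ℂ, ‖d.eval z‖ ≤ C * (1 + ‖z‖) ^ D := by
  refine ⟨∑ i ∈ Finset.range (d.natDegree + 1), ‖d.coeff i‖, d.natDegree, by positivity,
    fun z => ?_⟩
  rw [Polynomial.eval_eq_sum_range, Finset.sum_mul]
  refine norm_sum_le_of_le _ fun i hi => ?_
  rw [norm_mul, norm_pow]
  gcongr
  calc ‖z‖ ^ i ≤ (1 + ‖z‖) ^ i := by gcongr; linarith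
    _ ≤ _ := pow_le_pow_right₀ (by linarith [norm_nonneg z])
      (Nat.lt_succ_iff.1 (Finset.mem_range.1 hi))

theorem exists_norm_sum_eval_le {m : ℕ} (d : ℕ → ℂ[X]) : ∃ (C : ℝ) (D : ℕ),
    ∀ z : ℂ, 1 + ∑ i ∈ Finset.range m, ‖(d i).eval z‖ ≤ C * (1 + ‖z‖) ^ D := by
  choose C D hC h using fun i => exists_norm_eval_le (d i)
  refine ⟨1 + ∑ i ∈ Finset.range m, C i, ∑ i ∈ Finset.range m, D i, fun z => ?_⟩
  have hz : 1 ≤ 1 + ‖z‖ := by linarith [norm_nonneg z]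
  rw [add_mul, one_mul, Finset.sum_mul]
  refine add_le_add (one_le_pow₀ hz) (Finset.sum_le_sum fun i hi => (h i z).trans ?_)
  have := hC i
  gcongr
  exact Finset.single_le_sum (f := D) (fun _ _ => Nat.zero_le _) hi

/-- A quotient of entire series which is algebraic over `ℂ(z)` is rational. -/
theorem entire_algebraic_rational {p q : ℂ⟦X⟧} (hp : IsEntire p) (hq : IsEntire q) (hq0 : q ≠ 0)
    {m : ℕ} (c : ℕ → ℂ[X]) (hc : c m ≠ 0)
    (h : ∑ i ∈ Finset.range (m + 1), (c i : ℂ⟦X⟧) * p ^ i * q ^ (m - i) = 0) :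
    ∃ u w : ℂ[X], u ≠ 0 ∧ (u : ℂ⟦X⟧) * p = w * q := by
  rcases Nat.eq_zero_or_pos m with rfl | hm
  · simp at h
    exact absurd h hc
  let p' : entire := ⟨p, hp⟩
  let q' : entire := ⟨q, hq⟩
  let cc : ℂ[X] → entire := fun d => ⟨d, isEntire_coe d⟩
  have hev : ∀ z d, evalEntire z (cc d) = d.eval z := fun z d => evalEntire_coe z d
  have hrel : ∑ i ∈ Finset.range (m + 1), cc (c i) * p' ^ i * q' ^ (m - i) = 0 := by
    apply Subtype.ext
    rw [AddSubmonoidClass.coe_finsetSum]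
    exact h
  have hz : ∀ z, ∑ i ∈ Finset.range (m + 1), (c i).eval z * evalEntire z p' ^ i *
      evalEntire z q' ^ (m - i) = 0 := fun z => by
    have := congrArg (evalEntire z) hrel
    simpa [map_sum, hev] using this
  let d : ℕ → ℂ[X] := fun i => c i * c m ^ (m - 1 - i)
  obtain ⟨C, D, hCD⟩ := exists_norm_sum_eval_le (m := m) d
  have hbound : ∀ z, ‖(c m).eval z * evalEntire z p'‖ ≤
      C * (1 + ‖z‖) ^ D * ‖evalEntire z q'‖ := by
    intro z
    set P := (c m).eval z * evalEntire z p' with hP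
    have h1 : P ^ m = - ∑ i ∈ Finset.range m, (d i).eval z * P ^ i * evalEntire z q' ^ (m - i) := by
      have h2 := hz z
      rw [Finset.sum_range_succ, Nat.sub_self, pow_zero, mul_one] at h2
      have h3 : (c m).eval z ^ (m - 1) * ((c m).eval z * evalEntire z p' ^ m) = P ^ m := by
        rw [hP, mul_pow, ← mul_assoc, ← pow_succ]; congr 2; omega
      rw [← h3, eq_neg_of_add_eq_zero_right h2, mul_neg, Finset.mul_sum]
      congr 1
      refine Finset.sum_congr rfl fun i hi => ?_
      have hi' := Finset.mem_range.1 hi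
      rw [hP, mul_pow, Polynomial.eval_mul, Polynomial.eval_pow,
        show m - 1 = (m - 1 - i) + i by omega, pow_add, show m - 1 - i + i - i = m - 1 - i by omega]
      ring
    have h4 : ‖P‖ ^ m ≤ ∑ i ∈ Finset.range m,
        ‖(d i).eval z‖ * ‖P‖ ^ i * ‖evalEntire z q'‖ ^ (m - i) := by
      rw [← norm_pow, h1, norm_neg]
      refine norm_sum_le_of_le _ fun i _ => ?_
      rw [norm_mul, norm_mul, norm_pow, norm_pow]
    refine (le_of_pow_le_sum (norm_nonneg _) _ (fun i => norm_nonneg _) h4).trans ?_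
    gcongr
    exact hCD z
  have hq0' : ∃ z, evalEntire z q' ≠ 0 := by
    by_contra! hall
    exact hq0 (congrArg Subtype.val (entire_eq_zero hall))
  obtain ⟨w, hw⟩ := exists_polynomial_quotient (P := fun z => (c m).eval z * evalEntire z p')
    (((c m).differentiable).mul (differentiable_evalEntire p')) (differentiable_evalEntire q')
    hq0' hbound
  refine ⟨c m, w, hc, ?_⟩
  have : cc (c m) * p' - cc w * q' = 0 := entire_eq_zero fun z => by
    rw [map_sub, map_mul, map_mul, hev, hev, hw z, sub_self]
  exact congrArg Subtype.val (sub_eq_zero.1 this)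

end EntireFunctions

section AlgebraicallyClosed
open PowerSeries
variable {k : Type*} [Field k] [Algebra k ℂ]

/-- The polynomial obtained by applying a linear form to the coefficients. -/
def mapForm (ρ : ℂ →ₗ[k] k) (u : ℂ[X]) : k[X] :=
  ∑ i ∈ Finset.range (u.natDegree + 1), Polynomial.monomial i (ρ (u.coeff i))

theorem coeff_mapForm (ρ : ℂ →ₗ[k] k) (u : ℂ[X]) (n : ℕ) :
    (mapForm ρ u).coeff n = ρ (u.coeff n) := by
  rw [mapForm, Polynomial.finsetSum_coeff]
  simp only [Polynomial.coeff_monomial]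
  rw [Finset.sum_ite_eq' (Finset.range (u.natDegree + 1)) n]
  split_ifs with h
  · rfl
  · rw [Polynomial.coeff_eq_zero_of_natDegree_lt (by simpa using h), map_zero]

theorem coeff_mapForm_mul (ρ : ℂ →ₗ[k] k) (u : ℂ[X]) (p : k⟦X⟧) (n : ℕ) :
    coeff n ((mapForm ρ u : k⟦X⟧) * p) =
      ρ (coeff n ((u : ℂ⟦X⟧) * PowerSeries.map (algebraMap k ℂ) p)) := by
  rw [coeff_mul, coeff_mul, map_sum]
  refine Finset.sum_congr rfl fun ij _ => ?_
  rw [Polynomial.coeff_coe, Polynomial.coeff_coe, coeff_mapForm, coeff_map, mul_comm (u.coeff _),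
    ← Algebra.smul_def, map_smul, smul_eq_mul, mul_comm]

/-- A quotient of series with entire images which is algebraic over `k(z)` is rational. -/
theorem algebraic_rational {p q : k⟦X⟧} (hp : IsEntire (PowerSeries.map (algebraMap k ℂ) p))
    (hq : IsEntire (PowerSeries.map (algebraMap k ℂ) q)) (hq0 : q ≠ 0) {m : ℕ} (c : ℕ → k[X])
    (hc : c m ≠ 0)
    (h : ∑ i ∈ Finset.range (m + 1), (c i : k⟦X⟧) * p ^ i * q ^ (m - i) = 0) :
    ∃ u w : k[X], u ≠ 0 ∧ (u : k⟦X⟧) * p = w * q := by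
  have hinj : Function.Injective (PowerSeries.map (algebraMap k ℂ)) :=
    PowerSeries.map_injective _ (algebraMap k ℂ).injective
  obtain ⟨u, w, hu, huw⟩ := entire_algebraic_rational hp hq
    ((map_ne_zero_iff _ hinj).2 hq0) (m := m) (fun i => (c i).map (algebraMap k ℂ))
    ((Polynomial.map_ne_zero_iff (algebraMap k ℂ).injective).2 hc) (by
      have := congrArg (PowerSeries.map (algebraMap k ℂ)) h
      simpa [map_sum, Polynomial.polynomial_map_coe] using this)
  obtain ⟨n, hn⟩ : ∃ n, u.coeff n ≠ 0 := by
    by_contra! h0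
    exact hu (Polynomial.ext fun n => by simp [h0])
  obtain ⟨ρ, hρ⟩ : ∃ ρ : ℂ →ₗ[k] k, ρ (u.coeff n) ≠ 0 := by
    by_contra! h0
    exact hn ((Module.forall_dual_apply_eq_zero_iff k _).1 h0)
  refine ⟨mapForm ρ u, mapForm ρ w, fun h0 => hρ ?_, ?_⟩
  · rw [← coeff_mapForm, h0, Polynomial.coeff_zero]
  · ext n
    rw [coeff_mapForm_mul, coeff_mapForm_mul, huw]

end AlgebraicallyClosed

section Specialization
variable {F E Ω L : Type*} [Field F] [CharZero F] [Field E] [Algebra F E] [Field Ω]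

/-- If `F` is algebraically closed in `E`, elements of `E` which are linearly independent over `F`
stay so over the elements algebraic over `F` of any extension of `E`. -/
theorem eq_zero_of_sum_mul_eq_zero [Algebra F Ω] [Algebra E Ω] [IsScalarTower F E Ω]
    (hcl : ∀ x : E, IsIntegral F x → x ∈ (algebraMap F E).range) {ι : Type*} [Fintype ι]
    (x : ι → E) (hx : LinearIndependent F x) (m : ι → Ω) (hm : ∀ i, IsIntegral F (m i))
    (h : ∑ i, algebraMap E Ω (x i) * m i = 0) : m = 0 := by
  have hfd : FiniteDimensional F (IntermediateField.adjoin F (Set.range m)) :=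
    IntermediateField.finiteDimensional_adjoin (by rintro _ ⟨i, rfl⟩; exact hm i)
  obtain ⟨β', hβ'⟩ := Field.exists_primitive_element F (IntermediateField.adjoin F (Set.range m))
  set β : Ω := β'.1 with hβdef
  have hβ : IsIntegral F β := (Algebra.IsIntegral.isIntegral (R := F) β').map
    (IntermediateField.val _)
  have hP : ∀ i, ∃ P : F[X], P.degree < (minpoly F β).degree ∧ Polynomial.aeval β P = m i := by
    intro i
    have hmem : (⟨m i, IntermediateField.subset_adjoin F _ ⟨i, rfl⟩⟩ :
      IntermediateField.adjoin F (Set.range m)) ∈ IntermediateField.adjoin F {β'} := by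
      rw [hβ']; trivial
    rw [← IntermediateField.mem_toSubalgebra,
      IntermediateField.adjoin_simple_toSubalgebra_of_isAlgebraic
        (Algebra.IsAlgebraic.isAlgebraic β'), Algebra.adjoin_singleton_eq_range_aeval] at hmem
    obtain ⟨R, hR⟩ := hmem
    have hR' : Polynomial.aeval β R = m i := by
      have h1 := congrArg (IntermediateField.val (IntermediateField.adjoin F (Set.range m))) hR
      have h2 : (Polynomial.aeval β) R = m i :=
        (Polynomial.aeval_algHom_apply (IntermediateField.val _) β' R).trans h1
      exact h2
    refine ⟨R %ₘ minpoly F β, Polynomial.degree_modByMonic_lt _ (minpoly.monic hβ), ?_⟩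
    rw [← hR']
    conv_rhs => rw [← Polynomial.modByMonic_add_div R (minpoly F β)]
    simp
  choose P hPdeg hP using hP
  have hβE : IsIntegral E β := hβ.tower_top
  have hdeg : (minpoly F β).degree ≤ (minpoly E β).degree := by
    have hl := integralClosure.mem_lifts_of_monic_of_dvd_map E (minpoly.monic hβ)
      (minpoly.monic hβE) (minpoly.dvd_map_of_isScalarTower F E β)
    have hl' : minpoly E β ∈ Polynomial.lifts (algebraMap F E) := by
      rw [Polynomial.lifts_iff_coeff_lifts] at hl ⊢
      intro n
      obtain ⟨⟨y, hy⟩, hy'⟩ := hl n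
      rw [← hy']
      exact hcl y hy
    obtain ⟨q, hq, hqd, hqm⟩ := Polynomial.lifts_and_natDegree_eq_and_monic hl' (minpoly.monic hβE)
    have hq0 : Polynomial.aeval β q = 0 := by
      rw [← Polynomial.aeval_map_algebraMap E, hq, minpoly.aeval]
    rw [← hq, Polynomial.degree_map]
    exact minpoly.min F β hqm hq0
  have hz : ∑ i, Polynomial.C (x i) * (P i).map (algebraMap F E) = 0 := by
    by_contra hne
    have h1 := minpoly.degree_le_of_ne_zero E β hne (by
      rw [map_sum, ← h]
      refine Finset.sum_congr rfl fun i _ => ?_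
      rw [map_mul, Polynomial.aeval_C, Polynomial.aeval_map_algebraMap, hP])
    refine absurd (hdeg.trans h1) (not_le.2 ?_)
    refine lt_of_le_of_lt (Polynomial.degree_sum_le _ _) ?_
    rw [Finset.sup_lt_iff (bot_lt_iff_ne_bot.2 (by
      simpa using minpoly.ne_zero hβ))]
    intro i _
    refine lt_of_le_of_lt ?_ (hPdeg i)
    refine (Polynomial.degree_mul_le _ _).trans ?_
    rw [Polynomial.degree_map]
    simpa using add_le_add_left (Polynomial.degree_C_le (a := x i)) (P i).degree
  funext i
  rw [← hP i]
  suffices P i = 0 by rw [this]; simp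
  ext n
  have hn := congrArg (fun p => Polynomial.coeff p n) hz
  simp only [Polynomial.finsetSum_coeff, Polynomial.coeff_C_mul, Polynomial.coeff_map,
    Polynomial.coeff_zero] at hn
  exact Fintype.linearIndependent_iff.1 hx (fun i => (P i).coeff n) (by
    simpa [Algebra.smul_def, mul_comm] using hn) i

theorem exists_algHom_isIntegral_of_field (κ : Type*) [Field κ] [Algebra F κ]
    [Algebra.FiniteType F κ] [Algebra F Ω] [IsAlgClosed Ω] :
    ∃ χ : κ →ₐ[F] Ω, ∀ a, IsIntegral F (χ a) := by
  have hfin : Module.Finite F κ := finite_of_finite_type_of_isJacobsonRing F κ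
  exact ⟨IsAlgClosed.lift, fun a => (Algebra.IsIntegral.isIntegral (R := F) a).map _⟩

theorem exists_algHom_isIntegral (B : Type*) [CommRing B] [Nontrivial B] [Algebra F B]
    [Algebra.FiniteType F B] [Algebra F Ω] [IsAlgClosed Ω] :
    ∃ ψ : B →ₐ[F] Ω, ∀ a, IsIntegral F (ψ a) := by
  obtain ⟨M, hM⟩ := Ideal.exists_maximal B
  let _ : Field (B ⧸ M) := Ideal.Quotient.field M
  obtain ⟨χ, hχ⟩ := exists_algHom_isIntegral_of_field (F := F) (Ω := Ω) (B ⧸ M)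
  exact ⟨χ.comp (Ideal.Quotient.mkₐ F M), fun a => hχ _⟩

/-- If `F` is algebraically closed in `E`, the product of two nonzero tensors in `E ⊗ L`, written
in terms of structure constants, does not vanish. -/
theorem eq_zero_or_eq_zero_of_structure [Field L] [Algebra F L]
    (hcl : ∀ x : E, IsIntegral F x → x ∈ (algebraMap F E).range)
    {ι ι' ι'' : Type*} [Fintype ι] [Fintype ι'] [Fintype ι'']
    (x : ι → E) (hx : LinearIndependent F x) (x' : ι' → E) (hx' : LinearIndependent F x')
    (x'' : ι'' → E) (s : ι → ι' → ι'' → F)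
    (hs : ∀ i j, x i * x' j = ∑ l, algebraMap F E (s i j l) * x'' l)
    (g : ι → L) (g' : ι' → L)
    (hg : ∀ l, ∑ i, ∑ j, algebraMap F L (s i j l) * (g i * g' j) = 0) : g = 0 ∨ g' = 0 := by
  by_contra! hne
  obtain ⟨i₀, hi₀⟩ := Function.ne_iff.1 hne.1
  obtain ⟨j₀, hj₀⟩ := Function.ne_iff.1 hne.2
  set S : Set L := Set.range g ∪ Set.range g' ∪ {(g i₀)⁻¹, (g' j₀)⁻¹} with hS
  have hSfin : S.Finite := ((Set.finite_range g).union (Set.finite_range g')).union (by simp)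
  have hft : Algebra.FiniteType F (Algebra.adjoin F S) :=
    (Subalgebra.fg_iff_finiteType _).1 ⟨hSfin.toFinset, by simp⟩
  obtain ⟨ψ, hψ⟩ := exists_algHom_isIntegral (F := F) (Ω := AlgebraicClosure E)
    (Algebra.adjoin F S)
  have hmem : ∀ y ∈ S, y ∈ Algebra.adjoin F S := fun y hy => Algebra.subset_adjoin hy
  let G : ι → Algebra.adjoin F S := fun i => ⟨g i, hmem _ (Or.inl (Or.inl ⟨i, rfl⟩))⟩
  let G' : ι' → Algebra.adjoin F S := fun i => ⟨g' i, hmem _ (Or.inl (Or.inr ⟨i, rfl⟩))⟩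
  have hi1 : ψ (G i₀) ≠ 0 := by
    have : G i₀ * ⟨(g i₀)⁻¹, hmem _ (Or.inr (by simp))⟩ = 1 :=
      Subtype.ext (mul_inv_cancel₀ hi₀)
    intro h0
    have h1 := congrArg ψ this
    rw [map_mul, h0, zero_mul, map_one] at h1
    exact zero_ne_one h1
  have hj1 : ψ (G' j₀) ≠ 0 := by
    have : G' j₀ * ⟨(g' j₀)⁻¹, hmem _ (Or.inr (by simp))⟩ = 1 :=
      Subtype.ext (mul_inv_cancel₀ hj₀)
    intro h0
    have h1 := congrArg ψ this
    rw [map_mul, h0, zero_mul, map_one] at h1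
    exact zero_ne_one h1
  have hrel : ∀ l, ∑ i, ∑ j, algebraMap F (AlgebraicClosure E) (s i j l) *
      (ψ (G i) * ψ (G' j)) = 0 := by
    intro l
    have h0 : ∑ i, ∑ j, algebraMap F (Algebra.adjoin F S) (s i j l) * (G i * G' j) = 0 := by
      apply Subtype.ext
      simpa [G, G'] using hg l
    have h1 := congrArg ψ h0
    simpa [map_sum] using h1
  have hprod : (∑ i, algebraMap E (AlgebraicClosure E) (x i) * ψ (G i)) *
      (∑ j, algebraMap E (AlgebraicClosure E) (x' j) * ψ (G' j)) = 0 := by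
    rw [Finset.sum_mul_sum]
    have h1 : ∀ i j, algebraMap E (AlgebraicClosure E) (x i) * ψ (G i) *
        (algebraMap E (AlgebraicClosure E) (x' j) * ψ (G' j)) =
        ∑ l, algebraMap E (AlgebraicClosure E) (x'' l) *
          (algebraMap F (AlgebraicClosure E) (s i j l) * (ψ (G i) * ψ (G' j))) := by
      intro i j
      rw [mul_mul_mul_comm, ← map_mul, hs, map_sum, Finset.sum_mul]
      refine Finset.sum_congr rfl fun l _ => ?_
      rw [map_mul, ← IsScalarTower.algebraMap_apply]
      ring
    simp_rw [h1]
    have h2 : ∀ i, ∑ j, ∑ l, algebraMap E (AlgebraicClosure E) (x'' l) *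
          (algebraMap F (AlgebraicClosure E) (s i j l) * (ψ (G i) * ψ (G' j))) =
        ∑ l, algebraMap E (AlgebraicClosure E) (x'' l) * ∑ j,
          (algebraMap F (AlgebraicClosure E) (s i j l) * (ψ (G i) * ψ (G' j))) := fun i => by
      rw [Finset.sum_comm]
      simp_rw [Finset.mul_sum]
    simp_rw [h2]
    rw [Finset.sum_comm]
    simp_rw [← Finset.mul_sum, hrel, mul_zero, Finset.sum_const_zero]
  rcases mul_eq_zero.1 hprod with h | h
  · exact hi1 (congrFun (eq_zero_of_sum_mul_eq_zero hcl x hx (fun i => ψ (G i))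
      (fun i => hψ _) h) i₀)
  · exact hj1 (congrFun (eq_zero_of_sum_mul_eq_zero hcl x' hx' (fun i => ψ (G' i))
      (fun i => hψ _) h) j₀)

end Specialization

section Horizontal
open PowerSeries
variable {k : Type*} [Field k] [CharZero k]

theorem IsSol.eq_zero {n : ℕ} {Q : k[X]} {B : Matrix (Fin n) (Fin n) k[X]} {y : Fin n → k⟦X⟧}
    (hy : IsSol Q B y) (hQ : Q.coeff 0 ≠ 0) (h0 : ∀ i, constantCoeff (y i) = 0) : y = 0 := by
  have hQ' : constantCoeff (Q : k⟦X⟧) ≠ 0 := by simpa using hQ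
  refine ode_unique (fun i j => (Q : k⟦X⟧)⁻¹ * (B i j : k⟦X⟧)) y (fun i => ?_) h0
  simp_rw [mul_assoc]
  rw [← Finset.mul_sum, ← hy i, ← mul_assoc, PowerSeries.inv_mul_cancel _ hQ', one_mul]

/-- Products of horizontal vectors are horizontal. -/
theorem IsSol.structure_mul {n n' n'' : ℕ} {T : k[X]} {B : Matrix (Fin n) (Fin n) k[X]}
    {B' : Matrix (Fin n') (Fin n') k[X]} {B'' : Matrix (Fin n'') (Fin n'') k[X]}
    {s : Fin n → Fin n' → Fin n'' → k[X]}
    (hs : ∀ i j l, T * Polynomial.derivative (s i j l) + ∑ m, s i j m * B'' m l =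
      ∑ a, B i a * s a j l + ∑ c, B' j c * s i c l)
    {g : Fin n → k⟦X⟧} {g' : Fin n' → k⟦X⟧} (hg : IsSol T (-Bᵀ) g) (hg' : IsSol T (-B'ᵀ) g') :
    IsSol T (-B''ᵀ) fun l => ∑ i, ∑ j, (s i j l : k⟦X⟧) * (g i * g' j) := by
  intro l
  have e1 : ∀ i j, (T : k⟦X⟧) * d⁄dX k ((s i j l : k⟦X⟧) * (g i * g' j)) =
      (∑ a, (B i a : k⟦X⟧) * (s a j l : k⟦X⟧)) * (g i * g' j)
      + (∑ c, (B' j c : k⟦X⟧) * (s i c l : k⟦X⟧)) * (g i * g' j)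
      - (∑ m, (s i j m : k⟦X⟧) * (B'' m l : k⟦X⟧)) * (g i * g' j)
      - (s i j l : k⟦X⟧) * ((∑ a, (B a i : k⟦X⟧) * g a) * g' j)
      - (s i j l : k⟦X⟧) * (g i * (∑ c, (B' c j : k⟦X⟧) * g' c)) := by
    intro i j
    have h1 := congrArg (fun p : k[X] => (p : k⟦X⟧)) (hs i j l)
    simp only [Polynomial.coe_add, Polynomial.coe_mul, coe_sum_poly] at h1
    have h2 := hg i
    have h3 := hg' j
    simp only [Matrix.neg_apply, Matrix.transpose_apply, Polynomial.coe_neg, neg_mul,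
      Finset.sum_neg_distrib] at h2 h3
    rw [Derivation.leibniz, Derivation.leibniz, derivative_coe]
    simp only [smul_eq_mul]
    linear_combination (g i * g' j) * h1 + (s i j l : k⟦X⟧) * g' j * h2 +
      (s i j l : k⟦X⟧) * g i * h3
  have e4 : ∑ j, (((-B''ᵀ) l j : k[X]) : k⟦X⟧) *
      ∑ x, ∑ y, (s x y j : k⟦X⟧) * (g x * g' y) =
      - ∑ i, ∑ j, (∑ m, (s i j m : k⟦X⟧) * (B'' m l : k⟦X⟧)) * (g i * g' j) := by
    simp_rw [Finset.sum_mul, Finset.mul_sum, Matrix.neg_apply, Matrix.transpose_apply,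
      Polynomial.coe_neg, neg_mul, Finset.sum_neg_distrib]
    congr 1
    rw [Finset.sum_comm]
    refine Finset.sum_congr rfl fun i _ => ?_
    rw [Finset.sum_comm]
    refine Finset.sum_congr rfl fun j _ => Finset.sum_congr rfl fun m _ => by ring
  refine Eq.trans ?_ e4.symm
  rw [map_sum, Finset.mul_sum]
  have e5 : ∀ i, (T : k⟦X⟧) * d⁄dX k (∑ j, (s i j l : k⟦X⟧) * (g i * g' j)) =
      ∑ j, (T : k⟦X⟧) * d⁄dX k ((s i j l : k⟦X⟧) * (g i * g' j)) := fun i => by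
    rw [map_sum, Finset.mul_sum]
  simp_rw [e5, e1, Finset.sum_sub_distrib, Finset.sum_add_distrib]
  have e2 : ∑ i, ∑ j, (∑ a, (B i a : k⟦X⟧) * (s a j l : k⟦X⟧)) * (g i * g' j) =
      ∑ i, ∑ j, (s i j l : k⟦X⟧) * ((∑ a, (B a i : k⟦X⟧) * g a) * g' j) := by
    simp_rw [Finset.sum_mul, Finset.mul_sum]
    calc _ = ∑ i, ∑ a, ∑ j, (B i a : k⟦X⟧) * (s a j l : k⟦X⟧) * (g i * g' j) :=
          Finset.sum_congr rfl fun i _ => Finset.sum_comm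
      _ = ∑ a, ∑ i, ∑ j, (B i a : k⟦X⟧) * (s a j l : k⟦X⟧) * (g i * g' j) := Finset.sum_comm
      _ = _ := Finset.sum_congr rfl fun a _ => by
        rw [Finset.sum_comm]
        refine Finset.sum_congr rfl fun j _ => Finset.sum_congr rfl fun i _ => by ring
  have e3 : ∑ i, ∑ j, (∑ c, (B' j c : k⟦X⟧) * (s i c l : k⟦X⟧)) * (g i * g' j) =
      ∑ i, ∑ j, (s i j l : k⟦X⟧) * (g i * (∑ c, (B' c j : k⟦X⟧) * g' c)) := by
    simp_rw [Finset.sum_mul, Finset.mul_sum]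
    refine Finset.sum_congr rfl fun i _ => ?_
    rw [Finset.sum_comm]
    refine Finset.sum_congr rfl fun j _ => Finset.sum_congr rfl fun c _ => by ring
  rw [e2, e3]
  abel

end Horizontal

section Structure
variable {F E L : Type*} [Field F] [CharZero F] [Field E] [Algebra F E]

theorem eq_zero_or_eq_zero_of_structure_map [Field L] (τ : F →+* L)
    (hcl : ∀ x : E, IsIntegral F x → x ∈ (algebraMap F E).range)
    {ι ι' ι'' : Type*} [Fintype ι] [Fintype ι'] [Fintype ι'']
    (x : ι → E) (hx : LinearIndependent F x) (x' : ι' → E) (hx' : LinearIndependent F x')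
    (x'' : ι'' → E) (s : ι → ι' → ι'' → F)
    (hs : ∀ i j, x i * x' j = ∑ l, algebraMap F E (s i j l) * x'' l)
    (g : ι → L) (g' : ι' → L)
    (hg : ∀ l, ∑ i, ∑ j, τ (s i j l) * (g i * g' j) = 0) : g = 0 ∨ g' = 0 :=
  let _ := τ.toAlgebra
  eq_zero_or_eq_zero_of_structure hcl x hx x' hx' x'' s hs g g' hg

end Structure

section Fibre
open PowerSeries
variable {k : Type*} [Field k] [CharZero k]

theorem mem_range_of_isIntegral [Algebra k ℂ] {A : Subalgebra k[X] k⟦X⟧}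
    (hent : ∀ f ∈ A, IsEntire (PowerSeries.map (algebraMap k ℂ) f)) (E F : Type*) [Field E]
    [Algebra A E] [IsFractionRing A E] [Field F] [Algebra k[X] F] [IsFractionRing k[X] F]
    [Algebra k[X] E] [IsScalarTower k[X] A E] [Algebra F E] [IsScalarTower k[X] F E]
    (x : E) (hx : IsIntegral F x) : x ∈ (algebraMap F E).range := by
  obtain ⟨c, hc0, hc⟩ := (IsFractionRing.isAlgebraic_iff k[X] F E).2 hx.isAlgebraic
  obtain ⟨p, q, hq, rfl⟩ := IsFractionRing.div_surjective (A := A) x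
  have hq0 : (q : k⟦X⟧) ≠ 0 := fun h => nonZeroDivisors.ne_zero hq (Subtype.ext h)
  have hqE : algebraMap A E q ≠ 0 := by
    rw [Ne, IsFractionRing.to_map_eq_zero_iff]
    exact nonZeroDivisors.ne_zero hq
  have hrel : ∑ i ∈ Finset.range (c.natDegree + 1),
      algebraMap k[X] A (c.coeff i) * p ^ i * q ^ (c.natDegree - i) = 0 := by
    apply IsFractionRing.injective A E
    rw [map_zero, map_sum]
    rw [Polynomial.aeval_eq_sum_range] at hc
    have h1 := congrArg (fun y => algebraMap A E q ^ c.natDegree * y) hc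
    simp only [mul_zero, Finset.mul_sum] at h1
    rw [← h1]
    refine Finset.sum_congr rfl fun i hi => ?_
    have hi' : i ≤ c.natDegree := Nat.lt_succ_iff.1 (Finset.mem_range.1 hi)
    rw [map_mul, map_mul, map_pow, map_pow, ← IsScalarTower.algebraMap_apply, Algebra.smul_def,
      div_pow]
    have h2 : algebraMap A E q ^ c.natDegree =
        algebraMap A E q ^ i * algebraMap A E q ^ (c.natDegree - i) := by
      rw [← pow_add, Nat.add_sub_cancel' hi']
    rw [h2]
    field_simp
  have hrel' := congrArg (Subalgebra.val A) hrel
  obtain ⟨u, w, hu, huw⟩ := algebraic_rational (hent p p.2) (hent q q.2) hq0 (m := c.natDegree)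
    (fun i => c.coeff i) (by simpa using hc0) (by
      rw [map_sum, map_zero] at hrel'
      rw [← hrel']
      refine Finset.sum_congr rfl fun i _ => ?_
      rw [map_mul, map_mul, map_pow, map_pow, AlgHom.commutes, algebraMap_ps]
      rfl)
  have huw' : algebraMap k[X] A u * p = algebraMap k[X] A w * q := by
    apply Subtype.ext
    have h1 : ∀ r : k[X], ((algebraMap k[X] A r : A) : k⟦X⟧) = r := fun r => algebraMap_ps r
    simpa [h1] using huw
  have huE : algebraMap k[X] F u ≠ 0 := by
    rwa [Ne, IsFractionRing.to_map_eq_zero_iff]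
  refine ⟨algebraMap k[X] F w / algebraMap k[X] F u, ?_⟩
  have h3 := congrArg (algebraMap A E) huw'
  rw [map_mul, map_mul, ← IsScalarTower.algebraMap_apply, ← IsScalarTower.algebraMap_apply] at h3
  rw [map_div₀, ← IsScalarTower.algebraMap_apply, ← IsScalarTower.algebraMap_apply]
  have huE' : algebraMap k[X] E u ≠ 0 := by
    rw [IsScalarTower.algebraMap_apply k[X] F E]
    simpa using huE
  rw [div_eq_div_iff huE' hqE, ← h3, mul_comm]

theorem exists_basis {M : Submodule k[X] k⟦X⟧} (hM : M.FG) :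
    ∃ (n : ℕ) (b : Fin n → k⟦X⟧), LinearIndependent k[X] b ∧ (∀ i, b i ∈ M) ∧
      ∀ f ∈ M, ∃ P : Fin n → k[X], f = ∑ i, (P i : k⟦X⟧) * b i := by
  have : Module.Finite k[X] M := Module.Finite.iff_fg.2 hM
  have := torsionFree_ps (k := k)
  have b := Module.finBasis k[X] M
  refine ⟨_, fun i => (b i : k⟦X⟧),
    b.linearIndependent.map' M.subtype M.ker_subtype, fun i => (b i).2, fun f hf => ?_⟩
  refine ⟨fun i => b.repr ⟨f, hf⟩ i, ?_⟩
  have h := congrArg M.subtype (b.sum_repr ⟨f, hf⟩)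
  rw [map_sum] at h
  simp only [map_smul, smul_ps] at h
  exact h.symm

theorem coords_unique {n : ℕ} {b : Fin n → k⟦X⟧} (hb : LinearIndependent k[X] b)
    {P Q : Fin n → k[X]} (h : ∑ i, (P i : k⟦X⟧) * b i = ∑ i, (Q i : k⟦X⟧) * b i) : P = Q := by
  funext i
  have := Fintype.linearIndependent_iff.1 hb (fun i => P i - Q i) (by
    simp only [smul_ps, Polynomial.coe_sub, sub_mul, Finset.sum_sub_distrib, h, sub_self]) i
  exact sub_eq_zero.1 this

theorem taylor_derivative (α : k) (p : k[X]) :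
    Polynomial.taylor α (Polynomial.derivative p) =
      Polynomial.derivative (Polynomial.taylor α p) := by
  rw [Polynomial.taylor_apply, Polynomial.taylor_apply, Polynomial.derivative_comp]
  simp

/-- The embedding of `k(z)` into the field of Laurent series at `α`. -/
def taylorFrac (α : k) : FractionRing k[X] →+* FractionRing k⟦X⟧ :=
  IsFractionRing.lift (A := k[X])
    (g := ((algebraMap k⟦X⟧ (FractionRing k⟦X⟧)).comp Polynomial.coeToPowerSeries.ringHom).comp
      (Polynomial.taylorAlgHom α).toRingHom)
    ((IsFractionRing.injective k⟦X⟧ (FractionRing k⟦X⟧)).comp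
      ((Polynomial.coe_injective k).comp (Polynomial.taylor_injective α)))

theorem taylorFrac_algebraMap (α : k) (p : k[X]) :
    taylorFrac α (algebraMap k[X] (FractionRing k[X]) p) =
      algebraMap k⟦X⟧ (FractionRing k⟦X⟧) (Polynomial.taylor α p : k[X]) := by
  rw [taylorFrac, IsFractionRing.lift_algebraMap]
  rfl

theorem exists_smul_of_eval_eq_zero {M : Submodule k[X] k⟦X⟧} {n : ℕ} {b : Fin n → k⟦X⟧}
    (hb : ∀ i, b i ∈ M) {P : Fin n → k[X]} {α : k} (h : ∀ i, (P i).eval α = 0) :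
    ∃ q ∈ M, ∑ i, (P i : k⟦X⟧) * b i = ((Polynomial.X - Polynomial.C α : k[X]) : k⟦X⟧) * q := by
  choose R hR using fun i => Polynomial.dvd_iff_isRoot.2 (h i)
  refine ⟨∑ i, (R i : k⟦X⟧) * b i, Submodule.sum_mem _ fun i _ => ?_, ?_⟩
  · rw [← smul_ps]
    exact M.smul_mem _ (hb i)
  · rw [Finset.mul_sum]
    refine Finset.sum_congr rfl fun i _ => ?_
    rw [hR i, Polynomial.coe_mul, mul_assoc]

theorem linearIndependent_fractionRing {A : Subalgebra k[X] k⟦X⟧} (E F : Type*) [Field E]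
    [Algebra A E] [IsFractionRing A E] [Field F] [Algebra k[X] F] [IsFractionRing k[X] F]
    [Algebra k[X] E] [IsScalarTower k[X] A E] [Algebra F E] [IsScalarTower k[X] F E]
    {n : ℕ} {b : Fin n → k⟦X⟧} (hb : LinearIndependent k[X] b) (hA : ∀ i, b i ∈ A) :
    LinearIndependent F fun i => algebraMap A E ⟨b i, hA i⟩ := by
  rw [← LinearIndependent.iff_fractionRing k[X] F]
  have h1 : LinearIndependent k[X] fun i => (⟨b i, hA i⟩ : A) :=
    LinearIndependent.of_comp A.val.toLinearMap hb
  exact h1.map' (IsScalarTower.toAlgHom k[X] A E).toLinearMap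
    (LinearMap.ker_eq_bot.2 (IsFractionRing.injective A E))

/-- Structure constants of the product of two differential modules satisfy the differential
equation expressing the Leibniz rule. -/
theorem structure_derivative {n n' n'' : ℕ} {T : k[X]} {b : Fin n → k⟦X⟧} {b' : Fin n' → k⟦X⟧}
    {b'' : Fin n'' → k⟦X⟧} (hb'' : LinearIndependent k[X] b'') {B : Matrix (Fin n) (Fin n) k[X]}
    {B' : Matrix (Fin n') (Fin n') k[X]} {B'' : Matrix (Fin n'') (Fin n'') k[X]}
    (hB : IsSol T B b) (hB' : IsSol T B' b') (hB'' : IsSol T B'' b'')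
    {s : Fin n → Fin n' → Fin n'' → k[X]} (hs : ∀ i j, b i * b' j = ∑ l, (s i j l : k⟦X⟧) * b'' l)
    (i : Fin n) (j : Fin n') (l : Fin n'') :
    T * Polynomial.derivative (s i j l) + ∑ m, s i j m * B'' m l =
      ∑ a, B i a * s a j l + ∑ c, B' j c * s i c l := by
  refine congrFun (coords_unique hb'' (P := fun l => T * Polynomial.derivative (s i j l) +
    ∑ m, s i j m * B'' m l) (Q := fun l => ∑ a, B i a * s a j l + ∑ c, B' j c * s i c l) ?_) l
  have h1 : (T : k⟦X⟧) * d⁄dX k (b i * b' j) = ∑ l, ((T * Polynomial.derivative (s i j l) +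
      ∑ m, s i j m * B'' m l : k[X]) : k⟦X⟧) * b'' l := by
    rw [hs, map_sum, Finset.mul_sum]
    have h2 : ∀ l, (T : k⟦X⟧) * d⁄dX k ((s i j l : k⟦X⟧) * b'' l) =
        ((T * Polynomial.derivative (s i j l) : k[X]) : k⟦X⟧) * b'' l +
          ∑ m, (s i j l : k⟦X⟧) * (B'' l m : k⟦X⟧) * b'' m := by
      intro l
      rw [Derivation.leibniz, derivative_coe, Polynomial.coe_mul]
      simp only [smul_eq_mul, mul_assoc]
      rw [← Finset.mul_sum, ← hB'' l]
      ring
    simp_rw [h2]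
    rw [Finset.sum_add_distrib, Finset.sum_comm]
    simp only [Polynomial.coe_add, coe_sum_poly, add_mul, Finset.sum_mul, Polynomial.coe_mul,
      Finset.sum_add_distrib]
  have h3 : (T : k⟦X⟧) * d⁄dX k (b i * b' j) = ∑ l, ((∑ a, B i a * s a j l +
      ∑ c, B' j c * s i c l : k[X]) : k⟦X⟧) * b'' l := by
    have h4 : (T : k⟦X⟧) * d⁄dX k (b i * b' j) =
        ∑ a, (B i a : k⟦X⟧) * (b a * b' j) + ∑ c, (B' j c : k⟦X⟧) * (b i * b' c) := by
      rw [Derivation.leibniz]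
      simp only [smul_eq_mul]
      have e1 : ∑ a, (B i a : k⟦X⟧) * (b a * b' j) = (∑ a, (B i a : k⟦X⟧) * b a) * b' j := by
        rw [Finset.sum_mul]
        exact Finset.sum_congr rfl fun _ _ => by ring
      have e2 : ∑ c, (B' j c : k⟦X⟧) * (b i * b' c) = b i * ∑ c, (B' j c : k⟦X⟧) * b' c := by
        rw [Finset.mul_sum]
        exact Finset.sum_congr rfl fun _ _ => by ring
      rw [e1, e2, ← hB i, ← hB' j]
      ring
    rw [h4]
    simp only [hs, Polynomial.coe_add, coe_sum_poly, add_mul, Finset.sum_mul, Polynomial.coe_mul,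
      Finset.sum_add_distrib, Finset.mul_sum]
    congr 1
    · rw [Finset.sum_comm]
      exact Finset.sum_congr rfl fun _ _ => Finset.sum_congr rfl fun _ _ => by ring
    · rw [Finset.sum_comm]
      exact Finset.sum_congr rfl fun _ _ => Finset.sum_congr rfl fun _ _ => by ring
  exact h1.symm.trans h3

theorem fibre_domain [Algebra k ℂ] {A : Subalgebra k[X] k⟦X⟧}
    (hent : ∀ f ∈ A, IsEntire (PowerSeries.map (algebraMap k ℂ) f)) {T : k[X]} {α : k}
    (hT : T.eval α ≠ 0) {M M' M'' : Submodule k[X] k⟦X⟧} (hM : M.FG) (hM' : M'.FG) (hM'' : M''.FG)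
    (hA : M ≤ Subalgebra.toSubmodule A) (hA' : M' ≤ Subalgebra.toSubmodule A)
    (hA'' : M'' ≤ Subalgebra.toSubmodule A)
    (hD : ∀ f ∈ M, (T : k⟦X⟧) * d⁄dX k f ∈ M) (hD' : ∀ f ∈ M', (T : k⟦X⟧) * d⁄dX k f ∈ M')
    (hD'' : ∀ f ∈ M'', (T : k⟦X⟧) * d⁄dX k f ∈ M'') (hmul : ∀ f ∈ M, ∀ g ∈ M', f * g ∈ M'')
    {p p' q : k⟦X⟧} (hp : p ∈ M) (hp' : p' ∈ M') (hq : q ∈ M'')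
    (h : p * p' = ((Polynomial.X - Polynomial.C α : k[X]) : k⟦X⟧) * q) :
    (∃ q ∈ M, p = ((Polynomial.X - Polynomial.C α : k[X]) : k⟦X⟧) * q) ∨
    (∃ q ∈ M', p' = ((Polynomial.X - Polynomial.C α : k[X]) : k⟦X⟧) * q) := by
  obtain ⟨n, b, hb, hbM, hbc⟩ := exists_basis hM
  obtain ⟨n', b', hb', hbM', hbc'⟩ := exists_basis hM'
  obtain ⟨n'', b'', hb'', hbM'', hbc''⟩ := exists_basis hM''
  choose B hB using fun i => hbc _ (hD _ (hbM i))
  choose B' hB' using fun i => hbc' _ (hD' _ (hbM' i))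
  choose B'' hB'' using fun i => hbc'' _ (hD'' _ (hbM'' i))
  choose s hs using fun i j => hbc'' _ (hmul _ (hbM i) _ (hbM' j))
  obtain ⟨P, hP⟩ := hbc p hp
  obtain ⟨P', hP'⟩ := hbc' p' hp'
  obtain ⟨Q, hQ⟩ := hbc'' q hq
  have hsd := structure_derivative hb'' (B := B) (B' := B') (B'' := B'') hB hB' hB'' hs
  have hcoord : (fun l => ∑ i, ∑ j, s i j l * (P i * P' j)) =
      fun l => (Polynomial.X - Polynomial.C α) * Q l := by
    refine coords_unique hb'' ?_
    have e1 : p * p' = ∑ l, ((∑ i, ∑ j, s i j l * (P i * P' j) : k[X]) : k⟦X⟧) * b'' l := by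
      rw [hP, hP', Finset.sum_mul_sum]
      have e2 : ∀ i j, (P i : k⟦X⟧) * b i * ((P' j : k⟦X⟧) * b' j) =
          ∑ l, ((s i j l * (P i * P' j) : k[X]) : k⟦X⟧) * b'' l := fun i j => by
        rw [mul_mul_mul_comm, hs, Finset.mul_sum]
        refine Finset.sum_congr rfl fun l _ => ?_
        simp only [Polynomial.coe_mul]
        ring
      simp_rw [e2, coe_sum_poly, Finset.sum_mul]
      calc _ = ∑ i, ∑ l, ∑ j, ((s i j l * (P i * P' j) : k[X]) : k⟦X⟧) * b'' l :=
          Finset.sum_congr rfl fun i _ => Finset.sum_comm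
        _ = _ := Finset.sum_comm
    rw [← e1, h, hQ, Finset.mul_sum]
    refine Finset.sum_congr rfl fun l _ => ?_
    rw [Polynomial.coe_mul, mul_assoc]
  set tl : k[X] →ₐ[k] k[X] := Polynomial.taylorAlgHom α with htl
  have htl' : ∀ r, tl r = Polynomial.taylor α r := fun r => rfl
  have hT0 : (tl T).coeff 0 ≠ 0 := by rwa [htl', Polynomial.taylor_coeff_zero]
  obtain ⟨g, hg, hg0⟩ := exists_sol (tl T) (-((Matrix.of B).map tl)ᵀ) hT0 fun i => (P i).eval α
  obtain ⟨g', hg', hg0'⟩ :=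
    exists_sol (tl T) (-((Matrix.of B').map tl)ᵀ) hT0 fun i => (P' i).eval α
  have hsol := IsSol.structure_mul (T := tl T) (B := (Matrix.of B).map tl)
    (B' := (Matrix.of B').map tl) (B'' := (Matrix.of B'').map tl) (s := fun i j l => tl (s i j l))
    (fun i j l => by
      have h1 := congrArg tl (hsd i j l)
      simp only [map_add, map_mul, map_sum] at h1
      rw [htl' (Polynomial.derivative _), taylor_derivative] at h1
      exact h1) hg hg'
  have hzero := hsol.eq_zero hT0 (fun l => by
    have h1 := congrArg (Polynomial.eval α) (congrFun hcoord l)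
    simp only [Polynomial.eval_finsetSum, Polynomial.eval_mul, Polynomial.eval_sub,
      Polynomial.eval_X, Polynomial.eval_C, sub_self, zero_mul] at h1
    rw [← h1]
    simp only [map_sum, map_mul, hg0, hg0', htl', Polynomial.constantCoeff_coe,
      Polynomial.taylor_coeff_zero])
  have hfs : FaithfulSMul k[X] (FractionRing A) := by
    rw [faithfulSMul_iff_algebraMap_injective, IsScalarTower.algebraMap_eq k[X] A]
    refine (IsFractionRing.injective A (FractionRing A)).comp fun r r' hr => ?_
    apply Polynomial.coe_injective k
    rw [← algebraMap_ps, ← algebraMap_ps]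
    exact congrArg Subtype.val hr
  let _ : Algebra (FractionRing k[X]) (FractionRing A) := FractionRing.liftAlgebra k[X] _
  have := FractionRing.isScalarTower_liftAlgebra k[X] (FractionRing A)
  have hch : CharZero (FractionRing k[X]) :=
    charZero_of_injective_algebraMap (IsFractionRing.injective k[X] (FractionRing k[X]))
  have key := eq_zero_or_eq_zero_of_structure_map (F := FractionRing k[X]) (E := FractionRing A)
    (taylorFrac α) (mem_range_of_isIntegral hent _ _)
    _ (linearIndependent_fractionRing (FractionRing A) (FractionRing k[X]) hb fun i => hA (hbM i))
    _ (linearIndependent_fractionRing (FractionRing A) (FractionRing k[X]) hb' fun i => hA' (hbM' i))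
    (fun l => algebraMap A (FractionRing A) ⟨b'' l, hA'' (hbM'' l)⟩)
    (fun i j l => algebraMap k[X] (FractionRing k[X]) (s i j l))
    (fun i j => by
      have h1 : (⟨b i, hA (hbM i)⟩ * ⟨b' j, hA' (hbM' j)⟩ : A) =
          ∑ l, algebraMap k[X] A (s i j l) * ⟨b'' l, hA'' (hbM'' l)⟩ := by
        apply Subtype.ext
        have h2 : ∀ r : k[X], ((algebraMap k[X] A r : A) : k⟦X⟧) = r := fun r => algebraMap_ps r
        simpa [h2] using hs i j
      have h3 := congrArg (algebraMap A (FractionRing A)) h1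
      rw [map_mul, map_sum] at h3
      rw [h3]
      refine Finset.sum_congr rfl fun l _ => ?_
      rw [map_mul, ← IsScalarTower.algebraMap_apply, ← IsScalarTower.algebraMap_apply])
    (fun i => algebraMap k⟦X⟧ (FractionRing k⟦X⟧) (g i))
    (fun i => algebraMap k⟦X⟧ (FractionRing k⟦X⟧) (g' i))
    (fun l => by
      have h1 := congrArg (algebraMap k⟦X⟧ (FractionRing k⟦X⟧)) (congrFun hzero l)
      simp only [map_sum, map_mul, Pi.zero_apply, map_zero] at h1
      simp only [taylorFrac_algebraMap]
      exact h1)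
  refine key.imp (fun hk => ?_) (fun hk => ?_)
  · rw [hP]
    refine exists_smul_of_eval_eq_zero hbM fun i => ?_
    have h1 := (IsFractionRing.to_map_eq_zero_iff (K := FractionRing k⟦X⟧)).1 (congrFun hk i)
    rw [← hg0, h1, map_zero]
  · rw [hP']
    refine exists_smul_of_eval_eq_zero hbM' fun i => ?_
    have h1 := (IsFractionRing.to_map_eq_zero_iff (K := FractionRing k⟦X⟧)).1 (congrFun hk i)
    rw [← hg0', h1, map_zero]

end Fibre

section Reduction
variable {K : Type*} [Field K]

theorem injective_of_algebraicIndependent {D C ι : Type*} [CommRing D] [IsDomain D] [CommRing C]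
    [Algebra K D] [Algebra K C] (ev : D →ₐ[K] C) (y : ι → D)
    (hy : AlgebraicIndependent K (ev ∘ y))
    (hdep : ∀ x, ¬ AlgebraicIndependent K fun o : Option ι => o.elim x y) :
    Function.Injective ev := by
  rw [injective_iff_map_eq_zero]
  intro x hx
  by_contra hx0
  have hyD : AlgebraicIndependent K y := AlgebraicIndependent.of_comp ev hy
  have halg : IsAlgebraic (Algebra.adjoin K (Set.range y)) x := by
    by_contra htr
    exact hdep x ((hyD.option_iff_transcendental x).2 htr)
  obtain ⟨r, hr0, d, hd⟩ := halg.exists_nonzero_dvd (mem_nonZeroDivisors_of_ne_zero hx0)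
  obtain ⟨G, hG⟩ : (r : D) ∈ (MvPolynomial.aeval (R := K) y).range :=
    (Algebra.adjoin_range_eq_range_aeval K y).le r.2
  have h1 : ev (r : D) = 0 := by
    have : (r : D) = x * d := hd
    rw [this, map_mul, hx, zero_mul]
  have hG0 : G = 0 := by
    apply algebraicIndependent_iff.1 hy
    have h2 : MvPolynomial.aeval (ev ∘ y) G = ev (MvPolynomial.aeval y G) :=
      (MvPolynomial.comp_aeval_apply (f := y) ev G).symm
    rw [h2]
    exact (congrArg ev hG).trans h1
  apply hr0
  apply Subtype.ext
  rw [← hG, hG0]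
  simp

theorem not_algebraicIndependent_reduction {A D ι : Type*} [CommRing A] [IsDomain A]
    [Algebra K[X] A] [CommRing D] [Algebra K D] (π : A →+* D) (α : K)
    (hπ : ∀ p : K[X], π (algebraMap K[X] A p) = algebraMap K D (p.eval α))
    (ht : algebraMap K[X] A (Polynomial.X - Polynomial.C α) ≠ 0) (x : ι → A)
    (hx : ¬ AlgebraicIndependent K[X] x) : ¬ AlgebraicIndependent K (π ∘ x) := by
  rw [algebraicIndependent_iff] at hx ⊢
  push Not at hx ⊢
  obtain ⟨G, hG, hG0⟩ := hx
  have hirr : Irreducible (Polynomial.X - Polynomial.C α) := Polynomial.irreducible_X_sub_C α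
  have hnu : ¬ IsUnit (MvPolynomial.C (σ := ι) (Polynomial.X - Polynomial.C α)) := fun h => by
    have := h.map (MvPolynomial.constantCoeff)
    rw [MvPolynomial.constantCoeff_C] at this
    exact hirr.not_isUnit this
  obtain ⟨n, G₁, hG₁, rfl⟩ := WfDvdMonoid.max_power_factor' hG0 hnu
  have hG₁0 : MvPolynomial.aeval x G₁ = 0 := by
    rw [map_mul, map_pow, MvPolynomial.aeval_C] at hG
    exact (mul_eq_zero.1 hG).resolve_left (pow_ne_zero _ ht)
  refine ⟨MvPolynomial.map (Polynomial.evalRingHom α) G₁, ?_, fun h0 => hG₁ ?_⟩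
  · have h1 := congrArg π hG₁0
    rw [map_zero, MvPolynomial.aeval_def, MvPolynomial.hom_eval₂] at h1
    rw [MvPolynomial.aeval_def, MvPolynomial.eval₂_map, ← h1]
    congr 1
    ext p
    · simp [hπ]
    · simp [hπ]
  · rw [MvPolynomial.C_dvd_iff_dvd_coeff]
    intro m
    rw [Polynomial.dvd_iff_isRoot]
    have := congrArg (MvPolynomial.coeff m) h0
    simpa [MvPolynomial.coeff_map] using this

theorem dvd_of_prime_of_eval_eq_zero {A : Type*} [CommRing A] [IsDomain A] [Algebra K[X] A] {τ : ℕ}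
    {C : Type*} [CommRing C] [Algebra K C] (α : K) (ev : A →+* C)
    (hevp : ∀ p : K[X], ev (algebraMap K[X] A p) = algebraMap K C (p.eval α))
    (hprime : Prime (algebraMap K[X] A (Polynomial.X - Polynomial.C α)))
    (hdep : ∀ (x : A) (y : Fin τ → A),
      ¬ AlgebraicIndependent K[X] fun o : Option (Fin τ) => o.elim x y)
    (y : Fin τ → A) (hy : AlgebraicIndependent K (ev ∘ y)) {x : A} (hx : ev x = 0) :
    algebraMap K[X] A (Polynomial.X - Polynomial.C α) ∣ x := by
  set t := algebraMap K[X] A (Polynomial.X - Polynomial.C α) with ht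
  obtain ⟨D, _, _, π, hsurj, hker⟩ : ∃ (D : Type _) (_ : CommRing D) (_ : IsDomain D)
      (π : A →+* D), Function.Surjective π ∧ ∀ a, π a = 0 ↔ t ∣ a := by
    have hI : (Ideal.span {t}).IsPrime := (Ideal.span_singleton_prime hprime.ne_zero).2 hprime
    exact ⟨A ⧸ Ideal.span {t}, inferInstance, inferInstance, Ideal.Quotient.mk _,
      Ideal.Quotient.mk_surjective, fun a => by
        rw [Ideal.Quotient.eq_zero_iff_mem, Ideal.mem_span_singleton]⟩
  let _ : Algebra K D := ((π.comp (algebraMap K[X] A)).comp Polynomial.C).toAlgebra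
  have hπ : ∀ p : K[X], π (algebraMap K[X] A p) = algebraMap K D (p.eval α) := by
    intro p
    change π (algebraMap K[X] A p) = π (algebraMap K[X] A (Polynomial.C (p.eval α)))
    rw [← sub_eq_zero, ← map_sub, ← map_sub, hker]
    exact map_dvd _ Polynomial.X_sub_C_dvd_sub_C_eval
  have hevI : RingHom.ker π ≤ RingHom.ker ev := by
    intro a ha
    obtain ⟨c, rfl⟩ := (hker a).1 ha
    rw [RingHom.mem_ker, map_mul, ht, hevp]
    simp
  let evR : D →+* C := (RingHom.liftOfSurjective π hsurj) ⟨ev, hevI⟩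
  have hevR : ∀ a : A, evR (π a) = ev a := fun a =>
    RingHom.liftOfRightInverse_comp_apply π _ (Function.rightInverse_surjInv hsurj) ⟨ev, hevI⟩ a
  let evD : D →ₐ[K] C :=
    { evR with
      commutes' := fun c => by
        change evR (π (algebraMap K[X] A (Polynomial.C c))) = _
        rw [hevR, hevp, Polynomial.eval_C] }
  have hevD : ∀ a : A, evD (π a) = ev a := hevR
  have hinj := injective_of_algebraicIndependent evD (π ∘ y) (by
    have e1 : evD ∘ (π ∘ y) = ev ∘ y := funext fun i => hevD _
    rw [e1]
    exact hy) (fun z => by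
      obtain ⟨z, rfl⟩ := hsurj z
      have e2 : (fun o : Option (Fin τ) => o.elim (π z) (π ∘ y)) =
          π ∘ fun o : Option (Fin τ) => o.elim z y := by
        funext o
        cases o <;> rfl
      rw [e2]
      exact not_algebraicIndependent_reduction π α hπ hprime.ne_zero _ (hdep z y))
  rw [← hker]
  apply hinj
  rw [hevD, map_zero, hx]

end Reduction

section Lifting
open PowerSeries
variable {K : Type*} [Field K] [NumberField K] [Algebra K ℂ]

theorem isEB_of_mem_adjoin {s : ℕ} {F : Fin s → K⟦X⟧} (hF : ∀ a, IsEB (F a)) {f : K⟦X⟧}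
    (hf : f ∈ Algebra.adjoin K[X] (Set.range F)) : IsEB f := by
  induction hf using Algebra.adjoin_induction with
  | mem x hx => obtain ⟨a, rfl⟩ := hx; exact hF a
  | algebraMap r => rw [algebraMap_ps]; exact isEB_coe r
  | add x y _ _ hx hy => exact hx.add hy
  | mul x y _ _ hx hy => exact hx.mul hy

theorem exists_mem_pow_oneSpan {k A : Type*} [Field k] [CharZero k] {F : A → k⟦X⟧} {f : k⟦X⟧}
    (hf : f ∈ Algebra.adjoin k[X] (Set.range F)) : ∃ e, f ∈ oneSpan F ^ e := by
  have hmono : ∀ {a b : ℕ}, a ≤ b → oneSpan F ^ a ≤ oneSpan F ^ b := fun h =>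
    pow_le_pow_right₀ (Submodule.one_le.2 (one_mem_oneSpan F)) h
  induction hf using Algebra.adjoin_induction with
  | mem x hx => obtain ⟨a, rfl⟩ := hx; exact ⟨1, by rw [pow_one]; exact mem_oneSpan F a⟩
  | algebraMap r => exact ⟨0, by rw [pow_zero]; exact Submodule.algebraMap_mem _⟩
  | add x y _ _ hx hy =>
    obtain ⟨a, ha⟩ := hx
    obtain ⟨b, hb⟩ := hy
    exact ⟨a + b, add_mem (hmono (by omega) ha) (hmono (by omega) hb)⟩
  | mul x y _ _ hx hy =>
    obtain ⟨a, ha⟩ := hx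
    obtain ⟨b, hb⟩ := hy
    exact ⟨a + b, by rw [pow_add]; exact Submodule.mul_mem_mul ha hb⟩

theorem pow_oneSpan_le_adjoin {k A : Type*} [Field k] [CharZero k] (F : A → k⟦X⟧) (e : ℕ) :
    oneSpan F ^ e ≤ Subalgebra.toSubmodule (Algebra.adjoin k[X] (Set.range F)) := by
  have h1 : oneSpan F ≤ Subalgebra.toSubmodule (Algebra.adjoin k[X] (Set.range F)) := by
    refine Submodule.span_le.2 (Set.insert_subset
      (one_mem (Algebra.adjoin k[X] (Set.range F))) ?_)
    exact Algebra.subset_adjoin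
  induction e with
  | zero =>
    rw [pow_zero]
    exact Submodule.one_le.2 (one_mem (Algebra.adjoin k[X] (Set.range F)))
  | succ e ih =>
    rw [pow_succ]
    exact Submodule.mul_le.2 fun x hx y hy =>
      mul_mem (S := Subalgebra k[X] k⟦X⟧) (ih hx) (h1 hy)

/-- The fibre at `α` of the algebra generated by a differential system is a domain. -/
theorem fibre_domain_adjoin {k : Type*} [Field k] [CharZero k] [Algebra k ℂ] {A : Type*} [Finite A]
    {F : A → k⟦X⟧}
    (hent : ∀ f ∈ Algebra.adjoin k[X] (Set.range F), IsEntire (PowerSeries.map (algebraMap k ℂ) f))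
    {T : k[X]} {α : k} (hT : T.eval α ≠ 0)
    (hst : ∀ a, (T : k⟦X⟧) * d⁄dX k (F a) ∈ oneSpan F) {p p' q : k⟦X⟧}
    (hp : p ∈ Algebra.adjoin k[X] (Set.range F)) (hp' : p' ∈ Algebra.adjoin k[X] (Set.range F))
    (hq : q ∈ Algebra.adjoin k[X] (Set.range F))
    (h : p * p' = ((Polynomial.X - Polynomial.C α : k[X]) : k⟦X⟧) * q) :
    (∃ q ∈ Algebra.adjoin k[X] (Set.range F),
      p = ((Polynomial.X - Polynomial.C α : k[X]) : k⟦X⟧) * q) ∨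
    (∃ q ∈ Algebra.adjoin k[X] (Set.range F),
      p' = ((Polynomial.X - Polynomial.C α : k[X]) : k⟦X⟧) * q) := by
  obtain ⟨a, ha⟩ := exists_mem_pow_oneSpan hp
  obtain ⟨b, hb⟩ := exists_mem_pow_oneSpan hp'
  obtain ⟨c, hc⟩ := exists_mem_pow_oneSpan hq
  have hmono : ∀ {a b : ℕ}, a ≤ b → oneSpan F ^ a ≤ oneSpan F ^ b := fun h =>
    pow_le_pow_right₀ (Submodule.one_le.2 (one_mem_oneSpan F)) h
  have hfg : ∀ e, (oneSpan F ^ e).FG := fun e => (fg_oneSpan F).pow e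
  have hD : ∀ e, ∀ f ∈ oneSpan F ^ e, (T : k⟦X⟧) * d⁄dX k f ∈ oneSpan F ^ e := fun e f hf =>
    derivative_mem_pow (fun f hf => derivative_mem_oneSpan hst hf) hf
  refine (fibre_domain hent hT (hfg a) (hfg b) (hfg (a + b + c)) (pow_oneSpan_le_adjoin F a)
    (pow_oneSpan_le_adjoin F b) (pow_oneSpan_le_adjoin F _) (hD a) (hD b) (hD _)
    (fun f hf g hg => hmono (Nat.le_add_right (a + b) c)
      (by rw [pow_add]; exact Submodule.mul_mem_mul hf hg))
    ha hb (hmono (by omega) hc) h).imp ?_ ?_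
  · rintro ⟨q, hq, rfl⟩
    exact ⟨q, pow_oneSpan_le_adjoin F _ hq, rfl⟩
  · rintro ⟨q, hq, rfl⟩
    exact ⟨q, pow_oneSpan_le_adjoin F _ hq, rfl⟩

theorem faithfulSMul_subalgebra {k : Type*} [Field k] [CharZero k] (A : Subalgebra k[X] k⟦X⟧) :
    FaithfulSMul k[X] A := by
  rw [faithfulSMul_iff_algebraMap_injective]
  intro r r' hr
  apply Polynomial.coe_injective k
  have h1 : ∀ r : k[X], ((algebraMap k[X] A r : A) : k⟦X⟧) = r := fun r => algebraMap_ps r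
  rw [← h1, ← h1, hr]

theorem exists_transcendence_family {k : Type*} [Field k] [CharZero k] {s : ℕ} (F : Fin s → k⟦X⟧) :
    ∃ (τ : ℕ) (J : Fin τ → Fin s), AlgebraicIndependent k[X] (F ∘ J) ∧
      ∀ (x : Algebra.adjoin k[X] (Set.range F)) (y : Fin τ → Algebra.adjoin k[X] (Set.range F)),
        ¬ AlgebraicIndependent k[X] fun o : Option (Fin τ) => o.elim x y := by
  classical
  set A := Algebra.adjoin k[X] (Set.range F) with hA
  have hfs := faithfulSMul_subalgebra A
  set S : Set A := (↑) ⁻¹' Set.range F with hS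
  have hSfin : S.Finite := (Set.finite_range F).preimage Subtype.val_injective.injOn
  have htop : Algebra.adjoin k[X] S = ⊤ := Algebra.adjoin_adjoin_coe_preimage
  have halg : Algebra.IsAlgebraic (Algebra.adjoin k[X] S) A := ⟨fun x =>
    isAlgebraic_algebraMap (⟨x, by rw [htop]; trivial⟩ : Algebra.adjoin k[X] S)⟩
  obtain ⟨t, htS, ht⟩ := exists_isTranscendenceBasis_subset (R := k[X]) S
  have : Fintype t := (hSfin.subset htS).fintype
  let e := Fintype.equivFin t
  choose J hJ using fun i : Fin (Fintype.card t) => htS (e.symm i).2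
  refine ⟨Fintype.card t, J, ?_, fun x y hxy => ?_⟩
  · have h1 : AlgebraicIndependent k[X] fun i => A.val ((e.symm i : t) : A) :=
      (ht.1.comp e.symm e.symm.injective).map' (f := A.val) Subtype.val_injective
    have h2 : F ∘ J = fun i => A.val ((e.symm i : t) : A) := funext hJ
    rw [h2]
    exact h1
  · have h1 := hxy.lift_cardinalMk_le_trdeg
    rw [← ht.cardinalMk_eq_trdeg, Cardinal.mk_fintype, Cardinal.mk_fintype] at h1
    simp only [Cardinal.lift_natCast, Nat.cast_le, Fintype.card_option, Fintype.card_fin] at h1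
    have h2 : Fintype.card {x // x ∈ t} = Fintype.card ↑t := Fintype.card_congr (Equiv.refl _)
    omega

/-- An element of the algebra generated by a differential system of `E`-functions which vanishes
at the regular point `1` is divisible by `z - 1` in this algebra. -/
theorem exists_eq_mul_of_evEB_eq_zero {s : ℕ} {F : Fin s → K⟦X⟧} (hF : ∀ a, IsEB (F a)) {Q : K[X]}
    (hQ : Q.eval 1 ≠ 0) (hst : ∀ a, (Q : K⟦X⟧) * d⁄dX K (F a) ∈ oneSpan F) {x : K⟦X⟧}
    (hx : x ∈ Algebra.adjoin K[X] (Set.range F))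
    (h0 : evEB K ⟨x, isEB_of_mem_adjoin hF hx⟩ = 0) :
    ∃ q ∈ Algebra.adjoin K[X] (Set.range F),
      x = ((Polynomial.X - Polynomial.C 1 : K[X]) : K⟦X⟧) * q := by
  obtain ⟨τ, J, hJ, hdep⟩ := exists_transcendence_family F
  obtain ⟨v, hv, hvmem⟩ := trdeg_values F hF Q hQ hst J hJ
  set A := Algebra.adjoin K[X] (Set.range F) with hA
  have hcoe : ∀ r : K[X], ((algebraMap K[X] A r : A) : K⟦X⟧) = r := fun r => algebraMap_ps r
  set t : A := algebraMap K[X] A (Polynomial.X - Polynomial.C 1) with ht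
  have hfs := faithfulSMul_subalgebra A
  have ht0 : t ≠ 0 := by
    rw [ht, Ne, FaithfulSMul.algebraMap_eq_zero_iff]
    exact Polynomial.X_sub_C_ne_zero 1
  let ev : A →+* ℂ := (evEB K).toRingHom.comp
    ((A.val.toRingHom).codRestrict (ebSub K) fun f => isEB_of_mem_adjoin hF f.2)
  have hev : ∀ f : A, ev f = evEB K ⟨f.1, isEB_of_mem_adjoin hF f.2⟩ := fun f => rfl
  have hevp : ∀ p : K[X], ev (algebraMap K[X] A p) = algebraMap K ℂ (p.eval 1) := by
    intro p
    rw [hev, evEB_apply]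
    have e1 : (⟨PowerSeries.map (algebraMap K ℂ) (algebraMap K[X] A p : A).1,
        IsEB.isEntire (isEB_of_mem_adjoin hF (algebraMap K[X] A p).2) _⟩ : entire) =
        ⟨((p.map (algebraMap K ℂ) : Polynomial ℂ) : ℂ⟦X⟧), isEntire_coe _⟩ := by
      apply Subtype.ext
      change PowerSeries.map (algebraMap K ℂ) (algebraMap K[X] A p : A).1 =
        ((p.map (algebraMap K ℂ) : Polynomial ℂ) : ℂ⟦X⟧)
      rw [hcoe, Polynomial.polynomial_map_coe]
    rw [e1, evalEntire_coe, Polynomial.eval_map, Polynomial.eval₂_at_one]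
  have hprime : Prime t := by
    refine ⟨ht0, fun hu => ?_, fun p p' hpp => ?_⟩
    · have := hu.map ev
      rw [ht, hevp] at this
      simp at this
    · obtain ⟨q, hq⟩ := hpp
      have hq' := congrArg Subtype.val hq
      change (p : K⟦X⟧) * p' = t.1 * q.1 at hq'
      rw [ht, hcoe] at hq'
      refine (fibre_domain_adjoin (fun f hf => IsEB.isEntire (isEB_of_mem_adjoin hF hf) _) hQ hst
        p.2 p'.2 q.2 hq').imp ?_ ?_
      · rintro ⟨q, hq, h⟩
        exact ⟨⟨q, hq⟩, Subtype.ext (by rw [h]; change _ = t.1 * q; rw [ht, hcoe])⟩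
      · rintro ⟨q, hq, h⟩
        exact ⟨⟨q, hq⟩, Subtype.ext (by rw [h]; change _ = t.1 * q; rw [ht, hcoe])⟩
  have hlift : ∀ c ∈ Algebra.adjoin K (Set.range fun a => evEB K ⟨F a, hF a⟩), ∃ a : A, ev a = c := by
    intro c hc
    induction hc using Algebra.adjoin_induction with
    | mem c hc =>
      obtain ⟨a, rfl⟩ := hc
      exact ⟨⟨F a, Algebra.subset_adjoin ⟨a, rfl⟩⟩, rfl⟩
    | algebraMap r => exact ⟨algebraMap K[X] A (Polynomial.C r), by rw [hevp, Polynomial.eval_C]⟩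
    | add x y _ _ hx hy =>
      obtain ⟨a, rfl⟩ := hx
      obtain ⟨b, rfl⟩ := hy
      exact ⟨a + b, map_add _ _ _⟩
    | mul x y _ _ hx hy =>
      obtain ⟨a, rfl⟩ := hx
      obtain ⟨b, rfl⟩ := hy
      exact ⟨a * b, map_mul _ _ _⟩
  choose y hy using fun i => hlift (v i) (hvmem i)
  obtain ⟨q, hq⟩ := dvd_of_prime_of_eval_eq_zero 1 ev hevp hprime hdep y (by
    have e1 : ev ∘ y = v := funext hy
    rw [e1]
    exact hv) (x := ⟨x, hx⟩) h0
  refine ⟨q.1, q.2, ?_⟩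
  have h1 := congrArg Subtype.val hq
  change x = t.1 * q.1 at h1
  rwa [ht, hcoe] at h1

end Lifting

section Descent

/-- An algebra of finite type over a domain `R` has, up to denominators which are powers of a
single element, a retraction onto `R`. -/
theorem exists_retraction {R S : Type*} [CommRing R] [IsDomain R] [CharZero R] [CommRing S]
    [Algebra R S] [FaithfulSMul R S] [Algebra.FiniteType R S] :
    ∃ c : R, c ≠ 0 ∧ ∃ l : S →ₗ[R] FractionRing R, l 1 = 1 ∧
      ∀ s, ∃ (n : ℕ) (x : R), algebraMap R (FractionRing R) (c ^ n) * l s = algebraMap R _ x := by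
  classical
  let E := FractionRing R
  let Ω := AlgebraicClosure E
  have hnt : Nontrivial (TensorProduct R E S) := by
    have hfl : Module.Flat R E := IsLocalization.flat E (nonZeroDivisors R)
    exact (Algebra.TensorProduct.includeLeft_injective (S := R) (A := E) (B := S)
      (FaithfulSMul.algebraMap_injective R S)).nontrivial
  obtain ⟨ψ, hψ⟩ := exists_algHom_isIntegral (F := E) (Ω := Ω) (TensorProduct R E S)
  obtain ⟨l₀, hl₀⟩ := LinearMap.exists_leftInverse_of_injective (Algebra.linearMap E Ω)
    (LinearMap.ker_eq_bot.2 (algebraMap E Ω).injective)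
  let g : S →ₐ[R] Ω := (ψ.restrictScalars R).comp Algebra.TensorProduct.includeRight
  obtain ⟨G, hG⟩ := (Algebra.FiniteType.out : (⊤ : Subalgebra R S).FG)
  have halg : ∀ s : S, ∃ b : R, b ≠ 0 ∧ IsIntegral R (b • g s) := by
    intro s
    have h1 : IsAlgebraic E (g s) := (hψ _).isAlgebraic
    have h2 : IsAlgebraic R (g s) := (IsFractionRing.isAlgebraic_iff R E Ω).2 h1
    exact h2.exists_integral_multiple
  choose b hb0 hb using halg
  set B : R := ∏ s ∈ G, b s with hB
  have hB0 : B ≠ 0 := Finset.prod_ne_zero_iff.2 fun s _ => hb0 s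
  have hBint : ∀ s ∈ G, IsIntegral R (B • g s) := by
    intro s hs
    rw [hB, ← Finset.prod_erase_mul _ _ hs, mul_smul]
    exact (hb s).smul _
  set N : Subalgebra R Ω := Algebra.adjoin R ((fun s => B • g s) '' (G : Set S)) with hN
  have hNfg : (Subalgebra.toSubmodule N).FG := by
    refine fg_adjoin_of_finite (G.finite_toSet.image _) ?_
    rintro _ ⟨s, hs, rfl⟩
    exact hBint s hs
  let l₁ : Ω →ₗ[R] E := l₀.restrictScalars R
  obtain ⟨H, hH⟩ := hNfg.map l₁
  obtain ⟨c₂, hc₂⟩ := IsLocalization.exist_integer_multiples_of_finset (nonZeroDivisors R) H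
  have hlN : ∀ w ∈ N, ∃ x : R, algebraMap R E c₂ * l₁ w = algebraMap R E x := by
    intro w hw
    have h1 : l₁ w ∈ Submodule.span R (H : Set E) := by
      rw [hH]
      exact ⟨w, hw, rfl⟩
    generalize l₁ w = e at h1
    induction h1 using Submodule.span_induction with
    | mem x hx =>
      obtain ⟨y, hy⟩ := hc₂ x hx
      exact ⟨y, by rw [hy, Algebra.smul_def]⟩
    | zero => exact ⟨0, by simp⟩
    | add x y _ _ hx hy =>
      obtain ⟨u, hu⟩ := hx
      obtain ⟨v, hv⟩ := hy
      exact ⟨u + v, by rw [mul_add, hu, hv, map_add]⟩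
    | smul a x _ hx =>
      obtain ⟨u, hu⟩ := hx
      exact ⟨a * u, by rw [map_mul, ← hu, Algebra.smul_def]; ring⟩
  have hpow : ∀ s : S, ∃ n : ℕ, B ^ n • g s ∈ N := by
    intro s
    have hs : s ∈ Algebra.adjoin R (G : Set S) := by rw [hG]; trivial
    induction hs using Algebra.adjoin_induction with
    | mem x hx => exact ⟨1, by rw [pow_one]; exact Algebra.subset_adjoin ⟨x, hx, rfl⟩⟩
    | algebraMap r => exact ⟨0, by rw [pow_zero, one_smul, AlgHom.commutes]; exact N.algebraMap_mem r⟩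
    | add x y _ _ hx hy =>
      obtain ⟨m, hm⟩ := hx
      obtain ⟨n, hn⟩ := hy
      refine ⟨m + n, ?_⟩
      have e1 : B ^ (m + n) • g (x + y) = B ^ n • (B ^ m • g x) + B ^ m • (B ^ n • g y) := by
        rw [map_add, smul_add, smul_smul, smul_smul, pow_add, mul_comm (B ^ n)]
      rw [e1]
      exact add_mem (N.smul_mem hm _) (N.smul_mem hn _)
    | mul x y _ _ hx hy =>
      obtain ⟨m, hm⟩ := hx
      obtain ⟨n, hn⟩ := hy
      refine ⟨m + n, ?_⟩
      rw [map_mul, pow_add, ← smul_mul_smul_comm]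
      exact mul_mem hm hn
  refine ⟨B * c₂, mul_ne_zero hB0 (nonZeroDivisors.ne_zero c₂.2), l₁.comp g.toLinearMap, ?_, ?_⟩
  · have := LinearMap.congr_fun hl₀ 1
    simpa [l₁] using this
  · intro s
    obtain ⟨n, hn⟩ := hpow s
    obtain ⟨x, hx⟩ := hlN _ hn
    refine ⟨n + 1, B * (c₂ : R) ^ n * x, ?_⟩
    rw [map_mul _ _ x, ← hx, map_smul, Algebra.smul_def]
    change _ * l₁ (g s) = _
    simp only [map_mul, map_pow]
    ring

theorem exists_pow_mul_mem {R S : Type*} [CommRing R] [IsDomain R] [CharZero R] [CommRing S]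
    [Algebra R S] [FaithfulSMul R S] [Algebra.FiniteType R S] :
    ∃ c : R, c ≠ 0 ∧ ∀ x t : R, algebraMap R S t ∣ algebraMap R S x → ∃ n : ℕ, t ∣ c ^ n * x := by
  obtain ⟨c, hc, l, hl1, hl⟩ := exists_retraction (R := R) (S := S)
  refine ⟨c, hc, fun x t ⟨s, hs⟩ => ?_⟩
  obtain ⟨n, y, hy⟩ := hl s
  refine ⟨n, y, IsFractionRing.injective R (FractionRing R) ?_⟩
  have h1 : l (algebraMap R S x) = algebraMap R (FractionRing R) x := by
    rw [Algebra.algebraMap_eq_smul_one, map_smul, hl1, Algebra.algebraMap_eq_smul_one]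
  have h2 : l (algebraMap R S t * s) = algebraMap R (FractionRing R) t * l s := by
    rw [← Algebra.smul_def, map_smul, Algebra.smul_def]
  rw [map_mul, map_mul _ t, ← h1, hs, h2, ← hy]
  ring

theorem dvd_of_dvd_pow_mul {R : Type*} [CommRing R] [IsDomain R] {c t : R} (hc : c ≠ 0)
    (h : ∀ y, c ∣ t * y → c ∣ y) {n : ℕ} {x : R} (hx : t ∣ c ^ n * x) : t ∣ x := by
  induction n with
  | zero => simpa using hx
  | succ n ih =>
    obtain ⟨y, hy⟩ := hx
    obtain ⟨y', rfl⟩ := h y ⟨c ^ n * x, by rw [← hy]; ring⟩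
    refine ih ⟨y', mul_left_cancel₀ hc ?_⟩
    rw [← mul_assoc, ← pow_succ', hy]
    ring

theorem finite_zeroDivisor {k R : Type*} [Field k] [CommRing R] [IsNoetherianRing R]
    [Algebra k[X] R] (c : R) :
    {α : k | ∃ y, c ∣ algebraMap k[X] R (Polynomial.X - Polynomial.C α) * y ∧ ¬ c ∣ y}.Finite := by
  set M := R ⧸ Ideal.span {c}
  set t : k → R := fun α => algebraMap k[X] R (Polynomial.X - Polynomial.C α) with ht
  have hfin := associatedPrimes.finite R M
  refine Set.Finite.subset (s := ⋃ I ∈ associatedPrimes R M, {α | t α ∈ I})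
    (hfin.biUnion fun I hI => ?_) ?_
  · refine Set.Subsingleton.finite fun α hα β hβ => ?_
    by_contra hne
    have hp : I.IsPrime := hI.isPrime
    apply hp.ne_top
    have h1 : t α - t β = algebraMap k[X] R (Polynomial.C (β - α)) := by
      rw [ht, ← map_sub]
      congr 1
      rw [Polynomial.C_sub]
      ring
    have h2 : IsUnit (t α - t β) := by
      rw [h1]
      refine IsUnit.map _ (Polynomial.isUnit_C.2 (IsUnit.mk0 _ (sub_ne_zero.2 (Ne.symm hne))))
    exact Ideal.eq_top_of_isUnit_mem I (I.sub_mem hα hβ) h2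
  · rintro α ⟨y, hy, hcy⟩
    have h1 : t α ∈ ⋃ p ∈ associatedPrimes R M, (p : Set R) := by
      rw [biUnion_associatedPrimes_eq_zero_divisors R M]
      refine ⟨Ideal.Quotient.mk _ y, ?_, ?_⟩
      · rwa [Ne, Ideal.Quotient.eq_zero_iff_mem, Ideal.mem_span_singleton]
      · change Ideal.Quotient.mk _ (t α * y) = 0
        rwa [Ideal.Quotient.eq_zero_iff_mem, Ideal.mem_span_singleton]
    simpa using h1

theorem coeff_aeval_C_mul_X {ι A B : Type*} [CommRing A] [CommRing B] [Algebra A B] (f : ι → B)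
    (Q : MvPolynomial ι A) (n : ℕ) :
    (MvPolynomial.aeval (fun i => Polynomial.C (f i) * Polynomial.X) Q : Polynomial B).coeff n =
      MvPolynomial.aeval f (MvPolynomial.homogeneousComponent n Q) := by
  classical
  induction Q using MvPolynomial.induction_on' with
  | add p q hp hq => simp only [map_add, Polynomial.coeff_add, hp, hq]
  | monomial m a =>
    have h1 : MvPolynomial.homogeneousComponent n (MvPolynomial.monomial m a) =
        if m.degree = n then MvPolynomial.monomial m a else 0 := by
      ext v
      rw [MvPolynomial.coeff_homogeneousComponent]
      split_ifs with h2 h3 h3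
      · rfl
      · rw [MvPolynomial.coeff_monomial, if_neg, MvPolynomial.coeff_zero]
        rintro rfl
        exact h3 h2
      · rw [MvPolynomial.coeff_monomial, if_neg]
        rintro rfl
        exact h2 h3
      · rfl
    have h2 : (m.prod fun i e => (Polynomial.C (f i) * Polynomial.X) ^ e : Polynomial B) =
        Polynomial.C (m.prod fun i e => f i ^ e) * Polynomial.X ^ m.degree := by
      simp only [mul_pow, Finsupp.prod, Finset.prod_mul_distrib, map_prod, map_pow,
        Finsupp.degree_apply, Finset.prod_pow_eq_pow_sum]
    rw [h1, MvPolynomial.aeval_monomial, h2, Polynomial.algebraMap_apply, ← mul_assoc,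
      ← Polynomial.C_mul, Polynomial.coeff_C_mul_X_pow]
    by_cases h3 : n = m.degree
    · rw [if_pos h3, if_pos h3.symm, MvPolynomial.aeval_monomial]
    · rw [if_neg h3, if_neg (Ne.symm h3), map_zero]

/-- Outside a finite set of points, a homogeneous form in the `f i` which is divisible by `z - α`
in a given algebra of finite type is banal. -/
theorem exists_finite_banal {k A : Type*} [Field k] [CharZero k] [CommRing A] [IsDomain A]
    [Algebra k[X] A] [FaithfulSMul k[X] A] [Algebra.FiniteType k[X] A] {r : ℕ} (f : Fin r → A) :
    ∃ S : Set k, S.Finite ∧ ∀ α ∉ S, ∀ (P : MvPolynomial (Fin r) k) (d : ℕ), P.IsHomogeneous d →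
      algebraMap k[X] A (Polynomial.X - Polynomial.C α) ∣
        MvPolynomial.aeval f (MvPolynomial.map Polynomial.C P) →
      ∃ Q : MvPolynomial (Fin r) k[X], Q.IsHomogeneous d ∧ MvPolynomial.aeval f Q = 0 ∧
        MvPolynomial.map (Polynomial.evalRingHom α) Q = P := by
  let Φ : MvPolynomial (Fin r) k[X] →ₐ[k[X]] Polynomial A :=
    MvPolynomial.aeval fun i => Polynomial.C (f i) * Polynomial.X
  let R := Φ.range
  have : CharZero A := charZero_of_injective_algebraMap (FaithfulSMul.algebraMap_injective k[X] A)
  have : CharZero R := ⟨fun m n h => by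
    have h1 := congrArg (algebraMap R (Polynomial A)) h
    rw [map_natCast, map_natCast] at h1
    exact Nat.cast_injective h1⟩
  have : IsNoetherianRing R := isNoetherianRing_of_surjective _ _ Φ.rangeRestrict.toRingHom
    Φ.rangeRestrict_surjective
  have : Algebra.FiniteType k[X] (Polynomial A) := Algebra.FiniteType.trans (S := A) inferInstance
    inferInstance
  have : Algebra.FiniteType R (Polynomial A) :=
    Algebra.FiniteType.of_restrictScalars_finiteType k[X] R (Polynomial A)
  obtain ⟨c, hc, hcR⟩ := exists_pow_mul_mem (R := R) (S := Polynomial A)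
  refine ⟨_, finite_zeroDivisor (k := k) c, fun α hα P d hP hdvd => ?_⟩
  set t : k[X] := Polynomial.X - Polynomial.C α with ht
  set P' : MvPolynomial (Fin r) k[X] := MvPolynomial.map Polynomial.C P with hP'
  have hP'd : P'.IsHomogeneous d := hP.map _
  have hcoeff : ∀ n Q, (Φ Q).coeff n = MvPolynomial.aeval f (MvPolynomial.homogeneousComponent n Q) :=
    fun n Q => coeff_aeval_C_mul_X f Q n
  have h1 : algebraMap R (Polynomial A) (algebraMap k[X] R t) ∣
      algebraMap R (Polynomial A) (Φ.rangeRestrict P') := by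
    change algebraMap k[X] (Polynomial A) t ∣ Φ P'
    rw [Polynomial.algebraMap_apply, Polynomial.C_dvd_iff_dvd_coeff]
    intro n
    rw [hcoeff]
    by_cases hn : n = d
    · rw [hn, MvPolynomial.homogeneousComponent_of_mem hP'd, if_pos rfl]
      exact hdvd
    · rw [MvPolynomial.homogeneousComponent_of_mem hP'd, if_neg hn, map_zero]
      exact dvd_zero _
  obtain ⟨n, hn⟩ := hcR _ _ h1
  obtain ⟨⟨_, Q₁, rfl⟩, hQ₁⟩ := dvd_of_dvd_pow_mul hc (fun y hy => by
    by_contra hcy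
    exact hα ⟨y, hy, hcy⟩) hn
  have h2 : Φ P' = Φ (MvPolynomial.C t * Q₁) := by
    have := congrArg (algebraMap R (Polynomial A)) hQ₁
    rw [map_mul _ (MvPolynomial.C t), ← MvPolynomial.algebraMap_eq, AlgHom.commutes]
    exact this
  refine ⟨P' - MvPolynomial.C t * MvPolynomial.homogeneousComponent d Q₁, ?_, ?_, ?_⟩
  · refine hP'd.sub ?_
    have := (MvPolynomial.isHomogeneous_C (Fin r) t).mul
      (MvPolynomial.homogeneousComponent_isHomogeneous d Q₁)
    rwa [zero_add] at this
  · have h3 := congrArg (fun p => Polynomial.coeff p d) h2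
    simp only [hcoeff, MvPolynomial.homogeneousComponent_C_mul] at h3
    rw [MvPolynomial.homogeneousComponent_of_mem hP'd, if_pos rfl] at h3
    rw [map_sub, h3, sub_self]
  · rw [map_sub, map_mul, MvPolynomial.map_C, hP', MvPolynomial.map_map]
    have h4 : (Polynomial.evalRingHom α).comp Polynomial.C = RingHom.id k := by
      ext; simp
    rw [h4, MvPolynomial.map_id]
    simp [ht]

end Descent

section Recurrence
open PowerSeries
variable {k : Type*} [Field k] [CharZero k]

theorem exists_sum_descFactorial_ne_zero {m : ℕ} {c : ℕ → k} (hc : ∃ i ≤ m, c i ≠ 0) :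
    ∃ N : ℕ, ∀ M > N, ∑ i ∈ Finset.range (m + 1), c i * (M.descFactorial i : k) ≠ 0 := by
  set χ : k[X] := ∑ i ∈ Finset.range (m + 1), Polynomial.C (c i) * descPochhammer k i with hχ
  have heval : ∀ M : ℕ, χ.eval (M : k) =
      ∑ i ∈ Finset.range (m + 1), c i * (M.descFactorial i : k) := by
    intro M
    rw [hχ, Polynomial.eval_finsetSum]
    simp [descPochhammer_eval_eq_descFactorial]
  have hχ0 : χ ≠ 0 := by
    intro h0
    have hz : ∀ i ≤ m, c i = 0 := by
      intro i
      induction i using Nat.strong_induction_on with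
      | _ i ih =>
        intro hi
        have h1 := heval i
        rw [h0, Polynomial.eval_zero, Finset.sum_eq_single i] at h1
        · have h2 : ((i.descFactorial i : ℕ) : k) ≠ 0 := by
            rw [Nat.descFactorial_self]
            exact Nat.cast_ne_zero.2 (Nat.factorial_ne_zero i)
          exact (mul_eq_zero.1 h1.symm).resolve_right h2
        · intro j hj hji
          rcases lt_or_gt_of_ne hji with h | h
          · rw [ih j h (by omega), zero_mul]
          · rw [Nat.descFactorial_of_lt h, Nat.cast_zero, mul_zero]
        · intro h
          exact absurd (Finset.mem_range.2 (by omega)) h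
    obtain ⟨i, hi, hci⟩ := hc
    exact hci (hz i hi)
  have hfin : {M : ℕ | χ.IsRoot (M : k)}.Finite :=
    (Polynomial.finite_setOfPred_isRoot hχ0).preimage Nat.cast_injective.injOn
  obtain ⟨N, hN⟩ := hfin.bddAbove
  refine ⟨N, fun M hM h0 => ?_⟩
  have := hN (show χ.IsRoot (M : k) from (heval M).trans h0)
  omega

/-- A power series solution of a linear differential equation is determined by finitely many
of its coefficients. -/
theorem exists_eq_zero_of_coeff_eq_zero {m : ℕ} {p : ℕ → k[X]} (hp : ∃ i ≤ m, p i ≠ 0) :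
    ∃ N : ℕ, ∀ g : k⟦X⟧, ∑ i ∈ Finset.range (m + 1), (p i : k⟦X⟧) * (d⁄dX k)^[i] g = 0 →
      (∀ n ≤ N, coeff n g = 0) → g = 0 := by
  classical
  set b : ℕ → k[X] := fun i => Polynomial.X ^ (m - i) * p i with hb
  have hex : ∃ u, ∃ i ≤ m, (b i).coeff u ≠ 0 := by
    obtain ⟨i, hi, hpi⟩ := hp
    have h1 : b i ≠ 0 := mul_ne_zero (pow_ne_zero _ Polynomial.X_ne_zero) hpi
    exact ⟨(b i).natDegree, i, hi, Polynomial.leadingCoeff_ne_zero.2 h1⟩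
  set e := Nat.find hex with he
  have hmin : ∀ u < e, ∀ i ≤ m, (b i).coeff u = 0 := by
    intro u hu i hi
    by_contra h
    exact Nat.find_min hex hu ⟨i, hi, h⟩
  obtain ⟨N, hN⟩ := exists_sum_descFactorial_ne_zero (c := fun i => (b i).coeff e)
    (Nat.find_spec hex)
  refine ⟨N, fun g hg hg0 => ?_⟩
  by_contra hne
  obtain ⟨M, hM, hMmin⟩ : ∃ M, coeff M g ≠ 0 ∧ ∀ n < M, coeff n g = 0 := by
    have hex' : ∃ M, coeff M g ≠ 0 := by
      by_contra! h
      exact hne (PowerSeries.ext fun n => by rw [h n, map_zero])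
    exact ⟨Nat.find hex', Nat.find_spec hex', fun n hn => by
      have := Nat.find_min hex' hn
      push Not at this
      exact this⟩
  have hMN : N < M := by
    by_contra h
    exact hM (hg0 M (by omega))
  have hθ : ∀ i n, coeff n ((X : k⟦X⟧) ^ i * (d⁄dX k)^[i] g) = (n.descFactorial i : k) * coeff n g := by
    intro i n
    rw [coeff_X_pow_mul']
    split_ifs with h
    · obtain ⟨l, rfl⟩ := Nat.exists_eq_add_of_le h
      rw [Nat.add_sub_cancel_left, coeff_iterate_derivative, add_comm l i]
      congr 2
      rw [add_comm i l, Nat.add_descFactorial_eq_ascFactorial]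
    · rw [Nat.descFactorial_of_lt (by omega), Nat.cast_zero, zero_mul]
  have h1 : ∑ i ∈ Finset.range (m + 1),
      (b i : k⟦X⟧) * ((X : k⟦X⟧) ^ i * (d⁄dX k)^[i] g) = 0 := by
    have h2 : ∀ i ∈ Finset.range (m + 1), (b i : k⟦X⟧) * ((X : k⟦X⟧) ^ i * (d⁄dX k)^[i] g) =
        (X : k⟦X⟧) ^ m * ((p i : k⟦X⟧) * (d⁄dX k)^[i] g) := by
      intro i hi
      have h3 : (X : k⟦X⟧) ^ m = X ^ (m - i) * X ^ i := by
        rw [← pow_add, Nat.sub_add_cancel (by simpa [Nat.lt_succ_iff] using hi)]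
      rw [h3, hb]
      push_cast
      ring
    rw [Finset.sum_congr rfl h2, ← Finset.mul_sum, hg, mul_zero]
  have h2 := congrArg (coeff (e + M)) h1
  rw [map_sum, map_zero] at h2
  have h3 : ∀ i ∈ Finset.range (m + 1),
      coeff (e + M) ((b i : k⟦X⟧) * ((X : k⟦X⟧) ^ i * (d⁄dX k)^[i] g)) =
        (b i).coeff e * (M.descFactorial i : k) * coeff M g := by
    intro i hi
    have him : i ≤ m := by simpa [Nat.lt_succ_iff] using hi
    rw [coeff_mul, Finset.sum_eq_single (e, M)]
    · rw [hθ, Polynomial.coeff_coe, mul_assoc]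
    · rintro ⟨u, v⟩ huv hne'
      rw [Finset.HasAntidiagonal.mem_antidiagonal] at huv
      rw [hθ, Polynomial.coeff_coe]
      rcases lt_or_ge u e with h | h
      · rw [hmin u h i him, zero_mul]
      · have hv : v < M := by
          rcases lt_or_ge v M with h' | h'
          · exact h'
          · exact absurd (Prod.ext (by simp at huv ⊢; omega) (by simp at huv ⊢; omega)) hne'
        rw [hMmin v hv, mul_zero, mul_zero]
    · intro h
      exact (h (Finset.HasAntidiagonal.mem_antidiagonal.2 rfl)).elim
  rw [Finset.sum_congr rfl h3, ← Finset.sum_mul] at h2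
  exact (mul_ne_zero (hN M hMN) hM) h2

/-- The coefficients of a solution of a linear differential equation over `K` lie in `K` as soon
as finitely many of them do. -/
theorem exists_coeff_mem_subfield {m : ℕ} {p : ℕ → k[X]} (hp : ∃ i ≤ m, p i ≠ 0) :
    ∃ N : ℕ, ∀ (K : Subfield k) (g : k⟦X⟧), (∀ i ≤ m, ∀ n, (p i).coeff n ∈ K) →
      ∑ i ∈ Finset.range (m + 1), (p i : k⟦X⟧) * (d⁄dX k)^[i] g = 0 →
      (∀ n ≤ N, coeff n g ∈ K) → ∀ n, coeff n g ∈ K := by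
  obtain ⟨N, hN⟩ := exists_eq_zero_of_coeff_eq_zero hp
  refine ⟨N, fun K g hK hg hgN => ?_⟩
  obtain ⟨l, hl⟩ := LinearMap.exists_leftInverse_of_injective (Algebra.linearMap K k)
    (LinearMap.ker_eq_bot.2 (algebraMap K k).injective)
  have hl1 : ∀ x : K, l (algebraMap K k x) = x := fun x => LinearMap.congr_fun hl x
  let ρ : k →ₗ[K] k := (Algebra.linearMap K k).comp l
  have hρ : ∀ x ∈ K, ρ x = x := fun x hx => by
    change algebraMap K k (l (algebraMap K k ⟨x, hx⟩)) = x
    rw [hl1]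
    rfl
  have hρmul : ∀ x ∈ K, ∀ y, ρ (x * y) = x * ρ y := fun x hx y => ρ.map_smul ⟨x, hx⟩ y
  let g' : k⟦X⟧ := PowerSeries.mk fun n => ρ (coeff n g)
  have hg' : ∑ i ∈ Finset.range (m + 1), (p i : k⟦X⟧) * (d⁄dX k)^[i] g' = 0 := by
    ext n
    have h1 := congrArg ρ (congrArg (coeff n) hg)
    rw [map_zero, map_zero, map_sum, map_sum] at h1
    rw [map_sum, map_zero, ← h1]
    refine Finset.sum_congr rfl fun i hi => ?_
    rw [coeff_mul, coeff_mul, map_sum]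
    refine Finset.sum_congr rfl fun q _ => ?_
    rw [Polynomial.coeff_coe, hρmul _ (hK i (Nat.lt_succ_iff.1 (Finset.mem_range.1 hi)) _),
      coeff_iterate_derivative, coeff_iterate_derivative, coeff_mk, ← nsmul_eq_mul,
      ← nsmul_eq_mul, map_nsmul]
  have h0 := hN (g - g') (by
    have h2 : ∀ i, (d⁄dX k)^[i] (g - g') = (d⁄dX k)^[i] g - (d⁄dX k)^[i] g' := fun i => by
      simp
    simp only [h2, mul_sub, Finset.sum_sub_distrib]
    rw [hg, hg', sub_zero]) (fun n hn => by
      rw [map_sub, coeff_mk, hρ _ (hgN n hn), sub_self])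
  intro n
  rw [sub_eq_zero.1 h0, coeff_mk]
  exact (l (coeff n g)).2

end Recurrence

section Transfer
open PowerSeries
variable {k l : Type*} [Field k] [CharZero k] [Field l] [CharZero l]

theorem map_mem_oneSpan {A : Type*} {F : A → k⟦X⟧} (ψ : k⟦X⟧ →+* l⟦X⟧)
    (hψ : ∀ p : k[X], ∃ p' : l[X], ψ p = p') {x : k⟦X⟧} (hx : x ∈ oneSpan F) :
    ψ x ∈ oneSpan fun a => ψ (F a) := by
  induction hx using Submodule.span_induction with
  | mem x hx =>
    rcases hx with rfl | ⟨a, rfl⟩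
    · rw [map_one]
      exact one_mem_oneSpan _
    · exact mem_oneSpan (fun a => ψ (F a)) a
  | zero => rw [map_zero]; exact zero_mem _
  | add x y _ _ hx hy => rw [map_add]; exact add_mem hx hy
  | smul p x _ hx =>
    obtain ⟨p', hp'⟩ := hψ p
    rw [smul_ps, map_mul, hp', ← smul_ps]
    exact Submodule.smul_mem _ _ hx

theorem map_mem_adjoin {A : Type*} {F : A → k⟦X⟧} (ψ : k⟦X⟧ →+* l⟦X⟧)
    (hψ : ∀ p : k[X], ∃ p' : l[X], ψ p = p') {x : k⟦X⟧}
    (hx : x ∈ Algebra.adjoin k[X] (Set.range F)) :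
    ψ x ∈ Algebra.adjoin l[X] (Set.range fun a => ψ (F a)) := by
  induction hx using Algebra.adjoin_induction with
  | mem x hx =>
    obtain ⟨a, rfl⟩ := hx
    exact Algebra.subset_adjoin ⟨a, rfl⟩
  | algebraMap p =>
    obtain ⟨p', hp'⟩ := hψ p
    rw [algebraMap_ps, hp', ← algebraMap_ps]
    exact Subalgebra.algebraMap_mem _ _
  | add x y _ _ hx hy => rw [map_add]; exact add_mem hx hy
  | mul x y _ _ hx hy => rw [map_mul]; exact mul_mem hx hy

theorem rescale_coe (a : k) (p : k[X]) :
    rescale a (p : k⟦X⟧) = ((p.comp (Polynomial.C a * Polynomial.X) : k[X]) : k⟦X⟧) := by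
  ext n
  rw [coeff_rescale, Polynomial.coeff_coe, Polynomial.coeff_coe, Polynomial.comp_C_mul_X_coeff,
    mul_comm]

theorem derivative_rescale (a : k) (f : k⟦X⟧) :
    d⁄dX k (rescale a f) = C a * rescale a (d⁄dX k f) := by
  ext n
  rw [coeff_derivative, coeff_rescale, coeff_C_mul, coeff_rescale, coeff_derivative]
  ring

theorem iterate_derivative_map (ψ : k →+* l) (f : k⟦X⟧) (i : ℕ) :
    (d⁄dX l)^[i] (PowerSeries.map ψ f) = PowerSeries.map ψ ((d⁄dX k)^[i] f) := by
  ext n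
  simp [coeff_iterate_derivative]

theorem derivative_map (ψ : k →+* l) (f : k⟦X⟧) :
    d⁄dX l (PowerSeries.map ψ f) = PowerSeries.map ψ (d⁄dX k f) := by
  ext n
  simp [coeff_derivative]

end Transfer

section System
open PowerSeries
variable {k : Type*} [Field k] [CharZero k]

/-- A solution of a nontrivial linear differential equation is part of a differential system. -/
theorem exists_leading_equation {m : ℕ} {p : ℕ → k[X]} (hp : ∃ i ≤ m, p i ≠ 0) {f : k⟦X⟧}
    (hf : ∑ i ∈ Finset.range (m + 1), (p i : k⟦X⟧) * (d⁄dX k)^[i] f = 0) :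
    ∃ (n : ℕ) (T : k[X]), T ≠ 0 ∧ (T : k⟦X⟧) * (d⁄dX k)^[n] f ∈
      Submodule.span k[X] (Set.range fun j : Fin n => (d⁄dX k)^[j] f) := by
  classical
  induction m with
  | zero =>
    obtain ⟨i, hi, hpi⟩ := hp
    obtain rfl : i = 0 := by omega
    refine ⟨0, p 0, hpi, ?_⟩
    have h1 : (p 0 : k⟦X⟧) * (d⁄dX k)^[0] f = 0 := by simpa using hf
    rw [h1]
    exact zero_mem _
  | succ m ih =>
    by_cases h0 : p (m + 1) = 0
    · refine ih ?_ ?_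
      · obtain ⟨i, hi, hpi⟩ := hp
        refine ⟨i, ?_, hpi⟩
        rcases Nat.lt_or_ge i (m + 1) with h | h
        · omega
        · obtain rfl : i = m + 1 := by omega
          exact absurd h0 hpi
      · rw [Finset.sum_range_succ, h0] at hf
        simpa using hf
    · refine ⟨m + 1, p (m + 1), h0, ?_⟩
      rw [Finset.sum_range_succ] at hf
      rw [eq_neg_of_add_eq_zero_right hf]
      refine neg_mem (sum_mem fun i hi => ?_)
      rw [← smul_ps]
      exact Submodule.smul_mem _ _ (Submodule.subset_span ⟨⟨i, Finset.mem_range.1 hi⟩, rfl⟩)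

/-- Finitely many solutions of linear differential equations lie in the algebra generated by a
differential system formed by their derivatives. -/
theorem exists_system {r : ℕ} {f : Fin r → k⟦X⟧}
    (hf : ∀ i, ∃ (n : ℕ) (T : k[X]), T ≠ 0 ∧ (T : k⟦X⟧) * (d⁄dX k)^[n] (f i) ∈
      Submodule.span k[X] (Set.range fun j : Fin n => (d⁄dX k)^[j] (f i))) :
    ∃ (s : ℕ) (F : Fin s → k⟦X⟧) (T : k[X]), T ≠ 0 ∧
      (∀ a, (T : k⟦X⟧) * d⁄dX k (F a) ∈ oneSpan F) ∧
      (∀ i, f i ∈ Algebra.adjoin k[X] (Set.range F)) ∧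
      ∀ a, ∃ (i : Fin r) (j : ℕ), F a = (d⁄dX k)^[j] (f i) := by
  classical
  choose n T hT hspan using hf
  let e := Fintype.equivFin (Σ i : Fin r, Fin (n i))
  let G : (Σ i : Fin r, Fin (n i)) → k⟦X⟧ := fun a => (d⁄dX k)^[a.2] (f a.1)
  let F := G ∘ e.symm
  have hrange : Set.range F = Set.range G := e.symm.surjective.range_comp G
  have hG : ∀ a, G a ∈ oneSpan F := fun a => by
    rw [oneSpan, hrange]
    exact Submodule.subset_span (Or.inr ⟨a, rfl⟩)
  have hle : ∀ i, Submodule.span k[X] (Set.range fun j : Fin (n i) => (d⁄dX k)^[j] (f i)) ≤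
      oneSpan F := fun i => by
    rw [Submodule.span_le]
    rintro _ ⟨j, rfl⟩
    exact hG ⟨i, j⟩
  have hTi : ∀ i, ((∏ i, T i : k[X]) : k⟦X⟧) * (d⁄dX k)^[n i] (f i) ∈ oneSpan F := fun i => by
    rw [← Finset.prod_erase_mul _ _ (Finset.mem_univ i), Polynomial.coe_mul, mul_assoc, ← smul_ps]
    exact Submodule.smul_mem _ _ (hle i (hspan i))
  refine ⟨_, F, ∏ i, T i, Finset.prod_ne_zero_iff.2 fun i _ => hT i, fun a => ?_, fun i => ?_,
    fun a => ⟨_, _, rfl⟩⟩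
  · have key : ∀ b, ((∏ i, T i : k[X]) : k⟦X⟧) * d⁄dX k (G b) ∈ oneSpan F := by
      rintro ⟨i, j⟩
      change _ * d⁄dX k ((d⁄dX k)^[j] (f i)) ∈ _
      rw [← Function.iterate_succ_apply' (d⁄dX k)]
      rcases Nat.lt_or_ge (j + 1) (n i) with h | h
      · rw [← smul_ps]
        exact Submodule.smul_mem _ _ (hG ⟨i, ⟨j + 1, h⟩⟩)
      · have hj : (j : ℕ).succ = n i := by have := j.2; omega
        rw [hj]
        exact hTi i
    exact key _
  · rcases Nat.eq_zero_or_pos (n i) with h | h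
    · have h1 := hspan i
      have h2 : Set.range (fun j : Fin (n i) => (d⁄dX k)^[j] (f i)) = ∅ := by
        rw [Set.range_eq_empty_iff, h]
        infer_instance
      rw [h2, Submodule.span_empty, Submodule.mem_bot, h] at h1
      have h3 : (T i : k⟦X⟧) ≠ 0 := by
        rw [Ne, Polynomial.coe_eq_zero_iff]
        exact hT i
      have h4 : f i = 0 := (mul_eq_zero.1 h1).resolve_left h3
      rw [h4]
      exact zero_mem _
    · rw [hrange]
      exact Algebra.subset_adjoin ⟨⟨i, ⟨0, h⟩⟩, rfl⟩

end System

section AtPoint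
open PowerSeries
variable {K : Type*} [Field K] [NumberField K] [Algebra K ℂ]

/-- An element of the algebra generated by a differential system of `E`-functions which vanishes
at the regular point `α` is divisible by `z - α` in this algebra. -/
theorem exists_eq_mul_of_evalEntire_eq_zero {s : ℕ} {F : Fin s → K⟦X⟧} (hF : ∀ a, IsEB (F a))
    {T : K[X]} {α : K} (hα : α ≠ 0) (hT : T.eval α ≠ 0)
    (hst : ∀ a, (T : K⟦X⟧) * d⁄dX K (F a) ∈ oneSpan F) {x : K⟦X⟧}
    (hx : x ∈ Algebra.adjoin K[X] (Set.range F))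
    (h0 : evalEntire (algebraMap K ℂ α)
      ⟨PowerSeries.map (algebraMap K ℂ) x, (isEB_of_mem_adjoin hF hx).isEntire _⟩ = 0) :
    ∃ q ∈ Algebra.adjoin K[X] (Set.range F),
      x = ((Polynomial.X - Polynomial.C α : K[X]) : K⟦X⟧) * q := by
  have hpoly : ∀ (a : K) (p : K[X]), ∃ p' : K[X], rescale a (p : K⟦X⟧) = p' := fun a p =>
    ⟨_, rescale_coe a p⟩
  have hx' := map_mem_adjoin (rescale α) (hpoly α) hx
  obtain ⟨q, hq, hxq⟩ := exists_eq_mul_of_evEB_eq_zero (F := fun a => rescale α (F a))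
    (Q := T.comp (Polynomial.C α * Polynomial.X)) (x := rescale α x)
    (fun a => (hF a).rescale α) (by simpa using hT) (fun a => by
      rw [derivative_rescale, ← rescale_coe, mul_left_comm, ← map_mul, ← Polynomial.coe_C,
        ← smul_ps]
      exact Submodule.smul_mem _ _ (map_mem_oneSpan (rescale α) (hpoly α) (hst a))) hx' (by
      rw [evEB_apply, evalEntire_apply, ← h0, evalEntire_apply]
      refine tsum_congr fun ν => ?_
      simp [coeff_rescale, mul_comm])
  have hres : ∀ y : K⟦X⟧, rescale α⁻¹ (rescale α y) = y := fun y => by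
    ext n
    rw [coeff_rescale, coeff_rescale, ← mul_assoc, ← mul_pow, inv_mul_cancel₀ hα, one_pow, one_mul]
  have hq' := map_mem_adjoin (rescale α⁻¹) (hpoly α⁻¹) hq
  simp only [hres] at hq'
  refine ⟨(Polynomial.C α⁻¹ : K[X]) • rescale α⁻¹ q, Subalgebra.smul_mem _ hq' _, ?_⟩
  have h1 := congrArg (rescale α⁻¹) hxq
  rw [hres, map_mul, rescale_coe] at h1
  rw [h1, smul_ps, ← mul_assoc, ← Polynomial.coe_mul]
  congr 2
  simp only [Polynomial.sub_comp, Polynomial.X_comp, Polynomial.C_comp, sub_mul]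
  rw [← Polynomial.C_mul, mul_inv_cancel₀ hα, mul_comm]

end AtPoint

section FieldOfCoefficients
open PowerSeries

theorem psD_eq (f : ℂ⟦X⟧) : psD f = d⁄dX ℂ f := by
  ext n
  rw [psD, coeff_mk, coeff_derivative, mul_comm]

theorem polyPS_apply (p : ℂ[X]) : polyPS p = (p : ℂ⟦X⟧) := rfl

/-- The coefficients of an `E`-function and of a differential equation it satisfies generate a
number field. -/
theorem exists_finiteDimensional_of_isE {a : ℕ → ℂ} (ha : IsE a) :
    ∃ K : IntermediateField ℚ ℂ, FiniteDimensional ℚ K ∧ (∀ n, a n ∈ K) ∧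
      ∃ (m : ℕ) (p : ℕ → ℂ[X]), (∃ i ≤ m, p i ≠ 0) ∧ (∀ i ≤ m, ∀ n, (p i).coeff n ∈ K) ∧
        ∑ i ∈ Finset.range (m + 1), (p i : ℂ⟦X⟧) * (d⁄dX ℂ)^[i] (ePS a) = 0 := by
  obtain ⟨halg, ⟨m, p, hp, hp0, hsum⟩, -⟩ := ha
  have hD : psD = (d⁄dX ℂ : ℂ⟦X⟧ → ℂ⟦X⟧) := funext psD_eq
  simp only [hD, polyPS_apply] at hsum
  obtain ⟨N, hN⟩ := exists_coeff_mem_subfield hp0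
  set S : Set ℂ := (⋃ i ∈ Set.Iic m, ((p i).coeffs : Set ℂ)) ∪ a '' Set.Iic N with hS
  have hfin : S.Finite := ((Set.finite_Iic m).biUnion fun i _ => Finset.finite_toSet _).union
    ((Set.finite_Iic N).image a)
  have hSint : ∀ x ∈ S, IsIntegral ℚ x := by
    rintro x (hx | ⟨n, -, rfl⟩)
    · simp only [Set.mem_iUnion] at hx
      obtain ⟨i, -, hx⟩ := hx
      obtain ⟨n, -, rfl⟩ := Polynomial.mem_coeffs_iff.1 hx
      exact (hp i n).isIntegral
    · exact (halg n).isIntegral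
  have : Finite S := hfin
  have hsub : S ⊆ IntermediateField.adjoin ℚ S := IntermediateField.subset_adjoin ℚ S
  have hpK : ∀ i ≤ m, ∀ n, (p i).coeff n ∈ IntermediateField.adjoin ℚ S := by
    intro i hi n
    by_cases h0 : (p i).coeff n = 0
    · rw [h0]
      exact zero_mem _
    · exact hsub (Or.inl (Set.mem_biUnion (show i ∈ Set.Iic m from hi)
        (Polynomial.coeff_mem_coeffs h0)))
  refine ⟨IntermediateField.adjoin ℚ S, IntermediateField.finiteDimensional_adjoin hSint, fun n => ?_,
    m, p, hp0, hpK, hsum⟩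
  have h1 := hN (IntermediateField.adjoin ℚ S).toSubfield (ePS a) hpK hsum (fun n hn => by
    rw [ePS, coeff_mk]
    exact div_mem (S := IntermediateField ℚ ℂ) (hsub (Or.inr ⟨n, hn, rfl⟩)) (natCast_mem _ _)) n
  rw [ePS, coeff_mk] at h1
  have h2 : a n = a n / (n ! : ℂ) * (n ! : ℂ) :=
    (div_mul_cancel₀ _ (Nat.cast_ne_zero.2 n.factorial_ne_zero)).symm
  rw [h2]
  exact mul_mem (S := IntermediateField ℚ ℂ) h1 (natCast_mem _ _)

theorem exists_comp_eq {K L M : Type*} [Field K] [CommRing L] [IsDomain L] [Field M]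
    [IsAlgClosed M] (j : K →+* L) (σ : K →+* M) (hj : j.IsIntegral) :
    ∃ τ : L →+* M, τ.comp j = σ := by
  let _ : Algebra K L := j.toAlgebra
  let _ : Algebra K M := σ.toAlgebra
  have : Algebra.IsIntegral K L := ⟨hj⟩
  exact ⟨(IsAlgClosed.lift (R := K) (S := L) (M := M)).toRingHom, RingHom.ext fun x =>
    (IsAlgClosed.lift (R := K) (S := L) (M := M)).commutes x⟩

theorem exists_extension_embedding {K : Type*} [Field K] [NumberField K] [Algebra K ℂ]
    (σ : K →+* ℂ) : ∃ τ : integralClosure ℚ ℂ →+* ℂ,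
      ∀ (x : K) (h : algebraMap K ℂ x ∈ integralClosure ℚ ℂ), τ ⟨algebraMap K ℂ x, h⟩ = σ x := by
  have hmem : ∀ x : K, algebraMap K ℂ x ∈ integralClosure ℚ ℂ := fun x =>
    (Algebra.IsIntegral.isIntegral (R := ℚ) x).map (algebraMap K ℂ).toRatAlgHom
  let j : K →+* integralClosure ℚ ℂ := (algebraMap K ℂ).codRestrict (integralClosure ℚ ℂ) hmem
  have hInt : Algebra.IsIntegral ℚ (integralClosure ℚ ℂ) := inferInstance
  obtain ⟨τ, hτ⟩ := exists_comp_eq j σ (fun y => by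
    have h1 : IsIntegral ℚ y := hInt.isIntegral y
    obtain ⟨q, hq, hq0⟩ := h1
    refine ⟨q.map (algebraMap ℚ K), hq.map _, ?_⟩
    rw [Polynomial.eval₂_map, ← hq0]
    congr 1
    exact Subsingleton.elim _ _)
  exact ⟨τ, fun x h => RingHom.congr_fun hτ x⟩

theorem house_le {K : Type*} [Field K] [NumberField K] {x : K} {B : ℝ}
    (h : ∀ σ : K →+* ℂ, ‖σ x‖ ≤ B) : house x ≤ B := by
  have hB : 0 ≤ B := (norm_nonneg _).trans (h (Classical.arbitrary _))
  exact (pi_norm_le_iff_of_nonneg hB).2 h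

theorem isEB_of_isE {K : Type*} [Field K] [NumberField K] [Algebra K ℂ] {a : ℕ → ℂ} (ha : IsE a)
    {f : K⟦X⟧} (hf : PowerSeries.map (algebraMap K ℂ) f = ePS a) : IsEB f := by
  obtain ⟨halg, -, C, hC, d, hd⟩ := ha
  have hcoeff : ∀ n, algebraMap K ℂ ((n ! : K) * coeff n f) = a n := by
    intro n
    have h1 := congrArg (coeff n) hf
    rw [coeff_map, ePS, coeff_mk] at h1
    rw [map_mul, h1, map_natCast, mul_div_cancel₀ _ (Nat.cast_ne_zero.2 n.factorial_ne_zero)]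
  have hinj : Function.Injective (algebraMap K ℂ) := (algebraMap K ℂ).injective
  obtain ⟨d₀, hd₀, hInt₀⟩ := exists_nat_mul_isIntegral ((0 ! : K) * coeff 0 f)
  obtain ⟨c, hc⟩ := exists_nat_ge (C + house ((0 ! : K) * coeff 0 f))
  have hh0 := house_nonneg ((0 ! : K) * coeff 0 f)
  have hCc : C ≤ ((c + d₀ : ℕ) : ℝ) := by
    push_cast
    have : (0 : ℝ) ≤ d₀ := Nat.cast_nonneg _
    linarith
  have h1c : (1 : ℝ) ≤ ((c + d₀ : ℕ) : ℝ) := by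
    exact_mod_cast (by omega : 1 ≤ c + d₀)
  have hCpow : ∀ n, C ^ n ≤ ((c + d₀ : ℕ) : ℝ) ^ n := fun n => by gcongr
  refine isEB_iff.2 ⟨c + d₀, by omega, fun μ => ?_, fun ν => ?_⟩
  · rcases Nat.eq_zero_or_pos μ with rfl | hμ
    · rw [zero_add, pow_one]
      push_cast
      have : (0 : ℝ) ≤ d₀ := Nat.cast_nonneg _
      linarith
    · refine house_le fun σ => ?_
      obtain ⟨τ, hτ⟩ := exists_extension_embedding σ
      have h2 : ∀ h, ‖τ ⟨a μ, h⟩‖ ≤ C ^ μ := (hd μ hμ).2.2.1 τ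
      rw [← hcoeff μ] at h2
      have h3 : algebraMap K ℂ ((μ ! : K) * coeff μ f) ∈ integralClosure ℚ ℂ := by
        rw [hcoeff]
        exact (halg μ).isIntegral
      rw [← hτ _ h3]
      refine (h2 h3).trans ((hCpow μ).trans ?_)
      exact pow_le_pow_right₀ h1c (Nat.le_succ μ)
  · rcases Nat.eq_zero_or_pos ν with rfl | hν
    · refine ⟨d₀, hd₀, by rw [zero_add, pow_one]; omega, fun μ hμ => ?_⟩
      obtain rfl : μ = 0 := by omega
      exact hInt₀
    · obtain ⟨h1, h2, -, h3⟩ := hd ν hν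
      refine ⟨d ν * d₀, Nat.mul_pos h1 hd₀, ?_, fun μ hμ => ?_⟩
      · rw [pow_succ]
        refine Nat.mul_le_mul ?_ (by omega)
        exact_mod_cast h2.trans (hCpow ν)
      · rw [Nat.cast_mul]
        rcases Nat.eq_zero_or_pos μ with rfl | hμ0
        · rw [mul_assoc]
          exact (isIntegral_natCast _).mul hInt₀
        · rw [mul_comm (d ν : K), mul_assoc]
          refine (isIntegral_natCast _).mul ?_
          have h4 := h3 μ hμ0 hμ
          rw [← hcoeff, ← map_natCast (algebraMap K ℂ), ← map_mul] at h4
          exact (isIntegral_algHom_iff (algebraMap K ℂ).toIntAlgHom hinj).1 h4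

end FieldOfCoefficients

section Main
open PowerSeries

theorem exists_numberField_of_isE {r : ℕ} {a : Fin r → ℕ → ℂ} (ha : ∀ i, IsE (a i)) :
    ∃ K : IntermediateField ℚ ℂ, FiniteDimensional ℚ K ∧ (∀ i n, a i n ∈ K) ∧
      ∀ i, ∃ (m : ℕ) (p : ℕ → ℂ[X]), (∃ j ≤ m, p j ≠ 0) ∧ (∀ j ≤ m, ∀ n, (p j).coeff n ∈ K) ∧
        ∑ j ∈ Finset.range (m + 1), (p j : ℂ⟦X⟧) * (d⁄dX ℂ)^[j] (ePS (a i)) = 0 := by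
  choose L hL hmem hode using fun i => exists_finiteDimensional_of_isE (ha i)
  have hle : ∀ i, L i ≤ ⨆ i, L i := le_iSup L
  refine ⟨⨆ i, L i, IntermediateField.finiteDimensional_iSup_of_finite, fun i n => hle i (hmem i n),
    fun i => ?_⟩
  obtain ⟨m, p, h1, h2, h3⟩ := hode i
  exact ⟨m, p, h1, fun j hj n => hle i (h2 j hj n), h3⟩

/-- Finitely many `E`-functions lie in the algebra generated by a differential system of
`E`-functions defined over a number field. -/
theorem exists_system_of_isE {r : ℕ} {a : Fin r → ℕ → ℂ} (ha : ∀ i, IsE (a i)) :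
    ∃ K : IntermediateField ℚ ℂ, FiniteDimensional ℚ K ∧ ∃ f : Fin r → K⟦X⟧,
      (∀ i, PowerSeries.map (algebraMap K ℂ) (f i) = ePS (a i)) ∧
      ∃ (s : ℕ) (F : Fin s → K⟦X⟧) (T : K[X]), T ≠ 0 ∧
        (∀ b, (T : K⟦X⟧) * d⁄dX K (F b) ∈ oneSpan F) ∧
        (∀ i, f i ∈ Algebra.adjoin K[X] (Set.range F)) ∧
        ∀ b, ∃ (i : Fin r) (j : ℕ), F b = (d⁄dX K)^[j] (f i) := by
  obtain ⟨K, hK, hmem, hode⟩ := exists_numberField_of_isE ha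
  let f : Fin r → K⟦X⟧ := fun i => PowerSeries.mk fun n =>
    ⟨a i n / (n ! : ℂ), div_mem (hmem i n) (natCast_mem _ _)⟩
  have hf : ∀ i, PowerSeries.map (algebraMap K ℂ) (f i) = ePS (a i) := fun i => by
    ext n
    rw [coeff_map, coeff_mk, ePS, coeff_mk]
    rfl
  refine ⟨K, hK, f, hf, exists_system fun i => ?_⟩
  obtain ⟨m, p, hp0, hpK, hsum⟩ := hode i
  have hlift : ∀ j, ∃ q : K[X], j ≤ m → q.map (algebraMap K ℂ) = p j := by
    intro j
    by_cases hj : j ≤ m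
    · have h1 : p j ∈ Polynomial.lifts (algebraMap K ℂ) :=
        (Polynomial.lifts_iff_coeff_lifts _).2 fun n => ⟨⟨_, hpK j hj n⟩, rfl⟩
      obtain ⟨q, hq⟩ := (Polynomial.mem_lifts _).1 h1
      exact ⟨q, fun _ => hq⟩
    · exact ⟨0, fun h => absurd h hj⟩
  choose q hq using hlift
  refine exists_leading_equation (m := m) (p := q) ?_ ?_
  · obtain ⟨j, hj, hpj⟩ := hp0
    refine ⟨j, hj, fun h0 => hpj ?_⟩
    rw [← hq j hj, h0, Polynomial.map_zero]
  · apply PowerSeries.map_injective (algebraMap K ℂ) (algebraMap K ℂ).injective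
    rw [map_sum, map_zero, ← hsum]
    refine Finset.sum_congr rfl fun j hj => ?_
    rw [map_mul, ← iterate_derivative_map, hf, ← hq j (Nat.lt_succ_iff.1 (Finset.mem_range.1 hj)),
      Polynomial.polynomial_map_coe]

theorem exists_map_eq {r : ℕ} {K : IntermediateField ℚ ℂ} {P : MvPolynomial (Fin r) ℂ}
    (hP : ∀ w, MvPolynomial.coeff w P ∈ K) :
    ∃ P' : MvPolynomial (Fin r) K, MvPolynomial.map (algebraMap K ℂ) P' = P := by
  have : P ∈ Set.range (MvPolynomial.map (algebraMap K ℂ)) := by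
    rw [MvPolynomial.mem_range_map_iff_coeffs_subset]
    intro c hc
    obtain ⟨w, -, rfl⟩ := MvPolynomial.mem_coeffs_iff.1 hc
    exact ⟨⟨_, hP w⟩, rfl⟩
  exact this

/-- The number field generated by a number field, an algebraic number and the coefficients of a
polynomial. -/
theorem exists_field_extension {r : ℕ} (K₀ : IntermediateField ℚ ℂ) [FiniteDimensional ℚ K₀] {α : ℂ}
    (hα : IsAlgebraic ℚ α) {P : MvPolynomial (Fin r) ℂ}
    (hP : ∀ w, IsAlgebraic ℚ (MvPolynomial.coeff w P)) :
    ∃ K : IntermediateField ℚ ℂ, FiniteDimensional ℚ K ∧ K₀ ≤ K ∧ α ∈ K ∧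
      ∀ w, MvPolynomial.coeff w P ∈ K := by
  classical
  set S : Set ℂ := insert α (P.coeffs : Set ℂ) with hS
  have hfin : S.Finite := (Finset.finite_toSet _).insert α
  have : Finite S := hfin
  have hSint : ∀ x ∈ S, IsIntegral ℚ x := by
    rintro x (rfl | hx)
    · exact hα.isIntegral
    · obtain ⟨w, -, rfl⟩ := MvPolynomial.mem_coeffs_iff.1 hx
      exact (hP w).isIntegral
  have hfd : FiniteDimensional ℚ (IntermediateField.adjoin ℚ S) :=
    IntermediateField.finiteDimensional_adjoin hSint
  have hsub : S ⊆ (K₀ ⊔ IntermediateField.adjoin ℚ S : IntermediateField ℚ ℂ) :=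
    (IntermediateField.subset_adjoin ℚ S).trans
      (le_sup_right : IntermediateField.adjoin ℚ S ≤ K₀ ⊔ IntermediateField.adjoin ℚ S)
  refine ⟨K₀ ⊔ IntermediateField.adjoin ℚ S, IntermediateField.finiteDimensional_sup _ _,
    le_sup_left, hsub (Set.mem_insert _ _), fun w => ?_⟩
  by_cases h0 : MvPolynomial.coeff w P = 0
  · rw [h0]
    exact zero_mem _
  · exact hsub (Or.inr (MvPolynomial.coeff_mem_coeffs w h0))

theorem IsEB.iterate_derivative {K : Type*} [Field K] [NumberField K] {f : K⟦X⟧} (hf : IsEB f)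
    (j : ℕ) : IsEB ((d⁄dX K)^[j] f) := by
  induction j with
  | zero => exact hf
  | succ j ih =>
    rw [Function.iterate_succ_apply']
    exact ih.derivative

/-- A polynomial relation between the values of `E`-functions at a regular point comes from a
divisibility in the algebra generated by the differential system. -/
theorem exists_eq_mul_of_eval_eq_zero {K : Type*} [Field K] [NumberField K] [Algebra K ℂ] {r s : ℕ}
    {a : Fin r → ℕ → ℂ} {f : Fin r → K⟦X⟧}
    (hf : ∀ i, PowerSeries.map (algebraMap K ℂ) (f i) = ePS (a i)) {F : Fin s → K⟦X⟧}
    (hF : ∀ b, IsEB (F b)) {T : K[X]} {α : K} (hα : α ≠ 0) (hT : T.eval α ≠ 0)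
    (hst : ∀ b, (T : K⟦X⟧) * d⁄dX K (F b) ∈ oneSpan F)
    (hfF : ∀ i, f i ∈ Algebra.adjoin K[X] (Set.range F)) {P : MvPolynomial (Fin r) K}
    (hP : MvPolynomial.eval₂ (algebraMap K ℂ) (fun i => evalE (a i) (algebraMap K ℂ α)) P = 0) :
    ∃ q ∈ Algebra.adjoin K[X] (Set.range F), MvPolynomial.eval₂ C f P =
      ((Polynomial.X - Polynomial.C α : K[X]) : K⟦X⟧) * q := by
  have hmem : MvPolynomial.eval₂ C f P ∈ Algebra.adjoin K[X] (Set.range F) := by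
    rw [MvPolynomial.eval₂_eq']
    refine sum_mem fun w _ => mul_mem ?_ (prod_mem fun i _ => pow_mem (hfF i) _)
    rw [← Polynomial.coe_C, ← algebraMap_ps]
    exact Subalgebra.algebraMap_mem _ _
  refine exists_eq_mul_of_evalEntire_eq_zero hF hα hT hst hmem ?_
  let g : Fin r → entire := fun i => ⟨PowerSeries.map (algebraMap K ℂ) (f i),
    (isEB_of_mem_adjoin hF (hfF i)).isEntire _⟩
  have h1 : (⟨PowerSeries.map (algebraMap K ℂ) (MvPolynomial.eval₂ C f P),
      (isEB_of_mem_adjoin hF hmem).isEntire _⟩ : entire) =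
      MvPolynomial.eval₂ ((algebraMap ℂ entire).comp (algebraMap K ℂ)) g P := by
    apply Subtype.ext
    change PowerSeries.map (algebraMap K ℂ) (MvPolynomial.eval₂ C f P) =
      entire.val (MvPolynomial.eval₂ ((algebraMap ℂ entire).comp (algebraMap K ℂ)) g P)
    rw [MvPolynomial.hom_eval₂, ← AlgHom.coe_toRingHom, MvPolynomial.hom_eval₂]
    congr 1
    ext x : 1
    change PowerSeries.map (algebraMap K ℂ) (C x) = C (algebraMap K ℂ x)
    rw [map_C]
  rw [h1, ← AlgHom.coe_toRingHom, MvPolynomial.hom_eval₂, ← hP]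
  congr 1
  · ext x
    exact (evalEntire (algebraMap K ℂ α)).commutes _
  · funext i
    change evalEntire (algebraMap K ℂ α) (g i) = _
    rw [evalEntire_apply, evalE]
    refine tsum_congr fun ν => ?_
    change coeff ν (PowerSeries.map (algebraMap K ℂ) (f i)) * _ = _
    rw [hf, ePS, coeff_mk]

end Main

section Sporadic
open PowerSeries

theorem exists_map_polynomial {k l : Type*} [Field k] [Field l] (ψ : k →+* l) (p : k[X]) :
    ∃ p' : l[X], PowerSeries.map ψ (p : k⟦X⟧) = p' :=
  ⟨p.map ψ, (Polynomial.polynomial_map_coe).symm⟩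

/-- `exists_eq_mul_of_eval_eq_zero` for a system defined over a smaller field. -/
theorem exists_eq_mul_of_hom {K₀ K : Type*} [Field K₀] [CharZero K₀] [Algebra K₀ ℂ] [Field K]
    [NumberField K] [Algebra K ℂ] (ψ : K₀ →+* K)
    (hψ : (algebraMap K ℂ).comp ψ = algebraMap K₀ ℂ) {r s : ℕ} {a : Fin r → ℕ → ℂ}
    (ha : ∀ i, IsE (a i)) {f : Fin r → K₀⟦X⟧}
    (hf : ∀ i, PowerSeries.map (algebraMap K₀ ℂ) (f i) = ePS (a i)) {F : Fin s → K₀⟦X⟧} {T : K₀[X]}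
    (hst : ∀ b, (T : K₀⟦X⟧) * d⁄dX K₀ (F b) ∈ oneSpan F)
    (hfF : ∀ i, f i ∈ Algebra.adjoin K₀[X] (Set.range F))
    (hder : ∀ b, ∃ (i : Fin r) (j : ℕ), F b = (d⁄dX K₀)^[j] (f i))
    {α : K} (hα : α ≠ 0) (hT : (T.map ψ).eval α ≠ 0) {P : MvPolynomial (Fin r) K}
    (hP : MvPolynomial.eval₂ (algebraMap K ℂ) (fun i => evalE (a i) (algebraMap K ℂ α)) P = 0) :
    ∃ q ∈ Algebra.adjoin K[X] (Set.range fun b => PowerSeries.map ψ (F b)),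
      MvPolynomial.eval₂ C (fun i => PowerSeries.map ψ (f i)) P =
        ((Polynomial.X - Polynomial.C α : K[X]) : K⟦X⟧) * q := by
  have hf' : ∀ i, PowerSeries.map (algebraMap K ℂ) (PowerSeries.map ψ (f i)) = ePS (a i) :=
    fun i => by rw [← RingHom.comp_apply, ← PowerSeries.map_comp, hψ, hf]
  refine exists_eq_mul_of_eval_eq_zero hf' (fun b => ?_) hα hT (fun b => ?_)
    (fun i => map_mem_adjoin _ (exists_map_polynomial ψ) (hfF i)) hP
  · obtain ⟨i, j, h⟩ := hder b
    rw [h, ← iterate_derivative_map]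
    exact (isEB_of_isE (ha i) (hf' i)).iterate_derivative j
  · rw [derivative_map, Polynomial.polynomial_map_coe, ← map_mul]
    exact map_mem_oneSpan _ (exists_map_polynomial ψ) (hst b)

/-- A homogeneous relation over a field of algebraic numbers yields a banal one. -/
theorem banal_of_relation {k : Type*} [Field k] [CharZero k] [Algebra k ℂ]
    (hk : ∀ x : k, IsAlgebraic ℚ (algebraMap k ℂ x)) {r : ℕ} {a : Fin r → ℕ → ℂ} {f : Fin r → k⟦X⟧}
    (hf : ∀ i, PowerSeries.map (algebraMap k ℂ) (f i) = ePS (a i)) {α : k}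
    {Q : MvPolynomial (Fin r) k[X]} {d : ℕ} (hQ : Q.IsHomogeneous d)
    (hQf : MvPolynomial.aeval f Q = 0) :
    Banal (fun i => ePS (a i)) (algebraMap k ℂ α) (MvPolynomial.map (algebraMap k ℂ)
      (MvPolynomial.map (Polynomial.evalRingHom α) Q)) := by
  refine ⟨MvPolynomial.map (Polynomial.mapRingHom (algebraMap k ℂ)) Q, fun v j => ?_, ⟨d, hQ.map _⟩,
    ?_, ?_⟩
  · rw [MvPolynomial.coeff_map, Polynomial.coe_mapRingHom, Polynomial.coeff_map]
    exact hk _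
  · rw [MvPolynomial.eval₂_map]
    have h := congrArg (PowerSeries.map (algebraMap k ℂ)) hQf
    rw [map_zero, MvPolynomial.aeval_def, MvPolynomial.hom_eval₂] at h
    rw [← h]
    congr 1
    · refine RingHom.ext fun p => ?_
      simp only [RingHom.comp_apply, polyPS_apply, algebraMap_ps, Polynomial.coe_mapRingHom,
        ← Polynomial.polynomial_map_coe]
    · funext i
      exact (hf i).symm
  · rw [MvPolynomial.map_map, MvPolynomial.map_map]
    congr 2
    refine RingHom.ext fun p => ?_
    simp only [RingHom.comp_apply, Polynomial.coe_mapRingHom, Polynomial.coe_evalRingHom,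
      Polynomial.eval_map, Polynomial.eval₂_at_apply]

/-- Outside a finite set of algebraic numbers every homogeneous relation between the values of
given `E`-functions is banal. -/
theorem exists_finset_nonbanal {r : ℕ} {a : Fin r → ℕ → ℂ} (ha : ∀ i, IsE (a i)) :
    ∃ S : Finset ℂ, (∀ x ∈ S, IsAlgebraic ℚ x) ∧ ∀ α ∉ S, IsAlgebraic ℚ α → α ≠ 0 →
      ∀ (P : MvPolynomial (Fin r) ℂ) (d : ℕ), P.IsHomogeneous d →
        (∀ w, IsAlgebraic ℚ (MvPolynomial.coeff w P)) →
        MvPolynomial.eval (fun i => evalE (a i) α) P = 0 → Banal (fun i => ePS (a i)) α P := by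
  classical
  obtain ⟨K₀, hK₀, f, hf, s, F, T, hT, hst, hfF, hder⟩ := exists_system_of_isE ha
  let k : IntermediateField ℚ ℂ := algebraicClosure ℚ ℂ
  have hle : ∀ K : IntermediateField ℚ ℂ, FiniteDimensional ℚ K → K ≤ k := fun K hK =>
    le_algebraicClosure ℚ ℂ K
  have hk : ∀ x : k, IsAlgebraic ℚ (algebraMap k ℂ x) := fun x => mem_algebraicClosure_iff.1 x.2
  let ι : K₀ →+* k := (IntermediateField.inclusion (hle K₀ hK₀)).toRingHom
  have hι : (algebraMap k ℂ).comp ι = algebraMap K₀ ℂ := rfl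
  let G : Fin s → k⟦X⟧ := fun b => PowerSeries.map ι (F b)
  let A : Subalgebra k[X] k⟦X⟧ := Algebra.adjoin k[X] (Set.range G)
  have hA : Algebra.FiniteType k[X] A := (Subalgebra.fg_iff_finiteType _).1
    ⟨(Set.finite_range G).toFinset, by rw [Set.Finite.coe_toFinset]⟩
  have hA' : FaithfulSMul k[X] A := faithfulSMul_subalgebra A
  let g : Fin r → A := fun i => ⟨PowerSeries.map ι (f i),
    map_mem_adjoin _ (exists_map_polynomial ι) (hfF i)⟩
  obtain ⟨S, hS, hbanal⟩ := exists_finite_banal (k := k) g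
  refine ⟨(hS.toFinset ∪ (T.map ι).roots.toFinset).image (algebraMap k ℂ), fun x hx => ?_,
    fun α hαS hα hα0 P d hPd hPalg hP => ?_⟩
  · obtain ⟨y, -, rfl⟩ := Finset.mem_image.1 hx
    exact hk y
  obtain ⟨K, hK, hK₀K, hαK, hPK⟩ := exists_field_extension K₀ hα hPalg
  obtain ⟨P', rfl⟩ := exists_map_eq hPK
  have : NumberField K := ⟨⟩
  let ψ : K₀ →+* K := (IntermediateField.inclusion hK₀K).toRingHom
  let χ : K →+* k := (IntermediateField.inclusion (hle K hK)).toRingHom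
  have hχψ : χ.comp ψ = ι := rfl
  let β : K := ⟨α, hαK⟩
  have hβS : χ β ∉ S ∧ (T.map ι).eval (χ β) ≠ 0 := by
    constructor
    · exact fun h => hαS
        (Finset.mem_image.2 ⟨χ β, Finset.mem_union_left _ (hS.mem_toFinset.2 h), rfl⟩)
    · refine fun h => hαS (Finset.mem_image.2 ⟨χ β, Finset.mem_union_right _ ?_, rfl⟩)
      rw [Multiset.mem_toFinset, Polynomial.mem_roots (Polynomial.map_ne_zero hT)]
      exact h
  have hTβ : (T.map ψ).eval β ≠ 0 := fun h => hβS.2 (by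
    rw [← hχψ, ← Polynomial.map_map, Polynomial.eval_map, Polynomial.eval₂_at_apply, h, map_zero])
  rw [MvPolynomial.eval_map] at hP
  obtain ⟨q, hq, hqP⟩ := exists_eq_mul_of_hom ψ rfl ha hf hst hfF hder
    (fun h => hα0 (congrArg (algebraMap K ℂ) h) : β ≠ 0) hTβ hP
  have hmap : ∀ u : K₀⟦X⟧, PowerSeries.map χ (PowerSeries.map ψ u) = PowerSeries.map ι u :=
      fun u => by
    rw [← RingHom.comp_apply, ← PowerSeries.map_comp, hχψ]
  have hq' : PowerSeries.map χ q ∈ A := by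
    have := map_mem_adjoin _ (exists_map_polynomial χ) hq
    simp only [hmap] at this
    exact this
  obtain ⟨Q, hQd, hQ0, hQP⟩ := hbanal (χ β) hβS.1 (MvPolynomial.map χ P') d
    ((hPd.of_map (algebraMap K ℂ).injective).map _) ⟨⟨_, hq'⟩, by
      apply Subtype.ext
      have := congrArg (PowerSeries.map χ) hqP
      rw [map_mul, ← Polynomial.polynomial_map_coe, MvPolynomial.hom_eval₂] at this
      rw [Polynomial.map_sub, Polynomial.map_X, Polynomial.map_C] at this
      refine Eq.trans ?_ this
      rw [MvPolynomial.aeval_def, MvPolynomial.eval₂_map, MvPolynomial.eval₂_map]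
      change A.val.toRingHom _ = _
      rw [MvPolynomial.hom_eval₂]
      congr 1
      · refine RingHom.ext fun x => ?_
        change algebraMap k[X] k⟦X⟧ (Polynomial.C (χ x)) = PowerSeries.map χ (C x)
        rw [algebraMap_ps, Polynomial.coe_C, map_C]⟩
  have h1 : MvPolynomial.aeval (fun i => PowerSeries.map ι (f i)) Q = 0 := by
    have := congrArg A.val hQ0
    rw [map_zero] at this
    rw [← this, ← AlgHom.comp_apply, MvPolynomial.comp_aeval]
    rfl
  have h2 : Banal (fun i => ePS (a i)) (algebraMap k ℂ (χ β)) _ :=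
    banal_of_relation hk
      (fun i => by rw [← RingHom.comp_apply, ← PowerSeries.map_comp, hι, hf]) hQd h1
  rw [hQP, MvPolynomial.map_map] at h2
  exact h2

end Sporadic

end EFun

/-- For fixed E-functions `f₁, …, f_r` there is a finite set `S ⊂ ℚ̄` such
that a non-banal homogeneous algebraic relation over `ℚ̄` among `f₁(α), …, f_r(α)` can only
exist when `α ∈ S`. -/
theorem E_nonbanal_relations_sporadic
    (r : ℕ) (a : Fin r → ℕ → ℂ) (hE : ∀ i, IsE (a i)) :
    ∃ S : Finset ℂ, (∀ x ∈ S, IsAlgebraic ℚ x) ∧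
      ∀ α : ℂ, IsAlgebraic ℚ α → α ≠ 0 →
        (∃ (P : MvPolynomial (Fin r) ℂ) (d : ℕ),
            P.IsHomogeneous d ∧
            (∀ w, IsAlgebraic ℚ (MvPolynomial.coeff w P)) ∧
            MvPolynomial.eval (fun i => evalE (a i) α) P = 0 ∧
            ¬ Banal (fun i => ePS (a i)) α P) →
        α ∈ S := by
  obtain ⟨S, hS, h⟩ := EFun.exists_finset_nonbanal hE
  refine ⟨S, hS, fun α hα hα0 ⟨P, d, hPd, hPalg, hP, hnb⟩ => ?_⟩
  by_contra hαS
  exact hnb (h α hαS hα hα0 P d hPd hPalg hP)
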